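/- arXiv:1908.11029 — 9 statements merged into one kernel-verified Lean document; each statement's English description precedes it below -/
import Mathlib

section
/- Let (ψ_k)_{k≥0}, (δ_k)_{k≥1} and (α_k)_{k≥1} be sequences in [0, +∞) such that (a) ψ_{k+1} − ψ_k ≤ α_k (ψ_k − ψ_{k−1}) + δ_k for all k ≥ 1, (b) Σ_{k=1}^∞ δ_k < +∞, and (c) there exists α ∈ [0,1) with 0 ≤ α_k ≤ α for all k ≥ 1. Then (ψ_k) converges (in ℝ) and Σ_{k=1}^∞ max(ψ_{k+1} − ψ_k, 0) < +∞. -/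
open Filter Topology

/-- A nonnegative sequence with `u (k + 1) ≤ a * u k + d k`, where `a < 1` and `d` is nonnegative and
summable, is summable. -/
theorem summable_of_le_mul_add {u d : ℕ → ℝ} {a : ℝ} (ha1 : a < 1)
    (hu : ∀ k, 0 ≤ u k) (hd : ∀ k, 0 ≤ d k) (hdsum : Summable d)
    (h : ∀ k, u (k + 1) ≤ a * u k + d k) : Summable u := by
  refine summable_of_sum_range_le (c := (u 0 + ∑' k, d k) / (1 - a)) hu fun n => ?_
  rw [le_div_iff₀ (by linarith)]
  have hstep : ∑ i ∈ Finset.range n, u (i + 1) ≤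
      a * ∑ i ∈ Finset.range n, u i + ∑ i ∈ Finset.range n, d i := by
    rw [Finset.mul_sum, ← Finset.sum_add_distrib]
    exact Finset.sum_le_sum fun i _ => h i
  have hsum : ∑ i ∈ Finset.range n, d i ≤ ∑' k, d k := hdsum.sum_le_tsum _ fun i _ => hd i
  have hlast := Finset.sum_range_succ u n
  have hfirst := Finset.sum_range_succ' u n
  linarith [hu n]

/-- A real sequence that is bounded below and whose increments have summable positive parts
converges. -/
theorem exists_tendsto_of_summable_posPart_sub {f : ℕ → ℝ} {c : ℝ} (hf : ∀ k, c ≤ f k)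
    (hsum : Summable fun k => max (f (k + 1) - f k) 0) : ∃ l, Tendsto f atTop (𝓝 l) := by
  set p : ℕ → ℝ := fun k => max (f (k + 1) - f k) 0
  have hanti : Antitone fun n => f n - ∑ i ∈ Finset.range n, p i := by
    refine antitone_nat_of_succ_le fun n => ?_
    have hn : f (n + 1) - f n ≤ p n := le_max_left _ _
    rw [Finset.sum_range_succ]
    linarith
  have hbdd : BddBelow (Set.range fun n => f n - ∑ i ∈ Finset.range n, p i) := by
    refine ⟨c - ∑' k, p k, ?_⟩
    rintro _ ⟨n, rfl⟩
    exact sub_le_sub (hf n) (hsum.sum_le_tsum _ fun i _ => le_max_right _ _)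
  refine ⟨_, ((tendsto_atTop_ciInf hanti hbdd).add hsum.hasSum.tendsto_sum_nat).congr fun n => ?_⟩
  exact sub_add_cancel _ _

/-- Lemma (Alvarez–Attouch): if `ψ, δ, α` are nonnegative real sequences with
`ψ_{k+1} − ψ_k ≤ α_k (ψ_k − ψ_{k−1}) + δ_k` for all `k ≥ 1`, `∑_{k≥1} δ_k < ∞` and
`0 ≤ α_k ≤ α < 1`, then `ψ` converges and `∑_{k≥1} [ψ_{k+1} − ψ_k]_+ < ∞`. -/
theorem alvarez_attouch_lemma (ψ δ α : ℕ → ℝ) (a : ℝ)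
    (hψ : ∀ k, 0 ≤ ψ k)
    (hδpos : ∀ k, 1 ≤ k → 0 ≤ δ k)
    (hαpos : ∀ k, 1 ≤ k → 0 ≤ α k)
    (hrec : ∀ k, 1 ≤ k → ψ (k + 1) - ψ k ≤ α k * (ψ k - ψ (k - 1)) + δ k)
    (hδsum : Summable fun k => δ (k + 1))
    (ha0 : 0 ≤ a) (ha1 : a < 1)
    (hαa : ∀ k, 1 ≤ k → α k ≤ a) :
    (∃ l : ℝ, Tendsto ψ atTop (nhds l)) ∧
      Summable fun k => max (ψ (k + 2) - ψ (k + 1)) 0 := by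
  have hsum : Summable fun k => max (ψ (k + 1) - ψ k) 0 := by
    refine summable_of_le_mul_add ha1 (fun k => le_max_right _ _)
      (fun k => hδpos (k + 1) k.succ_pos) hδsum fun k => ?_
    have hk : 1 ≤ k + 1 := k.succ_pos
    have hmax : 0 ≤ max (ψ (k + 1) - ψ k) 0 := le_max_right _ _
    refine max_le ((hrec (k + 1) hk).trans ?_)
      (add_nonneg (mul_nonneg ha0 hmax) (hδpos (k + 1) hk))
    rw [Nat.add_sub_cancel]
    refine add_le_add_left ?_ _
    exact (mul_le_mul_of_nonneg_left (le_max_left _ _) (hαpos (k + 1) hk)).trans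
      (mul_le_mul_of_nonneg_right (hαa (k + 1) hk) hmax)
  exact ⟨exists_tendsto_of_summable_posPart_sub hψ hsum, (summable_nat_add_iff 1).2 hsum⟩
end

section
/- Let H be a real Hilbert space, T : H → H nonexpansive with a fixed point z*, and let z^{−1}, z^0 ∈ H, α_k ≥ 0, λ_k ∈ [0,1], e^k ∈ H, with μ^k = z^k + α_k (z^k − z^{k−1}) and z^{k+1} = μ^k + λ_k (Tμ^k + e^k − μ^k). Then for every k ≥ 0: ‖z^{k+1} − z*‖² ≤ (1 + α_k)‖z^k − z*‖² − α_k ‖z^{k−1} − z*‖² + 2λ_k ‖z^{k+1} − z*‖ ‖e^k‖ + α_k(1 + α_k)‖z^k − z^{k−1}‖² − λ_k (1 − λ_k) ‖Tμ^k − μ^k‖². -/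
open Filter Topology

section InnerProductSpace

variable {E : Type*} [NormedAddCommGroup E] [InnerProductSpace ℝ E]

/-- The squared norm along the line through `a` and `b`. -/
lemma norm_add_smul_sub_sq (a b : E) (t : ℝ) :
    ‖a + t • (b - a)‖ ^ 2 =
      (1 - t) * ‖a‖ ^ 2 + t * ‖b‖ ^ 2 - t * (1 - t) * ‖b - a‖ ^ 2 := by
  rw [norm_add_sq_real, norm_smul, mul_pow, Real.norm_eq_abs, sq_abs, norm_sub_sq_real,
    inner_smul_right, inner_sub_right, real_inner_self_eq_norm_sq, real_inner_comm a b]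
  ring

/-- A perturbation `t • e` with `0 ≤ t` increases the squared norm by at most
`2 * t * ‖w + t • e‖ * ‖e‖`. -/
lemma norm_add_smul_sq_le (w e : E) {t : ℝ} (ht : 0 ≤ t) :
    ‖w + t • e‖ ^ 2 ≤ ‖w‖ ^ 2 + 2 * t * ‖w + t • e‖ * ‖e‖ := by
  have hw : ‖w‖ ^ 2 = ‖w + t • e‖ ^ 2 - 2 * (t * inner ℝ (w + t • e) e) + ‖t • e‖ ^ 2 := by
    rw [← inner_smul_right, ← norm_sub_sq_real, add_sub_cancel_right]
  have hinner := mul_le_mul_of_nonneg_left (real_inner_le_norm (w + t • e) e) ht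
  linarith [sq_nonneg ‖t • e‖]

end InnerProductSpace

/-- The key one-step estimate for the inexact inertial Krasnoselskii–Mann iteration.
Here `z (k+1)` stands for the iterate `z^k` (so `z 0` is the initial point `z^{-1}`),
`μ k` for `μ^k`, `e k` for the error `e^k`. -/
theorem inexact_inertial_KM_key_inequality
    {H : Type*} [NormedAddCommGroup H] [InnerProductSpace ℝ H] [CompleteSpace H]
    (T : H → H) (hT : ∀ x y : H, ‖T x - T y‖ ≤ ‖x - y‖)
    (zs : H) (hzs : T zs = zs)
    (z μ e : ℕ → H) (α lam : ℕ → ℝ)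
    (hα : ∀ k, 0 ≤ α k)
    (hlam : ∀ k, 0 ≤ lam k ∧ lam k ≤ 1)
    (hμ : ∀ k, μ k = z (k + 1) + α k • (z (k + 1) - z k))
    (hz : ∀ k, z (k + 2) = μ k + lam k • (T (μ k) + e k - μ k)) :
    ∀ k : ℕ,
      ‖z (k + 2) - zs‖ ^ 2 ≤
        (1 + α k) * ‖z (k + 1) - zs‖ ^ 2 - α k * ‖z k - zs‖ ^ 2
          + 2 * lam k * ‖z (k + 2) - zs‖ * ‖e k‖
          + α k * (1 + α k) * ‖z (k + 1) - z k‖ ^ 2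
          - lam k * (1 - lam k) * ‖T (μ k) - μ k‖ ^ 2 := by
  intro k
  obtain ⟨hlam_nonneg, -⟩ := hlam k
  have hμ_sub : μ k - zs =
      (z (k + 1) - zs) + (-α k) • ((z k - zs) - (z (k + 1) - zs)) := by
    rw [hμ]
    module
  have hz_sub : z (k + 2) - zs =
      ((μ k - zs) + lam k • ((T (μ k) - zs) - (μ k - zs))) + lam k • e k := by
    rw [hz]
    module
  have hinertial := norm_add_smul_sub_sq (z (k + 1) - zs) (z k - zs) (-α k)
  rw [← hμ_sub, sub_sub_sub_cancel_right, norm_sub_rev (z k) (z (k + 1))] at hinertial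
  have herror := norm_add_smul_sq_le
    ((μ k - zs) + lam k • ((T (μ k) - zs) - (μ k - zs))) (e k) hlam_nonneg
  rw [← hz_sub, norm_add_smul_sub_sq, sub_sub_sub_cancel_right] at herror
  have hfix : ‖T (μ k) - zs‖ ≤ ‖μ k - zs‖ := by
    simpa only [hzs] using hT (μ k) zs
  have hfix_sq : lam k * ‖T (μ k) - zs‖ ^ 2 ≤ lam k * ‖μ k - zs‖ ^ 2 := by
    gcongr
  linarith
end

section
/- Let H be a real Hilbert space and T : H → H nonexpansive with Fix(T) ≠ ∅. Let (z^k), (μ^k) be generated by the inexact inertial Krasnoselskii–Mann iteration and assume conditions (I) hold. Then for every z* ∈ Fix(T), the limit lim_{k→∞} ‖z^k − z*‖ exists. -/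
open Filter Topology

/-- If `V + β * A` is dominated by the preceding `V + (β - γ) * A` up to a summable perturbation,
then `A` is summable. -/
lemma summable_of_lyapunov_step {V A s : ℕ → ℝ} {β γ : ℝ} (hγ : 0 < γ) (hγβ : γ ≤ β)
    (hV : ∀ k, 0 ≤ V k) (hA : ∀ k, 0 ≤ A k) (hs0 : ∀ k, 0 ≤ s k) (hs : Summable s)
    (h : ∀ k, V (k + 1) + β * A (k + 1) ≤ V k + (β - γ) * A k + s k) : Summable A := by
  have key : ∀ n, V n + β * A n + γ * ∑ i ∈ Finset.range n, A i
      ≤ V 0 + β * A 0 + ∑ i ∈ Finset.range n, s i := by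
    intro n
    induction n with
    | zero => simp
    | succ n ih =>
      rw [Finset.sum_range_succ, Finset.sum_range_succ]
      linarith [h n]
  refine summable_of_sum_range_le (c := (V 0 + β * A 0 + ∑' i, s i) / γ) hA fun n => ?_
  rw [le_div_iff₀ hγ]
  have h1 := hs.sum_le_tsum (Finset.range n) fun i _ => hs0 i
  have h2 : 0 ≤ β * A n := mul_nonneg (hγ.le.trans hγβ) (hA n)
  linarith [key n, hV n]

/-- A nonnegative sequence whose increments satisfy an inertial inequality with summable
perturbation converges. -/
lemma exists_tendsto_of_inertial_le {φ α s : ℕ → ℝ} {a : ℝ} (ha1 : a < 1)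
    (hα : ∀ k, 0 ≤ α k ∧ α k ≤ a) (hφ : ∀ k, 0 ≤ φ k) (hs0 : ∀ k, 0 ≤ s k) (hs : Summable s)
    (h : ∀ k, φ (k + 2) - φ (k + 1) ≤ α k * (φ (k + 1) - φ k) + s k) :
    ∃ L, Tendsto φ atTop (𝓝 L) := by
  set p : ℕ → ℝ := fun k => max (φ (k + 1) - φ k) 0 with hp
  have hp0 : ∀ k, 0 ≤ p k := fun k => le_max_right _ _
  have hpφ : ∀ k, φ (k + 1) - φ k ≤ p k := fun k => le_max_left _ _
  have hrec : ∀ k, p (k + 1) ≤ a * p k + s k := by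
    intro k
    have h1 : α k * (φ (k + 1) - φ k) ≤ a * p k :=
      (mul_le_mul_of_nonneg_left (hpφ k) (hα k).1).trans
        (mul_le_mul_of_nonneg_right (hα k).2 (hp0 k))
    have h2 : 0 ≤ a * p k := mul_nonneg ((hα k).1.trans (hα k).2) (hp0 k)
    exact max_le (by linarith [h k]) (by linarith [hs0 k])
  have hpsum : Summable p := by
    refine summable_of_lyapunov_step (V := fun _ => 0) (β := 1) (γ := 1 - a) (by linarith)
      (by linarith [(hα 0).1.trans (hα 0).2]) (fun _ => le_rfl) hp0 hs0 hs fun k => ?_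
    linarith [hrec k]
  have hanti : Antitone fun k => φ k - ∑ i ∈ Finset.range k, p i := by
    refine antitone_nat_of_succ_le fun k => ?_
    rw [Finset.sum_range_succ]
    linarith [hpφ k]
  have hbdd : BddBelow (Set.range fun k => φ k - ∑ i ∈ Finset.range k, p i) := by
    refine ⟨-∑' i, p i, ?_⟩
    rintro _ ⟨k, rfl⟩
    have := hpsum.sum_le_tsum (Finset.range k) fun i _ => hp0 i
    simp only
    linarith [hφ k]
  have hlim := (tendsto_atTop_ciInf hanti hbdd).add hpsum.hasSum.tendsto_sum_nat
  simp only [sub_add_cancel] at hlim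
  exact ⟨_, hlim⟩

section Residuals

variable {H : Type*} [NormedAddCommGroup H] [InnerProductSpace ℝ H]

/-- A relaxed step of length `s` from a point with residual `w` leads to a point whose residual `v`
is shorter, by an amount controlled by the change of the residual. -/
lemma norm_sq_residual_le {v w e : H} {s s' : ℝ} (hs : 0 < s) (hss' : s ≤ s')
    (h : ‖(v - w) + s • (w + e)‖ ≤ ‖s • (w + e)‖) :
    ‖v‖ ^ 2 ≤ ‖w‖ ^ 2 - (1 / s' - 1) * ‖v - w‖ ^ 2 + 2 * ‖v - w‖ * ‖e‖ := by
  obtain ⟨g, rfl⟩ : ∃ g, v = w + g := ⟨v - w, by abel⟩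
  rw [add_sub_cancel_left] at h ⊢
  have h1 := pow_le_pow_left₀ (norm_nonneg _) h 2
  rw [norm_add_sq_real, inner_smul_right, inner_add_right] at h1
  have h2 : -(‖g‖ * ‖e‖) ≤ inner ℝ g e := neg_le_of_abs_le (abs_real_inner_le_norm g e)
  have h3 : ‖g‖ ^ 2 / s + 2 * inner ℝ g w + 2 * inner ℝ g e ≤ 0 := by
    have : s * (‖g‖ ^ 2 / s + 2 * inner ℝ g w + 2 * inner ℝ g e) ≤ 0 := by
      field_simp
      linarith
    exact nonpos_of_mul_nonpos_right this hs
  have h4 : ‖g‖ ^ 2 * (1 / s') ≤ ‖g‖ ^ 2 * (1 / s) := by gcongr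
  rw [norm_add_sq_real, real_inner_comm]
  rw [div_eq_mul_one_div] at h3
  linarith

/-- If inertia is followed by a short step, the residual has changed substantially. -/
lemma mul_norm_le_of_inertial_step {v' w w' d d' d'' e e' : H} {α α' s s' l a : ℝ}
    (hl : 0 < l) (hs : l ≤ s ∧ s ≤ 1) (hs' : l ≤ s' ∧ s' ≤ 1) (hα : 0 ≤ α)
    (hα' : 0 ≤ α' ∧ α' ≤ a)
    (hd' : d' = α • d + s • (w + e)) (hd'' : d'' = α' • d' + s' • (w' + e'))
    (h : ‖v' - w' - α' • d'‖ ≤ α' * ‖d'‖) :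
    (1 - a) * ‖d'‖ ≤ ‖v' - w‖ + α * ‖d‖ / l + ‖d''‖ / l + ‖e‖ + ‖e'‖ := by
  have hs0 : 0 < s := hl.trans_le hs.1
  have hs0' : 0 < s' := hl.trans_le hs'.1
  have hw : w = s⁻¹ • d' - (s⁻¹ * α) • d - e := by
    rw [hd', mul_smul, ← smul_sub, add_sub_cancel_left, inv_smul_smul₀ hs0.ne', add_sub_cancel_right]
  have hw' : w' = s'⁻¹ • d'' - (s'⁻¹ * α') • d' - e' := by
    rw [hd'', mul_smul, ← smul_sub, add_sub_cancel_left, inv_smul_smul₀ hs0'.ne',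
      add_sub_cancel_right]
  set ξ := v' - w' - α' • d' with hξ
  have hid : (s⁻¹ + s'⁻¹ * α' - α') • d'
      = -(v' - w) + (s⁻¹ * α) • d + s'⁻¹ • d'' + e - e' + ξ := by
    have hv' : v' = ξ + w' + α' • d' := by rw [hξ]; abel
    rw [hv', hw', hw]
    module
  have h1 : 1 ≤ s⁻¹ := (one_le_inv₀ hs0).2 hs.2
  have h1' : 1 ≤ s'⁻¹ := (one_le_inv₀ hs0').2 hs'.2
  have hκ : 1 ≤ s⁻¹ + s'⁻¹ * α' - α' := by nlinarith [hα'.1]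
  have hnorm : (s⁻¹ + s'⁻¹ * α' - α') * ‖d'‖
      ≤ ‖v' - w‖ + s⁻¹ * α * ‖d‖ + s'⁻¹ * ‖d''‖ + ‖e‖ + ‖e'‖ + ‖ξ‖ := by
    calc (s⁻¹ + s'⁻¹ * α' - α') * ‖d'‖
        = ‖-(v' - w) + (s⁻¹ * α) • d + s'⁻¹ • d'' + e - e' + ξ‖ := by
          rw [← hid, norm_smul, Real.norm_of_nonneg (by linarith)]
      _ ≤ ‖-(v' - w)‖ + ‖(s⁻¹ * α) • d‖ + ‖s'⁻¹ • d''‖ + ‖e‖ + ‖e'‖ + ‖ξ‖ := by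
          refine (norm_add_le _ _).trans (add_le_add_left ?_ _)
          refine (norm_sub_le _ _).trans (add_le_add_left ?_ _)
          exact norm_add₄_le
      _ = _ := by
          rw [norm_neg, norm_smul, norm_smul, Real.norm_of_nonneg (by positivity),
            Real.norm_of_nonneg (by positivity)]
  have hκ' := mul_le_mul_of_nonneg_right hκ (norm_nonneg d')
  have ha := mul_le_mul_of_nonneg_right hα'.2 (norm_nonneg d')
  have h2 : s⁻¹ * α * ‖d‖ ≤ α * ‖d‖ / l := by
    rw [div_eq_inv_mul, mul_assoc]
    gcongr
    exact hs.1
  have h3 : s'⁻¹ * ‖d''‖ ≤ ‖d''‖ / l := by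
    rw [div_eq_inv_mul]
    gcongr
    exact hs'.1
  linarith

end Residuals

/-- The one-step decrease of the squared residual, in terms of the lengths involved. -/
lemma exists_residual_decrease {l ρ a M : ℝ} (hl : 0 < l) (hρ : 0 < ρ) (ha1 : a < 1) (hM : 0 ≤ M) :
    ∃ β C : ℝ, 0 < β ∧ 0 ≤ C ∧ ∀ α α' D D' D'' E E' G W V V' : ℝ,
      0 ≤ α ∧ α ≤ 1 → 0 ≤ α' ∧ α' ≤ 1 → 0 ≤ D ∧ D ≤ M → 0 ≤ D' ∧ D' ≤ M → 0 ≤ D'' →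
      0 ≤ E ∧ E ≤ M → 0 ≤ E' ∧ E' ≤ M → 0 ≤ G ∧ G ≤ M → 0 ≤ V → 0 ≤ V' →
      V' ^ 2 ≤ W ^ 2 - ρ * G ^ 2 + 2 * G * E → W ^ 2 ≤ V ^ 2 + 4 * (α * D) * W →
      W ≤ (D' + α * D) / l + E →
      (1 - a) * D' ≤ G + α * D / l + D'' / l + E + E' →
      V' ≤ V + 2 * D' → V ≤ W + 2 * (α * D) →
      V' ^ 2 + β * (α' * D' ^ 2)
        ≤ V ^ 2 + β / 2 * (α * D ^ 2) + C * (α * D' ^ 2 + α' * D'' ^ 2 + E + E') := by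
  obtain ⟨L, hL⟩ : ∃ x, x = 1 / l := ⟨_, rfl⟩
  have hL0 : 0 < L := by rw [hL]; positivity
  obtain ⟨β, hβ⟩ : ∃ x, x = ρ * (1 - a) ^ 2 / 5 := ⟨_, rfl⟩
  have hβ0 : 0 < β := by
    have : 0 < 1 - a := by linarith
    rw [hβ]
    positivity
  obtain ⟨δ, hδ⟩ : ∃ x, x = β / 4 / (4 * L + ρ * L ^ 2) := ⟨_, rfl⟩
  have hδ0 : 0 < δ := by rw [hδ]; positivity
  have hδβ : (4 * L + ρ * L ^ 2) * δ = β / 4 := by rw [hδ]; field_simp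
  obtain ⟨c₁, hc₁⟩ : ∃ x, x = 16 * L ^ 2 / β := ⟨_, rfl⟩
  obtain ⟨c₂, hc₂⟩ : ∃ x, x = 8 * (L + 2) ^ 2 / β := ⟨_, rfl⟩
  obtain ⟨c₃, hc₃⟩ : ∃ x, x = (4 * L + 4 + β) / δ := ⟨_, rfl⟩
  have hc₁0 : 0 ≤ c₁ := by rw [hc₁]; positivity
  have hc₂0 : 0 ≤ c₂ := by rw [hc₂]; positivity
  have hc₃0 : 0 ≤ c₃ := by rw [hc₃]; positivity
  refine ⟨β, c₁ + c₂ + c₃ + ρ * L ^ 2 + 6 * M + ρ * M, hβ0, by positivity, ?_⟩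
  intro α α' D D' D'' E E' G W V V' hα hα' hD hD' hD'' hE hE' hG hV hV' h1 h2 hW h3 h4 h5
  obtain ⟨hα0, hα1⟩ := hα
  obtain ⟨hα0', hα1'⟩ := hα'
  obtain ⟨hD0, hDM⟩ := hD
  obtain ⟨hD0', hDM'⟩ := hD'
  obtain ⟨hE0, hEM⟩ := hE
  obtain ⟨hE0', hEM'⟩ := hE'
  obtain ⟨hG0, hGM⟩ := hG
  have hdiv : ∀ x, x / l = L * x := fun x => by rw [hL]; ring
  rw [hdiv] at hW
  rw [hdiv, hdiv] at h3
  have hDE : α * D * E ≤ M * E := by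
    gcongr
    exact (mul_le_of_le_one_left hD0 hα1).trans hDM
  have hEE : E ^ 2 ≤ M * E := by rw [pow_two]; gcongr
  have hEE' : E' ^ 2 ≤ M * E' := by rw [pow_two]; gcongr
  have hGE : G * E ≤ M * E := by gcongr
  have hDE' : D' * E ≤ M * E := by gcongr
  have hrest : ∀ x ≤ c₁ + c₂ + c₃, ∀ y ≤ ρ * L ^ 2,
      x * (α * D' ^ 2) + y * (α' * D'' ^ 2) + (6 * M + ρ * M) * (E + E')
      ≤ (c₁ + c₂ + c₃ + ρ * L ^ 2 + 6 * M + ρ * M) * (α * D' ^ 2 + α' * D'' ^ 2 + E + E') := by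
    intro x hx y hy
    have t1 : x * (α * D' ^ 2) ≤ (c₁ + c₂ + c₃ + ρ * L ^ 2 + 6 * M + ρ * M) * (α * D' ^ 2) := by
      gcongr
      have : 0 ≤ ρ * L ^ 2 + 6 * M + ρ * M := by positivity
      linarith
    have t2 : y * (α' * D'' ^ 2) ≤ (c₁ + c₂ + c₃ + ρ * L ^ 2 + 6 * M + ρ * M) * (α' * D'' ^ 2) := by
      gcongr
      have : 0 ≤ c₁ + c₂ + c₃ + 6 * M + ρ * M := by positivity
      linarith
    have t3 : (6 * M + ρ * M) * (E + E')
        ≤ (c₁ + c₂ + c₃ + ρ * L ^ 2 + 6 * M + ρ * M) * (E + E') := by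
      gcongr
      have : 0 ≤ c₁ + c₂ + c₃ + ρ * L ^ 2 := by positivity
      linarith
    linarith
  rcases le_total α δ with hαδ | hαδ
  · have hsq : (1 - a) ^ 2 * D' ^ 2
        ≤ 5 * (G ^ 2 + L ^ 2 * (α * D) ^ 2 + L ^ 2 * D'' ^ 2 + E ^ 2 + E' ^ 2) := by
      have h6 : ((1 - a) * D') ^ 2 ≤ (G + L * (α * D) + L * D'' + E + E') ^ 2 :=
        pow_le_pow_left₀ (mul_nonneg (by linarith) hD0') h3 2
      have h7 : (G + L * (α * D) + L * D'' + E + E') ^ 2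
          ≤ 5 * (G ^ 2 + (L * (α * D)) ^ 2 + (L * D'') ^ 2 + E ^ 2 + E' ^ 2) := by
        have := sq_sum_le_card_mul_sum_sq (s := Finset.univ)
          (f := ![G, L * (α * D), L * D'', E, E'])
        simpa [Fin.sum_univ_succ, add_assoc] using this
      simp only [mul_pow] at h6 h7 ⊢
      linarith
    have hβA : β * (α' * D' ^ 2) ≤ ρ * G ^ 2 + ρ * L ^ 2 * (α * D) ^ 2
        + ρ * L ^ 2 * (α' * D'' ^ 2) + ρ * E ^ 2 + ρ * E' ^ 2 := by
      have h6 : β * (α' * D' ^ 2) = ρ / 5 * α' * ((1 - a) ^ 2 * D' ^ 2) := by rw [hβ]; ring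
      have h7 : ρ / 5 * α' * ((1 - a) ^ 2 * D' ^ 2) ≤ ρ / 5 * α' *
          (5 * (G ^ 2 + L ^ 2 * (α * D) ^ 2 + L ^ 2 * D'' ^ 2 + E ^ 2 + E' ^ 2)) := by gcongr
      have h8 : ρ * (α' * (G ^ 2 + L ^ 2 * (α * D) ^ 2 + E ^ 2 + E' ^ 2))
          ≤ ρ * (G ^ 2 + L ^ 2 * (α * D) ^ 2 + E ^ 2 + E' ^ 2) := by
        gcongr
        exact mul_le_of_le_one_left (by positivity) hα1'
      linarith
    have hcross : 4 * L * (α * D * D') ≤ β / 4 * (α * D ^ 2) + c₁ * (α * D' ^ 2) := by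
      have h6 : β / 4 * D ^ 2 + c₁ * D' ^ 2 - 4 * L * (D * D')
          = β / 4 * (D - 8 * L / β * D') ^ 2 := by rw [hc₁]; field_simp; ring
      have h7 : 0 ≤ α * (β / 4 * D ^ 2 + c₁ * D' ^ 2 - 4 * L * (D * D')) := by
        rw [h6]; positivity
      linarith
    have hquad : (4 * L + ρ * L ^ 2) * (α * D) ^ 2 ≤ β / 4 * (α * D ^ 2) := by
      have h6 : (α * D) ^ 2 = α * (α * D ^ 2) := by ring
      rw [← hδβ, mul_assoc, h6]
      gcongr
    have hαDW : α * D * W ≤ α * D * (L * (D' + α * D) + E) := by gcongr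
    have e1 : ρ * E ^ 2 ≤ ρ * (M * E) := by gcongr
    have e2 : ρ * E' ^ 2 ≤ ρ * (M * E') := by gcongr
    have e3 : 0 ≤ M * E' := by positivity
    have := hrest c₁ (by linarith) (ρ * L ^ 2) le_rfl
    linarith
  · have hDδ : (4 * L + 4 + β) * D' ^ 2 ≤ c₃ * (α * D' ^ 2) := by
      have : (4 * L + 4 + β) * D' ^ 2 = c₃ * (δ * D' ^ 2) := by rw [hc₃]; field_simp
      rw [this]
      gcongr
    have hβA : β * (α' * D' ^ 2) ≤ β * D' ^ 2 := by
      gcongr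
      exact mul_le_of_le_one_left (by positivity) hα1'
    have hcross : 4 * (L + 2) * (α * D * D') ≤ β / 2 * (α * D ^ 2) + c₂ * (α * D' ^ 2) := by
      have h6 : β / 2 * D ^ 2 + c₂ * D' ^ 2 - 4 * (L + 2) * (D * D')
          = β / 2 * (D - 4 * (L + 2) / β * D') ^ 2 := by rw [hc₂]; field_simp; ring
      have h7 : 0 ≤ α * (β / 2 * D ^ 2 + c₂ * D' ^ 2 - 4 * (L + 2) * (D * D')) := by
        rw [h6]; positivity
      linarith
    have hsq : V' ^ 2 ≤ (V + 2 * D') ^ 2 := pow_le_pow_left₀ hV' h4 2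
    have hVD : D' * V ≤ D' * (L * (D' + α * D) + E + 2 * (α * D)) := by
      gcongr
      linarith
    have e1 : 0 ≤ ρ * (M * (E + E')) := by positivity
    have e2 : 0 ≤ M * E' := by positivity
    have e3 : 0 ≤ M * E := by positivity
    have e4 : 0 ≤ ρ * L ^ 2 * (α' * D'' ^ 2) := by positivity
    have := hrest (c₂ + c₃) (by linarith) (ρ * L ^ 2) le_rfl
    linarith

/-- Theorem 3.1 (i): under conditions (I), for every fixed point z* of T, lim ‖z^k − z*‖ exists. -/
theorem inexact_inertial_KM_condI_norm_limit_exists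
    {H : Type*} [NormedAddCommGroup H] [InnerProductSpace ℝ H] [CompleteSpace H]
    (T : H → H) (hT : ∀ x y : H, ‖T x - T y‖ ≤ ‖x - y‖)
    (hfix : ∃ p : H, T p = p)
    (z μ e : ℕ → H) (α lam : ℕ → ℝ) (a l l' : ℝ)
    -- the iteration: `z (k+1)` stands for `z^k` (so `z 0` is `z^{-1}`), `μ k` for `μ^k`
    (hμ : ∀ k, μ k = z (k + 1) + α k • (z (k + 1) - z k))
    (hz : ∀ k, z (k + 2) = μ k + lam k • (T (μ k) + e k - μ k))
    -- conditions (I)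
    (ha0 : 0 ≤ a) (ha1 : a < 1)
    (hα : ∀ k, 0 ≤ α k ∧ α k ≤ a)
    (hl : 0 < l) (hl' : l' < 1)
    (hlam : ∀ k, l ≤ lam k ∧ lam k ≤ l')
    (hsumα : Summable fun k => α k * ‖z (k + 2) - z (k + 1)‖ ^ 2)
    (hsume : Summable fun k => lam k * ‖e k‖)
    (hbdd : ∃ M : ℝ, ∀ k, ‖z k‖ ≤ M) :
    ∀ zs : H, T zs = zs →
      ∃ L : ℝ, Tendsto (fun k => ‖z k - zs‖) atTop (nhds L) := by
  intro zs hzs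
  obtain ⟨B, hB⟩ := hbdd
  have hlam0 : ∀ k, 0 < lam k := fun k => hl.trans_le (hlam k).1
  have hlam1 : ∀ k, lam k ≤ 1 := fun k => (hlam k).2.trans hl'.le
  have hα1 : ∀ k, α k ≤ 1 := fun k => (hα k).2.trans ha1.le
  -- summability of the errors
  have he : Summable fun k => ‖e k‖ := by
    refine Summable.of_nonneg_of_le (fun _ => norm_nonneg _) (fun k => ?_) (hsume.mul_left l⁻¹)
    rw [← mul_assoc]
    refine le_mul_of_one_le_left (norm_nonneg _) ?_
    rw [inv_mul_eq_div, one_le_div hl]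
    exact (hlam k).1
  obtain ⟨Eb, hEb⟩ : ∃ Eb, ∀ k, ‖e k‖ ≤ Eb :=
    ⟨_, fun k => he.le_tsum k fun _ _ => norm_nonneg _⟩
  have hEb0 : 0 ≤ Eb := (norm_nonneg _).trans (hEb 0)
  -- boundedness of the quantities involved
  obtain ⟨N, hN⟩ : ∃ N, ∀ k, ‖z k - zs‖ ≤ N :=
    ⟨B + ‖zs‖, fun k => (norm_sub_le _ _).trans (add_le_add_left (hB k) _)⟩
  have hN0 : 0 ≤ N := (norm_nonneg _).trans (hN 0)
  have hd : ∀ k, ‖z (k + 1) - z k‖ ≤ 2 * N := fun k => by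
    have := norm_sub_le (z (k + 1) - zs) (z k - zs)
    rw [sub_sub_sub_cancel_right] at this
    linarith [hN k, hN (k + 1)]
  have hαd : ∀ k, ‖α k • (z (k + 1) - z k)‖ = α k * ‖z (k + 1) - z k‖ := fun k => by
    rw [norm_smul, Real.norm_of_nonneg (hα k).1]
  have hμN : ∀ k, ‖μ k - zs‖ ≤ 3 * N := fun k => by
    have h1 : μ k - zs = (z (k + 1) - zs) + α k • (z (k + 1) - z k) := by rw [hμ]; abel
    rw [h1]
    refine (norm_add_le _ _).trans ?_
    rw [hαd]
    linarith [hN (k + 1), hd k, mul_le_of_le_one_left (norm_nonneg (z (k + 1) - z k)) (hα1 k)]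
  have hres : ∀ x, ‖T x - x‖ ≤ 2 * ‖x - zs‖ := fun x => by
    have h1 := norm_sub_le (T x - T zs) (x - zs)
    rw [hzs, sub_sub_sub_cancel_right] at h1
    have h2 := hT x zs
    rw [hzs] at h2
    linarith
  have hresT : ∀ x y, ‖T x - x‖ ≤ ‖T y - y‖ + 2 * ‖x - y‖ := fun x y => by
    have h1 : T x - x = (T y - y) + (T x - T y) - (x - y) := by abel
    rw [h1]
    linarith [norm_sub_le ((T y - y) + (T x - T y)) (x - y),
      norm_add_le (T y - y) (T x - T y), hT x y]
  have hstep : ∀ k, z (k + 2) = μ k + lam k • ((T (μ k) - μ k) + e k) := fun k => by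
    rw [hz]; congr 2; abel
  have hdstep : ∀ k, z (k + 2) - z (k + 1)
      = α k • (z (k + 1) - z k) + lam k • ((T (μ k) - μ k) + e k) := fun k => by
    rw [hstep, hμ]; abel
  have hl'0 : 0 < l' := (hlam0 0).trans_le (hlam 0).2
  have hρ : 0 < 1 / l' - 1 := by
    rwa [sub_pos, one_lt_div hl'0]
  -- the inertial terms are summable
  obtain ⟨β, C, hβ, hC, hdec⟩ :=
    exists_residual_decrease hl hρ ha1 (M := 10 * N + Eb) (by positivity)
  have hA : Summable fun k => α k * ‖z (k + 1) - z k‖ ^ 2 := by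
    refine summable_of_lyapunov_step (β := β) (γ := β / 2)
      (V := fun k => ‖T (z (k + 1)) - z (k + 1)‖ ^ 2)
      (s := fun k => C * (α k * ‖z (k + 2) - z (k + 1)‖ ^ 2
        + α (k + 1) * ‖z (k + 3) - z (k + 2)‖ ^ 2 + ‖e k‖ + ‖e (k + 1)‖))
      (by positivity) (by linarith) (fun _ => by positivity)
      (fun k => mul_nonneg (hα k).1 (by positivity)) (fun k => ?_) ?_ fun k => ?_
    · have h0 := (hα k).1
      have h1 := (hα (k + 1)).1
      positivity
    · exact (((hsumα.add ((summable_nat_add_iff 1).2 hsumα)).add he).add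
        ((summable_nat_add_iff 1).2 he)).mul_left C
    · have hG : ‖(T (z (k + 2)) - z (k + 2)) - (T (μ k) - μ k)‖ ≤ 10 * N + Eb := by
        refine (norm_sub_le _ _).trans ?_
        linarith [hres (z (k + 2)), hres (μ k), hN (k + 2), hμN k]
      have hE : ∀ k, ‖e k‖ ≤ 10 * N + Eb := fun k => by linarith [hEb k]
      have hD : ∀ k, ‖z (k + 1) - z k‖ ≤ 10 * N + Eb := fun k => by linarith [hd k]
      have hμz : ‖μ k - z (k + 1)‖ = α k * ‖z (k + 1) - z k‖ := by
        rw [hμ, add_sub_cancel_left, hαd]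
      have hWV : ‖T (μ k) - μ k‖
          ≤ ‖T (z (k + 1)) - z (k + 1)‖ + 2 * (α k * ‖z (k + 1) - z k‖) := by
        rw [← hμz]
        exact hresT _ _
      have hVW : ‖T (z (k + 1)) - z (k + 1)‖
          ≤ ‖T (μ k) - μ k‖ + 2 * (α k * ‖z (k + 1) - z k‖) := by
        rw [← hμz, norm_sub_rev (μ k) (z (k + 1))]
        exact hresT _ _
      have hαD0 : 0 ≤ α k * ‖z (k + 1) - z k‖ := mul_nonneg (hα k).1 (norm_nonneg _)
      have hW : ‖T (μ k) - μ k‖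
          ≤ (‖z (k + 2) - z (k + 1)‖ + α k * ‖z (k + 1) - z k‖) / l + ‖e k‖ := by
        have h1 : lam k • ((T (μ k) - μ k) + e k)
            = (z (k + 2) - z (k + 1)) - α k • (z (k + 1) - z k) := by rw [hdstep]; abel
        have h2 : l * ‖(T (μ k) - μ k) + e k‖
            ≤ ‖z (k + 2) - z (k + 1)‖ + α k * ‖z (k + 1) - z k‖ := by
          calc l * ‖(T (μ k) - μ k) + e k‖ ≤ lam k * ‖(T (μ k) - μ k) + e k‖ := by
                gcongr
                exact (hlam k).1
            _ = ‖(z (k + 2) - z (k + 1)) - α k • (z (k + 1) - z k)‖ := by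
                rw [← h1, norm_smul, Real.norm_of_nonneg (hlam0 k).le]
            _ ≤ _ := by
                rw [← hαd]
                exact norm_sub_le _ _
        have h3 := norm_sub_le ((T (μ k) - μ k) + e k) (e k)
        rw [add_sub_cancel_right] at h3
        refine h3.trans (add_le_add_left ?_ _)
        rwa [le_div_iff₀' hl]
      have hfin := hdec (α k) (α (k + 1)) ‖z (k + 1) - z k‖ ‖z (k + 2) - z (k + 1)‖
        ‖z (k + 3) - z (k + 2)‖ ‖e k‖ ‖e (k + 1)‖
        ‖(T (z (k + 2)) - z (k + 2)) - (T (μ k) - μ k)‖ ‖T (μ k) - μ k‖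
        ‖T (z (k + 1)) - z (k + 1)‖ ‖T (z (k + 2)) - z (k + 2)‖
        ⟨(hα k).1, hα1 k⟩ ⟨(hα (k + 1)).1, hα1 (k + 1)⟩ ⟨norm_nonneg _, hD k⟩
        ⟨norm_nonneg _, hD (k + 1)⟩ (norm_nonneg _) ⟨norm_nonneg _, hE k⟩
        ⟨norm_nonneg _, hE (k + 1)⟩ ⟨norm_nonneg _, hG⟩ (norm_nonneg _) (norm_nonneg _)
        ?_ ?_ hW ?_ ?_ hVW
      · linarith
      · refine norm_sq_residual_le (hlam0 k) (hlam k).2 ?_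
        have h1 : (T (z (k + 2)) - z (k + 2)) - (T (μ k) - μ k)
            + lam k • ((T (μ k) - μ k) + e k) = T (z (k + 2)) - T (μ k) := by
          nth_rewrite 2 [hstep k]
          abel
        have h2 : lam k • ((T (μ k) - μ k) + e k) = z (k + 2) - μ k := by
          rw [hstep k, add_sub_cancel_left]
        rw [h1, h2]
        exact hT _ _
      · rcases le_total ‖T (μ k) - μ k‖ ‖T (z (k + 1)) - z (k + 1)‖ with h | h
        · have h1 := pow_le_pow_left₀ (norm_nonneg _) h 2
          have h2 := mul_nonneg hαD0 (norm_nonneg (T (μ k) - μ k))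
          linarith
        · have h1 := norm_nonneg (T (z (k + 1)) - z (k + 1))
          nlinarith
      · refine mul_norm_le_of_inertial_step hl ⟨(hlam k).1, hlam1 k⟩
          ⟨(hlam (k + 1)).1, hlam1 (k + 1)⟩ (hα k).1 (hα (k + 1)) (hdstep k) (hdstep (k + 1)) ?_
        have h1 : T (z (k + 2)) - z (k + 2) - (T (μ (k + 1)) - μ (k + 1))
            - α (k + 1) • (z (k + 2) - z (k + 1)) = T (z (k + 2)) - T (μ (k + 1)) := by
          nth_rewrite 2 [hμ (k + 1)]
          abel
        have h2 := hT (z (k + 2)) (μ (k + 1))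
        rw [h1]
        refine h2.trans_eq ?_
        rw [norm_sub_rev, hμ (k + 1), add_sub_cancel_left, hαd]
      · exact hresT (z (k + 2)) (z (k + 1))
  -- convergence of the squared distances
  obtain ⟨L, hL⟩ : ∃ L, Tendsto (fun k => ‖z k - zs‖ ^ 2) atTop (𝓝 L) := by
    refine exists_tendsto_of_inertial_le (α := α)
      (s := fun k => 2 * (α k * ‖z (k + 1) - z k‖ ^ 2) + (6 * N + Eb) * ‖e k‖)
      ha1 hα (fun _ => by positivity) (fun k => ?_)
      ((hA.mul_left 2).add (he.mul_left _)) fun k => ?_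
    · have := (hα k).1
      positivity
    · have h1 : z (k + 2) - zs
          = (1 - lam k) • (μ k - zs) + lam k • (T (μ k) - zs) + lam k • e k := by
        rw [hz]; module
      have h2 : ‖z (k + 2) - zs‖ ≤ ‖μ k - zs‖ + ‖e k‖ := by
        have hTμ := hT (μ k) zs
        rw [hzs] at hTμ
        rw [h1]
        refine (norm_add₃_le).trans ?_
        rw [norm_smul, norm_smul, norm_smul, Real.norm_of_nonneg (hlam0 k).le,
          Real.norm_of_nonneg (sub_nonneg.2 (hlam1 k))]
        linarith [mul_le_mul_of_nonneg_left hTμ (hlam0 k).le,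
          mul_le_of_le_one_left (norm_nonneg (e k)) (hlam1 k)]
      have h3 : ‖z (k + 2) - zs‖ ^ 2 ≤ ‖μ k - zs‖ ^ 2 + (6 * N + Eb) * ‖e k‖ := by
        have h4 := pow_le_pow_left₀ (norm_nonneg _) h2 2
        have h5 := mul_le_mul_of_nonneg_right (hμN k) (norm_nonneg (e k))
        have h6 := mul_le_mul_of_nonneg_right (hEb k) (norm_nonneg (e k))
        linarith
      have h4 : ‖μ k - zs‖ ^ 2 = (1 + α k) * ‖z (k + 1) - zs‖ ^ 2 - α k * ‖z k - zs‖ ^ 2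
          + α k * (1 + α k) * ‖z (k + 1) - z k‖ ^ 2 := by
        have h5 : μ k - zs = (z (k + 1) - zs) + α k • (z (k + 1) - z k) := by rw [hμ]; abel
        have h6 : z k - zs = (z (k + 1) - zs) - (z (k + 1) - z k) := by abel
        rw [h5, h6, norm_add_sq_real,
          norm_sub_sq_real (z (k + 1) - zs) (z (k + 1) - z k), hαd, inner_smul_right]
        ring
      have h5 : 0 ≤ α k * ‖z (k + 1) - z k‖ ^ 2 := mul_nonneg (hα k).1 (by positivity)
      have h6 := mul_le_mul_of_nonneg_right (hα1 k) h5
      linarith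
  refine ⟨√L, ?_⟩
  simpa [Real.sqrt_sq (norm_nonneg _)] using hL.sqrt
end

section
/- Let H be a real Hilbert space and T : H → H nonexpansive with Fix(T) ≠ ∅. Let (z^k), (μ^k) be generated by the inexact inertial Krasnoselskii–Mann iteration and assume conditions (I) hold. Then lim_{k→∞} ‖Tμ^k − μ^k‖ = 0. -/
open Filter Topology

open scoped RealInnerProductSpace

/-- A quasi-Fejér type descent inequality with summable perturbations forces the decrements to be
summable. -/
lemma summable_of_descent {Φ g s : ℕ → ℝ} (hΦ : ∀ k, 0 ≤ Φ k) (hg : ∀ k, 0 ≤ g k)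
    (hs : Summable s) (h : ∀ k, Φ (k + 1) + g k ≤ Φ k + s k) : Summable g := by
  have hsum : ∀ n, ∑ i ∈ Finset.range n, g i + Φ n ≤ Φ 0 + ∑ i ∈ Finset.range n, s i := by
    intro n
    induction n with
    | zero => simp
    | succ n ih =>
      rw [Finset.sum_range_succ, Finset.sum_range_succ]
      linarith [h n]
  obtain ⟨C, hC⟩ := hs.hasSum.tendsto_sum_nat.bddAbove_range
  refine summable_of_sum_range_le (c := Φ 0 + C) hg fun n => ?_
  linarith [hsum n, hΦ n, hC (Set.mem_range_self n)]

/-- Summability of `R` from coupled descent inequalities in which the gain `A` of the energy `Ψ` is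
controlled by the decrease of a second potential `P`, up to arbitrarily small multiples of
`R + q`. -/
lemma summable_of_coupled_descent {Ψ P q R A s : ℕ → ℝ} {a b c K M : ℝ}
    (hΨ0 : ∀ k, 0 ≤ Ψ k) (hP0 : ∀ k, 0 ≤ P k) (hq0 : ∀ k, 0 ≤ q k) (hR0 : ∀ k, 0 ≤ R k)
    (hA0 : ∀ k, 0 ≤ A k) (ha : a < 1) (hb : 0 < b) (hc : 0 < c) (hK : 0 < K) (hM : 0 < M)
    (hs : Summable s)
    (hΨ : ∀ k, Ψ (k + 1) ≤ Ψ k + M * A k - c * R k + s k)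
    (hq : ∀ k, q (k + 1) ≤ a * q k + K * R k + s k)
    (hA : ∀ η : ℝ, 0 < η → ∃ σ : ℕ → ℝ, Summable σ ∧
      ∀ k, P (k + 1) + b * A (k + 1) ≤ P k + η * (R k + q k) + σ k) :
    Summable R := by
  have ha' : 0 < 1 - a := by linarith
  obtain ⟨n, hn, hnK⟩ : ∃ n : ℝ, 0 < n ∧ n * K = c / 4 := ⟨c / 4 / K, by positivity, by field_simp⟩
  obtain ⟨N, hN, hNb⟩ : ∃ N : ℝ, 0 < N ∧ N * b = M := ⟨M / b, by positivity, by field_simp⟩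
  obtain ⟨η, hη, hη1, hη2⟩ : ∃ η : ℝ, 0 < η ∧ N * η ≤ c / 4 ∧ N * η ≤ n * (1 - a) := by
    refine ⟨min (c / 4) (n * (1 - a)) / N, by positivity, ?_, ?_⟩
    · rw [mul_div_cancel₀ _ hN.ne']; exact min_le_left _ _
    · rw [mul_div_cancel₀ _ hN.ne']; exact min_le_right _ _
  obtain ⟨σ, hσ, hσA⟩ := hA η hη
  have key : Summable fun k => c / 2 * R k := by
    refine summable_of_descent (Φ := fun k => Ψ k + N * P k + M * A k + n * q k)
      (s := fun k => s k + N * σ k + n * s k) (fun k => ?_) (fun k => ?_)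
      ((hs.add (hσ.mul_left N)).add (hs.mul_left n)) (fun k => ?_)
    · have := hΨ0 k; have := hP0 k; have := hA0 k; have := hq0 k
      positivity
    · have := hR0 k
      positivity
    · have h1 := mul_le_mul_of_nonneg_left (hσA k) hN.le
      have h2 := mul_le_mul_of_nonneg_left (hq k) hn.le
      have h3 := mul_le_mul_of_nonneg_right hη1 (hR0 k)
      have h4 := mul_le_mul_of_nonneg_right hη2 (hq0 k)
      have e1 : N * (b * A (k + 1)) = M * A (k + 1) := by rw [← hNb]; ring
      have e2 : n * (K * R k) = c / 4 * R k := by rw [← hnK]; ring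
      have h5 := hΨ k
      linarith
  exact (summable_mul_left_iff (by positivity : c / 2 ≠ 0)).1 key

section Step

variable {H : Type*} [NormedAddCommGroup H] [InnerProductSpace ℝ H]

/-- A relaxed step along `u`, perturbed by `f`, changes the squared residual from `‖u‖ ^ 2` to
`‖v‖ ^ 2` in a controlled way. -/
lemma residual_sq_le {u v f : H} {t : ℝ} (h : ‖v - (1 - t) • u + f‖ ≤ ‖t • u + f‖) :
    ‖v‖ ^ 2 ≤ (2 * t - 1) * ‖u‖ ^ 2 + 2 * (1 - t) * ⟪u, v⟫ + 2 * ‖f‖ * (‖u‖ + ‖v‖) := by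
  have h2 : ‖v - (1 - t) • u + f‖ ^ 2 ≤ ‖t • u + f‖ ^ 2 := by gcongr
  have e1 : ‖v - (1 - t) • u + f‖ ^ 2 = ‖v‖ ^ 2 + (1 - t) ^ 2 * ‖u‖ ^ 2 + ‖f‖ ^ 2
      - 2 * (1 - t) * ⟪u, v⟫ + 2 * ⟪v, f⟫ - 2 * (1 - t) * ⟪u, f⟫ := by
    simp only [← real_inner_self_eq_norm_sq, inner_add_left, inner_sub_left, inner_add_right,
      inner_sub_right, real_inner_smul_left, real_inner_smul_right, real_inner_comm v u,
      real_inner_comm f u, real_inner_comm f v]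
    ring
  have e2 : ‖t • u + f‖ ^ 2 = t ^ 2 * ‖u‖ ^ 2 + 2 * t * ⟪u, f⟫ + ‖f‖ ^ 2 := by
    simp only [← real_inner_self_eq_norm_sq, inner_add_left, inner_add_right,
      real_inner_smul_left, real_inner_smul_right, real_inner_comm f u]
    ring
  have h3 := real_inner_le_norm u f
  have h4 : -⟪v, f⟫ ≤ ‖v‖ * ‖f‖ := (neg_le_abs _).trans (abs_real_inner_le_norm v f)
  rw [e1, e2] at h2
  nlinarith

/-- If the inertial step following the displacement `D` produces the displacement `D'`, then the
residual `v` at the intermediate point cannot point along `D`, unless `D'` is large. -/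
lemma inner_residual_le {v u' D D' f' : H} {α t l : ℝ} (hα : 0 ≤ α) (hl : 0 < l) (hlt : l ≤ t)
    (ht : t < 1) (hD' : D' = α • D + t • u' + f') (huv : ‖u' - v‖ ≤ 2 * α * ‖D‖) :
    l * (⟪D, v⟫ - α * ‖D‖ ^ 2) ≤ (‖D'‖ + ‖f'‖) * ‖D‖ := by
  have h1 : ⟪D, v⟫ ≤ ⟪D, u'⟫ + 2 * α * ‖D‖ ^ 2 := by
    have h : -⟪D, u' - v⟫ ≤ ‖D‖ * ‖u' - v‖ := (neg_le_abs _).trans (abs_real_inner_le_norm _ _)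
    rw [inner_sub_right] at h
    nlinarith [mul_le_mul_of_nonneg_left huv (norm_nonneg D)]
  have h2 : t * ⟪D, u'⟫ ≤ -(α * ‖D‖ ^ 2) + (‖D'‖ + ‖f'‖) * ‖D‖ := by
    have e : ⟪D, D'⟫ = α * ‖D‖ ^ 2 + t * ⟪D, u'⟫ + ⟪D, f'⟫ := by
      rw [hD']
      simp only [inner_add_right, real_inner_smul_right, real_inner_self_eq_norm_sq]
    have h3 := real_inner_le_norm D D'
    have h4 : -⟪D, f'⟫ ≤ ‖D‖ * ‖f'‖ := (neg_le_abs _).trans (abs_real_inner_le_norm _ _)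
    nlinarith
  set s := ⟪D, u'⟫
  have hX : 0 ≤ (‖D'‖ + ‖f'‖) * ‖D‖ := by positivity
  have hAD : 0 ≤ α * ‖D‖ ^ 2 := by positivity
  rcases le_total (s + α * ‖D‖ ^ 2) 0 with hs | hs
  · nlinarith
  · nlinarith [mul_le_mul_of_nonneg_right hlt hs]

set_option maxHeartbeats 1000000 in
/-- Decrease of the squared residual over one step, quantified by the displacement `D`. -/
lemma residual_descent {w D D' u v₀ v u' f f' : H} {α β t t' l l' a B : ℝ}
    (ha1 : a < 1) (hα : 0 ≤ α) (hαa : α ≤ a) (hβ : 0 ≤ β) (hβa : β ≤ a)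
    (hl : 0 < l) (hl' : l' < 1) (hlt : l ≤ t) (htl : t ≤ l') (hlt' : l ≤ t') (htl' : t' ≤ l')
    (hD : D = β • w + t • u + f) (hD' : D' = α • D + t' • u' + f')
    (huv₀ : ‖u - v₀‖ ≤ 2 * β * ‖w‖) (huv : ‖u' - v‖ ≤ 2 * α * ‖D‖)
    (hv : ‖v - (1 - t) • u + f‖ ≤ ‖t • u + f‖)
    (hDB : ‖D‖ ≤ B) (huB : ‖u‖ ≤ B) (hvB : ‖v‖ ≤ B) :
    l ^ 2 * (‖v‖ ^ 2 - ‖v₀‖ ^ 2) + l ^ 2 * ((1 - l') * (1 - a)) * (α * ‖D‖ ^ 2) ≤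
      1 / (l ^ 2 * ((1 - l') * (1 - a))) * (α * ‖D'‖ ^ 2) + 2 * B * ‖f'‖ + 14 * B * ‖f‖
      + β * (16 * (‖w‖ ^ 2 + ‖v‖ ^ 2 + ‖D‖ ^ 2 + ‖v₀‖ ^ 2)) := by
  have hB : 0 ≤ B := (norm_nonneg D).trans hDB
  have ha0 : 0 ≤ a := hα.trans hαa
  have ht0 : 0 < t := hl.trans_le hlt
  have ht1 : t < 1 := htl.trans_lt hl'
  have hl1 : l < 1 := hlt.trans_lt ht1
  have hfu : ‖f‖ * ‖u‖ ≤ B * ‖f‖ := by rw [mul_comm B]; gcongr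
  have I1 := residual_sq_le hv
  have I2 := inner_residual_le hα hl hlt' (htl'.trans_lt hl') hD' huv
  have hfv : ‖f‖ * ‖v‖ ≤ B * ‖f‖ := by rw [mul_comm B]; gcongr
  have hfD : ‖f‖ * ‖D‖ ≤ B * ‖f‖ := by rw [mul_comm B]; gcongr
  have hf'D : ‖f'‖ * ‖D‖ ≤ B * ‖f'‖ := by rw [mul_comm B]; gcongr
  have htu : t • u = D - β • w - f := by rw [hD]; abel
  have I3 : t * ⟪u, v⟫ ≤ ⟪D, v⟫ + β * (‖w‖ * ‖v‖) + B * ‖f‖ := by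
    have e : t * ⟪u, v⟫ = ⟪D, v⟫ - β * ⟪w, v⟫ - ⟪f, v⟫ := by
      rw [← real_inner_smul_left, htu]
      simp only [inner_sub_left, real_inner_smul_left]
    have h1 : -⟪w, v⟫ ≤ ‖w‖ * ‖v‖ := (neg_le_abs _).trans (abs_real_inner_le_norm _ _)
    have h2 : -⟪f, v⟫ ≤ ‖f‖ * ‖v‖ := (neg_le_abs _).trans (abs_real_inner_le_norm _ _)
    linarith [mul_le_mul_of_nonneg_left h1 hβ]
  have I4 : ‖D‖ ^ 2 ≤ t ^ 2 * ‖u‖ ^ 2 + 2 * (β * (‖D‖ * ‖w‖)) + 2 * (B * ‖f‖) := by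
    have e : t ^ 2 * ‖u‖ ^ 2 = ‖D‖ ^ 2 - 2 * ⟪D, β • w + f⟫ + ‖β • w + f‖ ^ 2 := by
      rw [← norm_sub_sq_real, ← sub_sub, ← htu, norm_smul, mul_pow, Real.norm_eq_abs, sq_abs]
    have h1 : ⟪D, β • w + f⟫ ≤ β * (‖D‖ * ‖w‖) + ‖f‖ * ‖D‖ := by
      rw [inner_add_right, real_inner_smul_right]
      have h2 := mul_le_mul_of_nonneg_left (real_inner_le_norm D w) hβ
      have h3 := real_inner_le_norm D f
      linarith
    linarith [sq_nonneg ‖β • w + f‖]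
  have I5 : ‖u‖ ^ 2 ≤ ‖v₀‖ ^ 2 + β * (4 * (‖v₀‖ * ‖w‖) + 4 * ‖w‖ ^ 2) := by
    have h1 : ‖u‖ ≤ ‖v₀‖ + 2 * β * ‖w‖ := by linarith [norm_le_norm_add_norm_sub' u v₀]
    have h2 : ‖u‖ ^ 2 ≤ (‖v₀‖ + 2 * β * ‖w‖) ^ 2 := by gcongr
    have h3 : β * (β * ‖w‖ ^ 2) ≤ β * ‖w‖ ^ 2 := by
      have : β * ‖w‖ ^ 2 ≤ ‖w‖ ^ 2 :=
        mul_le_of_le_one_left (sq_nonneg _) (hβa.trans ha1.le)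
      gcongr
    linarith [h2.trans_eq (by ring : (‖v₀‖ + 2 * β * ‖w‖) ^ 2 =
      ‖v₀‖ ^ 2 + β * (4 * (‖v₀‖ * ‖w‖)) + 4 * (β * (β * ‖w‖ ^ 2)))]
  have hBf : 0 ≤ B * ‖f‖ := by positivity
  have hBf' : 0 ≤ B * ‖f'‖ := by positivity
  generalize hX : ‖D'‖ * ‖D‖ + B * ‖f'‖ = X at *
  have hX0 : 0 ≤ X := by rw [← hX]; positivity
  set iuv := ⟪u, v⟫
  set iDv := ⟪D, v⟫
  set E := X + β * (‖w‖ * ‖v‖) + 2 * (β * (‖D‖ * ‖w‖)) + 3 * (B * ‖f‖) with hE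
  have hE0 : 0 ≤ E := by positivity
  have J1 : l * (t * iuv) ≤ l * (t * a * ‖u‖ ^ 2) + E := by
    have h1 : l * (t * iuv) ≤ l * iDv + β * (‖w‖ * ‖v‖) + B * ‖f‖ := by
      have h5 := mul_le_mul_of_nonneg_left I3 hl.le
      have h6 : l * (β * (‖w‖ * ‖v‖) + B * ‖f‖) ≤ 1 * (β * (‖w‖ * ‖v‖) + B * ‖f‖) := by gcongr
      linarith
    have h2 : l * iDv ≤ l * (a * ‖D‖ ^ 2) + X := by
      have : l * (α * ‖D‖ ^ 2) ≤ l * (a * ‖D‖ ^ 2) := by gcongr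
      linarith
    have h3 : a * ‖D‖ ^ 2 ≤ t * a * ‖u‖ ^ 2 + 2 * (β * (‖D‖ * ‖w‖)) + 2 * (B * ‖f‖) := by
      have h4 : t ^ 2 * ‖u‖ ^ 2 ≤ t * ‖u‖ ^ 2 := by
        have : t ^ 2 ≤ t := pow_le_of_le_one ht0.le ht1.le two_ne_zero
        gcongr
      have h5 := mul_le_mul_of_nonneg_left I4 ha0
      have h6 := mul_le_mul_of_nonneg_left h4 ha0
      have h7 : a * (2 * (β * (‖D‖ * ‖w‖)) + 2 * (B * ‖f‖)) ≤
          1 * (2 * (β * (‖D‖ * ‖w‖)) + 2 * (B * ‖f‖)) := by gcongr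
      linarith
    have h8 := mul_le_mul_of_nonneg_left h3 hl.le
    have h9 : l * (2 * (β * (‖D‖ * ‖w‖)) + 2 * (B * ‖f‖)) ≤
        1 * (2 * (β * (‖D‖ * ‖w‖)) + 2 * (B * ‖f‖)) := by gcongr
    rw [hE]
    linarith
  have hc1 : 0 < 1 - l' := by linarith
  have hc2 : 0 < 1 - a := by linarith
  have I1' : ‖v‖ ^ 2 ≤ (2 * t - 1) * ‖u‖ ^ 2 + 2 * (1 - t) * iuv + 4 * (B * ‖f‖) := by
    linarith
  have sq_aux : ∀ Z Y : ℝ, 0 ≤ Y → l * (t * Z) ≤ Y → l ^ 2 * Z ≤ Y := by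
    intro Z Y hY h
    rcases le_total Z 0 with hZ | hZ
    · exact (mul_nonpos_of_nonneg_of_nonpos (sq_nonneg l) hZ).trans hY
    · have : l * (l * Z) ≤ l * (t * Z) := by gcongr
      linarith
  have hlt1 : l * t ≤ 1 := mul_le_one₀ hl1.le ht0.le ht1.le
  have hlt0 : 0 < l * t := by positivity
  have U1 : l ^ 2 * (‖v‖ ^ 2 - ‖u‖ ^ 2 + 2 * ((1 - l') * (1 - a)) * ‖u‖ ^ 2) ≤
      2 * E + 4 * (B * ‖f‖) := by
    refine sq_aux _ _ (by positivity) ?_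
    have h1 := mul_le_mul_of_nonneg_left I1' hlt0.le
    have h2 := mul_le_mul_of_nonneg_left J1 (by linarith : 0 ≤ 2 * (1 - t))
    have h3 : (l * t) * (4 * (B * ‖f‖)) ≤ 1 * (4 * (B * ‖f‖)) := by gcongr
    have h4 : l * t * (2 * ((1 - l') * (1 - a)) * ‖u‖ ^ 2) ≤
        l * t * (2 * ((1 - t) * (1 - a)) * ‖u‖ ^ 2) := by gcongr
    have h5 : (1 - t) * E ≤ 1 * E := by gcongr; linarith
    linarith
  have U2 : l ^ 2 * (‖v‖ ^ 2 - ‖u‖ ^ 2) ≤ 4 * (B * ‖f‖) := by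
    have h0 : 2 * iuv ≤ ‖u‖ ^ 2 + ‖v‖ ^ 2 := by
      have := real_inner_le_norm u v
      linarith [sq_nonneg (‖u‖ - ‖v‖)]
    have h1 : t * (‖v‖ ^ 2 - ‖u‖ ^ 2) ≤ 4 * (B * ‖f‖) := by
      linarith [mul_le_mul_of_nonneg_left h0 (by linarith : 0 ≤ 1 - t)]
    refine sq_aux _ _ (by positivity) ?_
    have h2 := mul_le_mul_of_nonneg_left h1 hl.le
    have h3 : l * (4 * (B * ‖f‖)) ≤ 1 * (4 * (B * ‖f‖)) := by gcongr
    linarith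
  set c := (1 - l') * (1 - a) with hc
  have hc0 : 0 < c := by positivity
  have hl'0 : 0 < l' := by linarith
  have hc_le : c ≤ 1 := mul_le_one₀ (by linarith) hc2.le (by linarith)
  have hl2 : l ^ 2 ≤ 1 := pow_le_one₀ hl.le hl1.le
  have hl2c : l ^ 2 * c ≤ 1 := mul_le_one₀ hl2 hc0.le hc_le
  have U1' : l ^ 2 * (‖v‖ ^ 2 - ‖u‖ ^ 2) + 2 * (l ^ 2 * c) * ‖D‖ ^ 2 ≤
      2 * E + 8 * (B * ‖f‖) + 4 * (β * (‖D‖ * ‖w‖)) := by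
    have h1 : ‖D‖ ^ 2 ≤ ‖u‖ ^ 2 + (2 * (β * (‖D‖ * ‖w‖)) + 2 * (B * ‖f‖)) := by
      have : t ^ 2 * ‖u‖ ^ 2 ≤ 1 * ‖u‖ ^ 2 := by
        have : t ^ 2 ≤ 1 := pow_le_one₀ ht0.le ht1.le
        gcongr
      linarith
    have h2 := mul_le_mul_of_nonneg_left h1 (by positivity : 0 ≤ 2 * (l ^ 2 * c))
    have h3 : (l ^ 2 * c) * (2 * (β * (‖D‖ * ‖w‖)) + 2 * (B * ‖f‖)) ≤
      1 * (2 * (β * (‖D‖ * ‖w‖)) + 2 * (B * ‖f‖)) := by gcongr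
    linarith
  have V1 : l ^ 2 * (‖v‖ ^ 2 - ‖u‖ ^ 2) + 2 * (l ^ 2 * c) * (α * ‖D‖ ^ 2) ≤
      2 * (α * (‖D'‖ * ‖D‖)) + 2 * (B * ‖f'‖) + 14 * (B * ‖f‖)
      + 2 * (β * (‖w‖ * ‖v‖)) + 8 * (β * (‖D‖ * ‖w‖)) := by
    have hα1 : α ≤ 1 := by linarith
    have h1 := mul_le_mul_of_nonneg_left U1' hα
    have h2 := mul_le_mul_of_nonneg_left U2 (by linarith : 0 ≤ 1 - α)
    have h3 : α * (2 * (B * ‖f'‖) + 10 * (B * ‖f‖) + 2 * (β * (‖w‖ * ‖v‖))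
      + 8 * (β * (‖D‖ * ‖w‖))) ≤ 1 * (2 * (B * ‖f'‖) + 10 * (B * ‖f‖) + 2 * (β * (‖w‖ * ‖v‖))
      + 8 * (β * (‖D‖ * ‖w‖))) := by gcongr
    rw [hE, ← hX] at h1
    linarith
  set κ := l ^ 2 * c with hκ
  have hκ0 : 0 < κ := by positivity
  have V2 : 2 * (α * (‖D'‖ * ‖D‖)) ≤ κ * (α * ‖D‖ ^ 2) + 1 / κ * (α * ‖D'‖ ^ 2) := by
    have h1 : 2 * (‖D'‖ * ‖D‖) ≤ κ * ‖D‖ ^ 2 + 1 / κ * ‖D'‖ ^ 2 := by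
      have h2 : κ * ‖D‖ ^ 2 + 1 / κ * ‖D'‖ ^ 2 - 2 * (‖D'‖ * ‖D‖)
          = 1 / κ * (κ * ‖D‖ - ‖D'‖) ^ 2 := by field_simp; ring
      have h3 : 0 ≤ 1 / κ * (κ * ‖D‖ - ‖D'‖) ^ 2 := by positivity
      linarith
    linarith [mul_le_mul_of_nonneg_left h1 hα]
  have V3 : l ^ 2 * (‖u‖ ^ 2 - ‖v₀‖ ^ 2) ≤ β * (4 * (‖v₀‖ * ‖w‖) + 4 * ‖w‖ ^ 2) := by
    have h0 : 0 ≤ β * (4 * (‖v₀‖ * ‖w‖) + 4 * ‖w‖ ^ 2) := by positivity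
    have h1 : l ^ 2 * (‖u‖ ^ 2 - ‖v₀‖ ^ 2) ≤
        l ^ 2 * (β * (4 * (‖v₀‖ * ‖w‖) + 4 * ‖w‖ ^ 2)) := by gcongr; linarith
    exact h1.trans (mul_le_of_le_one_left h0 hl2)
  have V4 : β * (2 * (‖w‖ * ‖v‖) + 8 * (‖D‖ * ‖w‖) + 4 * (‖v₀‖ * ‖w‖) + 4 * ‖w‖ ^ 2) ≤
      β * (16 * (‖w‖ ^ 2 + ‖v‖ ^ 2 + ‖D‖ ^ 2 + ‖v₀‖ ^ 2)) := by
    gcongr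
    linarith [sq_nonneg (‖w‖ - ‖v‖), sq_nonneg (‖D‖ - ‖w‖), sq_nonneg (‖v₀‖ - ‖w‖),
      sq_nonneg ‖w‖, sq_nonneg ‖v‖, sq_nonneg ‖D‖, sq_nonneg ‖v₀‖]
  linarith

set_option maxHeartbeats 1000000 in
/-- Version of `residual_descent` in which the inertial parameter `β` of the step itself is
arbitrary: either it is small, or the displacement `D` is controlled by `β * ‖D‖ ^ 2`. -/
lemma residual_descent_eps {l l' a B η : ℝ} (ha1 : a < 1) (hl : 0 < l) (hl' : l' < 1)
    (hη : 0 < η) : ∃ C : ℝ, ∀ {w D D' u v₀ v u' f f' : H} {α β t t' : ℝ},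
    0 ≤ α → α ≤ a → 0 ≤ β → β ≤ a → l ≤ t → t ≤ l' → l ≤ t' → t' ≤ l' →
    D = β • w + t • u + f → D' = α • D + t' • u' + f' →
    ‖u - v₀‖ ≤ 2 * β * ‖w‖ → ‖u' - v‖ ≤ 2 * α * ‖D‖ → ‖v - v₀‖ ≤ 2 * ‖D‖ →
    ‖v - (1 - t) • u + f‖ ≤ ‖t • u + f‖ →
    ‖D‖ ≤ B → ‖u‖ ≤ B → ‖v‖ ≤ B → ‖f‖ ≤ B →
    l ^ 2 * ‖v‖ ^ 2 + l ^ 2 * ((1 - l') * (1 - a)) * (α * ‖D‖ ^ 2) ≤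
      l ^ 2 * ‖v₀‖ ^ 2 + η * (‖u‖ ^ 2 + ‖w‖ ^ 2)
      + C * (β * ‖D‖ ^ 2 + α * ‖D'‖ ^ 2 + ‖f‖ + ‖f'‖) := by
  set κ := l ^ 2 * ((1 - l') * (1 - a)) with hκ
  have hc1 : 0 < 1 - l' := by linarith
  have hc2 : 0 < 1 - a := by linarith
  have hκ0 : 0 < κ := by positivity
  set C₁ := (32 / η + 5) * (960 / η) with hC₁
  have hC₁0 : 0 < C₁ := by positivity
  refine ⟨C₁ + 1 / κ + (14 + η) * |B|, ?_⟩
  intro w D D' u v₀ v u' f f' α β t t' hα hαa hβ hβa hlt htl hlt' htl' hD hD' huv₀ huv hvv hv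
    hDB huB hvB hfB
  have hB : 0 ≤ B := (norm_nonneg D).trans hDB
  rw [abs_of_nonneg hB]
  have ht0 : 0 < t := hl.trans_le hlt
  have ht1 : t < 1 := htl.trans_lt hl'
  have hl1 : l < 1 := hlt.trans_lt ht1
  have hβ1 : β ≤ 1 := by linarith
  have ha0 : 0 ≤ a := hα.trans hαa
  have hv₀ : ‖v₀‖ ^ 2 ≤ 2 * ‖u‖ ^ 2 + 8 * ‖w‖ ^ 2 := by
    have h1 : ‖v₀‖ ≤ ‖u‖ + 2 * ‖w‖ := by
      have h3 : β * ‖w‖ ≤ ‖w‖ := mul_le_of_le_one_left (norm_nonneg w) hβ1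
      linarith [norm_le_norm_add_norm_sub u v₀]
    have h2 : ‖v₀‖ ^ 2 ≤ (‖u‖ + 2 * ‖w‖) ^ 2 := by gcongr
    linarith [sq_nonneg (‖u‖ - 2 * ‖w‖)]
  have hD2 : ‖D‖ ^ 2 ≤ 3 * ‖w‖ ^ 2 + 3 * ‖u‖ ^ 2 + 3 * (B * ‖f‖) := by
    have h1 : ‖D‖ ≤ ‖w‖ + ‖u‖ + ‖f‖ := by
      rw [hD]
      refine norm_add₃_le.trans ?_
      rw [norm_smul, norm_smul, Real.norm_of_nonneg hβ, Real.norm_of_nonneg ht0.le]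
      linarith [mul_le_of_le_one_left (norm_nonneg w) hβ1,
        mul_le_of_le_one_left (norm_nonneg u) ht1.le]
    have h2 : ‖D‖ ^ 2 ≤ (‖w‖ + ‖u‖ + ‖f‖) ^ 2 := by gcongr
    have h3 : ‖f‖ ^ 2 ≤ B * ‖f‖ := by rw [sq]; gcongr
    linarith [sq_nonneg (‖w‖ - ‖u‖), sq_nonneg (‖w‖ - ‖f‖), sq_nonneg (‖u‖ - ‖f‖)]
  have hvle : ‖v‖ ≤ ‖v₀‖ + 2 * ‖D‖ := by linarith [norm_le_norm_add_norm_sub' v v₀]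
  have hv2 : ‖v‖ ^ 2 ≤ ‖v₀‖ ^ 2 + 4 * (‖v₀‖ * ‖D‖) + 4 * ‖D‖ ^ 2 := by
    have : ‖v‖ ^ 2 ≤ (‖v₀‖ + 2 * ‖D‖) ^ 2 := by gcongr
    linarith
  have hT0 : 0 ≤ β * ‖D‖ ^ 2 := by positivity
  have hT1 : 0 ≤ α * ‖D'‖ ^ 2 := by positivity
  have hBf : 0 ≤ B * ‖f‖ := by positivity
  have hBf' : 0 ≤ B * ‖f'‖ := by positivity
  have hexp : (C₁ + 1 / κ + (14 + η) * B) * (β * ‖D‖ ^ 2 + α * ‖D'‖ ^ 2 + ‖f‖ + ‖f'‖) ≥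
      C₁ * (β * ‖D‖ ^ 2) + 1 / κ * (α * ‖D'‖ ^ 2) + (14 + η) * (B * ‖f‖)
      + (14 + η) * (B * ‖f'‖) := by
    have h1 : 0 ≤ C₁ * (α * ‖D'‖ ^ 2 + ‖f‖ + ‖f'‖) := by positivity
    have h2 : 0 ≤ 1 / κ * (β * ‖D‖ ^ 2 + ‖f‖ + ‖f'‖) := by positivity
    have h3 : 0 ≤ (14 + η) * B * (β * ‖D‖ ^ 2 + α * ‖D'‖ ^ 2) := by positivity
    linarith
  have hηf' : 0 ≤ η * (B * ‖f'‖) := by positivity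
  have hηf : 0 ≤ η * (B * ‖f‖) := by positivity
  rcases le_total β (η / 960) with hβη | hβη
  · have key := residual_descent ha1 hα hαa hβ hβa hl hl' hlt htl hlt' htl' hD hD' huv₀ huv hv
      hDB huB hvB
    rw [← hκ] at key
    have hQ : 16 * (‖w‖ ^ 2 + ‖v‖ ^ 2 + ‖D‖ ^ 2 + ‖v₀‖ ^ 2) ≤
        960 * (‖u‖ ^ 2 + ‖w‖ ^ 2 + B * ‖f‖) := by
      linarith [sq_nonneg (‖v₀‖ - 2 * ‖D‖), sq_nonneg ‖u‖, sq_nonneg ‖w‖]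
    have h1 : β * (16 * (‖w‖ ^ 2 + ‖v‖ ^ 2 + ‖D‖ ^ 2 + ‖v₀‖ ^ 2)) ≤
        η / 960 * (960 * (‖u‖ ^ 2 + ‖w‖ ^ 2 + B * ‖f‖)) := by gcongr
    have h2 : 0 ≤ C₁ * (β * ‖D‖ ^ 2) := by positivity
    linarith
  · have hDT : ‖D‖ ^ 2 ≤ 960 / η * (β * ‖D‖ ^ 2) := by
      have h1 : η / 960 * ‖D‖ ^ 2 ≤ β * ‖D‖ ^ 2 := by gcongr
      have h2 : 960 / η * (η / 960 * ‖D‖ ^ 2) ≤ 960 / η * (β * ‖D‖ ^ 2) := by gcongr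
      have h3 : 960 / η * (η / 960 * ‖D‖ ^ 2) = ‖D‖ ^ 2 := by field_simp
      linarith
    have hl2 : l ^ 2 ≤ 1 := pow_le_one₀ hl.le hl1.le
    have hcross : 4 * (‖v₀‖ * ‖D‖) ≤ η / 8 * ‖v₀‖ ^ 2 + 32 / η * ‖D‖ ^ 2 := by
      have h2 : η / 8 * ‖v₀‖ ^ 2 + 32 / η * ‖D‖ ^ 2 - 4 * (‖v₀‖ * ‖D‖)
          = 2 / η * (η / 4 * ‖v₀‖ - 4 * ‖D‖) ^ 2 := by field_simp; ring
      have h3 : 0 ≤ 2 / η * (η / 4 * ‖v₀‖ - 4 * ‖D‖) ^ 2 := by positivity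
      linarith
    have hv₀η : η / 8 * ‖v₀‖ ^ 2 ≤ η / 8 * (8 * (‖u‖ ^ 2 + ‖w‖ ^ 2)) := by
      gcongr
      linarith [sq_nonneg ‖u‖]
    have hκ1 : κ * (α * ‖D‖ ^ 2) ≤ ‖D‖ ^ 2 := by
      have hl'0 : 0 < l' := by linarith
      have h0 : (1 - l') * (1 - a) ≤ 1 := mul_le_one₀ (by linarith) hc2.le (by linarith)
      have h1 : κ ≤ 1 := mul_le_one₀ hl2 (by positivity) h0
      have h2 : κ * α ≤ 1 := mul_le_one₀ h1 hα (by linarith)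
      rw [← mul_assoc]
      exact mul_le_of_le_one_left (sq_nonneg _) h2
    have h4 : l ^ 2 * ‖v‖ ^ 2 ≤ l ^ 2 * ‖v₀‖ ^ 2 + (4 * (‖v₀‖ * ‖D‖) + 4 * ‖D‖ ^ 2) := by
      have h5 : 0 ≤ 4 * (‖v₀‖ * ‖D‖) + 4 * ‖D‖ ^ 2 := by positivity
      linarith [mul_le_mul_of_nonneg_left hv2 (sq_nonneg l), mul_le_of_le_one_left h5 hl2]
    have h6 : (32 / η + 5) * ‖D‖ ^ 2 ≤ C₁ * (β * ‖D‖ ^ 2) := by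
      rw [hC₁, mul_assoc]
      gcongr
    have h7 : 0 ≤ 1 / κ * (α * ‖D'‖ ^ 2) := by positivity
    linarith

/-- Energy estimate for one perturbed inertial relaxed step of a map which is quasi-nonexpansive
at `p`. -/
lemma energy_step {p x x₀ m y x' f : H} {α t B : ℝ} (hα : 0 ≤ α) (hα1 : α ≤ 1)
    (ht : 0 ≤ t) (ht1 : t ≤ 1) (hm : m = x + α • (x - x₀)) (hx' : x' = m + t • (y - m) + f)
    (hy : ‖y - p‖ ≤ ‖m - p‖) (hmB : ‖m - p‖ ≤ B) (hfB : ‖f‖ ≤ B) :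
    ‖x' - p‖ ^ 2 ≤ ‖x - p‖ ^ 2 + α * (‖x - p‖ ^ 2 - ‖x₀ - p‖ ^ 2) + 2 * (α * ‖x - x₀‖ ^ 2)
      - t * (1 - t) * ‖y - m‖ ^ 2 + 3 * B * ‖f‖ := by
  have e1 : ‖m - p‖ ^ 2 = ‖x - p‖ ^ 2 + α * (‖x - p‖ ^ 2 - ‖x₀ - p‖ ^ 2)
      + (α + α ^ 2) * ‖x - x₀‖ ^ 2 := by
    have h1 : m - p = (x - p) + α • ((x - p) - (x₀ - p)) := by
      rw [hm]; module
    have h2 : x - x₀ = (x - p) - (x₀ - p) := by abel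
    rw [h1, h2]
    simp only [← real_inner_self_eq_norm_sq, inner_add_left, inner_sub_left, inner_add_right,
      inner_sub_right, real_inner_smul_left, real_inner_smul_right]
    ring
  set g := (m - p) + t • (y - m) with hg
  have e2 : ‖g‖ ^ 2 = (1 - t) * ‖m - p‖ ^ 2 + t * ‖y - p‖ ^ 2 - t * (1 - t) * ‖y - m‖ ^ 2 := by
    have h2 : y - m = (y - p) - (m - p) := by abel
    rw [hg, h2]
    simp only [← real_inner_self_eq_norm_sq, inner_add_left, inner_sub_left, inner_add_right,
      inner_sub_right, real_inner_smul_left, real_inner_smul_right]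
    ring
  have hy2 : ‖y - p‖ ^ 2 ≤ ‖m - p‖ ^ 2 := by gcongr
  have hg2 : ‖g‖ ^ 2 ≤ ‖m - p‖ ^ 2 - t * (1 - t) * ‖y - m‖ ^ 2 := by nlinarith
  have hgB : ‖g‖ ≤ B := by
    have h0 : 0 ≤ t * (1 - t) * ‖y - m‖ ^ 2 :=
      mul_nonneg (mul_nonneg ht (by linarith)) (sq_nonneg _)
    refine le_trans ?_ hmB
    exact le_of_sq_le_sq (by linarith) (norm_nonneg _)
  have hx : ‖x' - p‖ ≤ ‖g‖ + ‖f‖ := by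
    have : x' - p = g + f := by rw [hx', hg]; abel
    rw [this]
    exact norm_add_le _ _
  have hx2 : ‖x' - p‖ ^ 2 ≤ (‖g‖ + ‖f‖) ^ 2 := by gcongr
  have hα2 : α ^ 2 * ‖x - x₀‖ ^ 2 ≤ α * ‖x - x₀‖ ^ 2 := by
    have : α ^ 2 ≤ α := by nlinarith
    gcongr
  nlinarith [norm_nonneg f]

/-- Geometric decay of the squared displacement up to the squared residual. -/
lemma displacement_sq_le {w D u f : H} {β t a B : ℝ} (ha0 : 0 ≤ a) (ha1 : a < 1)
    (hβ : 0 ≤ β) (hβa : β ≤ a) (ht : 0 ≤ t) (ht1 : t ≤ 1) (hD : D = β • w + t • u + f)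
    (hfB : ‖f‖ ≤ B) :
    ‖D‖ ^ 2 ≤ a * ‖w‖ ^ 2 + 2 / (1 - a) * ‖u‖ ^ 2 + 2 / (1 - a) * B * ‖f‖ := by
  have h1a : 0 < 1 - a := by linarith
  have h1 : ‖D‖ ≤ a * ‖w‖ + (‖u‖ + ‖f‖) := by
    rw [hD]
    refine norm_add₃_le.trans ?_
    rw [norm_smul, norm_smul, Real.norm_of_nonneg hβ, Real.norm_of_nonneg ht]
    nlinarith [norm_nonneg w, norm_nonneg u]
  have h2 : ‖D‖ ^ 2 ≤ (a * ‖w‖ + (‖u‖ + ‖f‖)) ^ 2 := by gcongr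
  have h3 : (a * ‖w‖ + (‖u‖ + ‖f‖)) ^ 2 ≤ a * ‖w‖ ^ 2 + 1 / (1 - a) * (‖u‖ + ‖f‖) ^ 2 := by
    have e : a * ‖w‖ ^ 2 + 1 / (1 - a) * (‖u‖ + ‖f‖) ^ 2 - (a * ‖w‖ + (‖u‖ + ‖f‖)) ^ 2 =
        a / (1 - a) * ((1 - a) * ‖w‖ - (‖u‖ + ‖f‖)) ^ 2 := by field_simp; ring
    have : 0 ≤ a / (1 - a) * ((1 - a) * ‖w‖ - (‖u‖ + ‖f‖)) ^ 2 := by positivity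
    linarith
  have h4 : (‖u‖ + ‖f‖) ^ 2 ≤ 2 * ‖u‖ ^ 2 + 2 * (B * ‖f‖) := by
    nlinarith [sq_nonneg (‖u‖ - ‖f‖), norm_nonneg f]
  have h5 : 1 / (1 - a) * (‖u‖ + ‖f‖) ^ 2 ≤ 1 / (1 - a) * (2 * ‖u‖ ^ 2 + 2 * (B * ‖f‖)) := by
    gcongr
  calc ‖D‖ ^ 2 ≤ a * ‖w‖ ^ 2 + 1 / (1 - a) * (2 * ‖u‖ ^ 2 + 2 * (B * ‖f‖)) := by linarith
    _ = _ := by ring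

end Step

/-- Theorem 3.1 (ii): under conditions (I), ‖Tμ^k − μ^k‖ → 0. -/
theorem inexact_inertial_KM_condI_residual_to_zero
    {H : Type*} [NormedAddCommGroup H] [InnerProductSpace ℝ H] [CompleteSpace H]
    (T : H → H) (hT : ∀ x y : H, ‖T x - T y‖ ≤ ‖x - y‖)
    (hfix : ∃ p : H, T p = p)
    (z μ e : ℕ → H) (α lam : ℕ → ℝ) (a l l' : ℝ)
    -- the iteration: `z (k+1)` stands for `z^k` (so `z 0` is `z^{-1}`), `μ k` for `μ^k`
    (hμ : ∀ k, μ k = z (k + 1) + α k • (z (k + 1) - z k))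
    (hz : ∀ k, z (k + 2) = μ k + lam k • (T (μ k) + e k - μ k))
    -- conditions (I)
    (ha0 : 0 ≤ a) (ha1 : a < 1)
    (hα : ∀ k, 0 ≤ α k ∧ α k ≤ a)
    (hl : 0 < l) (hl' : l' < 1)
    (hlam : ∀ k, l ≤ lam k ∧ lam k ≤ l')
    (hsumα : Summable fun k => α k * ‖z (k + 2) - z (k + 1)‖ ^ 2)
    (hsume : Summable fun k => lam k * ‖e k‖)
    (hbdd : ∃ M : ℝ, ∀ k, ‖z k‖ ≤ M) :
    Tendsto (fun k => ‖T (μ k) - μ k‖) atTop (nhds 0) := by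
  obtain ⟨p, hp⟩ := hfix
  obtain ⟨M, hM⟩ := hbdd
  set N := M + ‖p‖ with hN
  set d : ℕ → H := fun k => z (k + 1) - z k with hd
  set v : ℕ → H := fun k => T (z (k + 1)) - z (k + 1) with hv
  set r : ℕ → H := fun k => T (μ k) - μ k with hr
  set f : ℕ → H := fun k => lam k • e k with hf
  have hlam0 : ∀ k, 0 < lam k := fun k => hl.trans_le (hlam k).1
  have hlam1 : ∀ k, lam k < 1 := fun k => (hlam k).2.trans_lt hl'
  have hfs : Summable fun k => ‖f k‖ := by
    refine hsume.congr fun k => ?_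
    rw [hf, norm_smul, Real.norm_of_nonneg (hlam0 k).le]
  have hstep : ∀ k, z (k + 2) = μ k + lam k • r k + f k := fun k => by
    rw [hz k, hr, hf]; module
  have hμd : ∀ k, μ k - z (k + 1) = α k • d k := fun k => by rw [hμ k, hd]; abel
  have hdisp : ∀ k, d (k + 1) = α k • d k + lam k • r k + f k := fun k => by
    have h1 : d (k + 1) = z (k + 2) - z (k + 1) := rfl
    rw [h1, hstep k, ← hμd k]; abel
  have hres : ∀ x y : H, ‖(T x - x) - (T y - y)‖ ≤ 2 * ‖x - y‖ := fun x y => by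
    have h1 : (T x - x) - (T y - y) = (T x - T y) - (x - y) := by abel
    rw [h1]
    linarith [norm_sub_le (T x - T y) (x - y), hT x y]
  have hrv : ∀ k, ‖r k - v k‖ ≤ 2 * α k * ‖d k‖ := fun k => by
    refine (hres (μ k) (z (k + 1))).trans_eq ?_
    rw [hμd k, norm_smul, Real.norm_of_nonneg (hα k).1, mul_assoc]
  have hvv : ∀ k, ‖v (k + 1) - v k‖ ≤ 2 * ‖d (k + 1)‖ := fun k => hres _ _
  have hvr : ∀ k, ‖v (k + 1) - (1 - lam k) • r k + f k‖ ≤ ‖lam k • r k + f k‖ := fun k => by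
    have h1 : v (k + 1) - (1 - lam k) • r k + f k = T (z (k + 2)) - T (μ k) := by
      have h2 : v (k + 1) = T (z (k + 2)) - (μ k + lam k • r k + f k) := by
        rw [← hstep k]
      rw [h2, sub_smul, one_smul]
      simp only [hr]
      abel
    have h3 : lam k • r k + f k = z (k + 2) - μ k := by rw [hstep k]; abel
    rw [h1, h3]
    exact hT _ _
  have hTp : ∀ x, ‖T x - p‖ ≤ ‖x - p‖ := fun x => by simpa [hp] using hT x p
  have hzp : ∀ k, ‖z k - p‖ ≤ N := fun k => (norm_sub_le _ _).trans (by linarith [hM k])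
  have hN0 : 0 ≤ N := (norm_nonneg _).trans (hzp 0)
  have hresp : ∀ x, ‖T x - x‖ ≤ 2 * ‖x - p‖ := fun x => by
    simpa [hp] using hres x p
  have hdN : ∀ k, ‖d k‖ ≤ 2 * N := fun k => by
    have h1 : d k = (z (k + 1) - p) - (z k - p) := by simp only [hd]; abel
    rw [h1]
    linarith [norm_sub_le (z (k + 1) - p) (z k - p), hzp k, hzp (k + 1)]
  have hαd : ∀ k, ‖α k • d k‖ ≤ 2 * N := fun k => by
    rw [norm_smul, Real.norm_of_nonneg (hα k).1]
    have : α k * ‖d k‖ ≤ 1 * (2 * N) := by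
      gcongr
      · exact (hα k).2.trans ha1.le
      · exact hdN k
    linarith
  have hμN : ∀ k, ‖μ k - p‖ ≤ 3 * N := fun k => by
    have h1 : μ k - p = (z (k + 1) - p) + α k • d k := by rw [← hμd k]; abel
    rw [h1]
    linarith [norm_add_le (z (k + 1) - p) (α k • d k), hzp (k + 1), hαd k]
  have hrN : ∀ k, ‖r k‖ ≤ 6 * N := fun k => by linarith [hresp (μ k), hμN k]
  have hvN : ∀ k, ‖v k‖ ≤ 2 * N := fun k => by linarith [hresp (z (k + 1)), hzp (k + 1)]
  have hfN : ∀ k, ‖f k‖ ≤ 10 * N := fun k => by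
    have h1 : f k = d (k + 1) - α k • d k - lam k • r k := by rw [hdisp k]; abel
    have h2 : ‖lam k • r k‖ ≤ 6 * N := by
      rw [norm_smul, Real.norm_of_nonneg (hlam0 k).le]
      nlinarith [hlam1 k, norm_nonneg (r k), hrN k]
    rw [h1]
    linarith [norm_sub_le (d (k + 1) - α k • d k) (lam k • r k),
      norm_sub_le (d (k + 1)) (α k • d k), hdN (k + 1), hαd k]
  have h1a : 0 < 1 - a := by linarith
  have h1l : 0 < 1 - l' := by linarith
  set φ : ℕ → ℝ := fun k => ‖z k - p‖ ^ 2 with hφ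
  set h : ℕ → ℝ := fun k => max (φ (k + 1) - φ k) 0 with hh
  set m := a / (1 - a) with hm
  have hm0 : 0 ≤ m := by positivity
  have hma : a + m * a = m := by rw [hm]; field_simp; ring
  have hh0 : ∀ k, 0 ≤ h k := fun k => le_max_right _ _
  have henergy : ∀ k, φ (k + 2) ≤ φ (k + 1) + a * h k + 2 * (α k * ‖d k‖ ^ 2)
      - l * (1 - l') * ‖r k‖ ^ 2 + 3 * (10 * N) * ‖f k‖ := fun k => by
    have h1 := energy_step (p := p) (B := 10 * N) (hα k).1 ((hα k).2.trans ha1.le) (hlam0 k).le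
      (hlam1 k).le (hμ k) (hstep k) (hTp (μ k)) (by linarith [hμN k]) (hfN k)
    have h2 : α k * (φ (k + 1) - φ k) ≤ a * h k :=
      (mul_le_mul_of_nonneg_left (le_max_left _ 0) (hα k).1).trans
        (mul_le_mul_of_nonneg_right (hα k).2 (hh0 k))
    have h3 : l * (1 - l') * ‖r k‖ ^ 2 ≤ lam k * (1 - lam k) * ‖r k‖ ^ 2 := by
      have := hlam k
      have := hlam0 k
      gcongr <;> linarith
    change φ (k + 2) ≤ φ (k + 1) + α k * (φ (k + 1) - φ k) + 2 * (α k * ‖d k‖ ^ 2)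
      - lam k * (1 - lam k) * ‖r k‖ ^ 2 + 3 * (10 * N) * ‖f k‖ at h1
    linarith
  have hpos : ∀ k, h (k + 1) ≤ a * h k + 2 * (α k * ‖d k‖ ^ 2) + 3 * (10 * N) * ‖f k‖ := by
    intro k
    have h0 := hh0 k
    have h1 := (hα k).1
    have h2 : 0 ≤ l * (1 - l') * ‖r k‖ ^ 2 := by positivity
    refine max_le ?_ (by positivity)
    linarith [henergy k]
  have hmain : Summable fun k => ‖r k‖ ^ 2 := by
    set K := 2 / (1 - a) with hK
    have hK0 : 0 < K := by positivity
    refine summable_of_coupled_descent (Ψ := fun k => φ (k + 1) + m * h k)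
      (P := fun k => l ^ 2 * ‖v k‖ ^ 2) (q := fun k => ‖d k‖ ^ 2)
      (A := fun k => α k * ‖d k‖ ^ 2)
      (s := fun k => ((1 + m) * (3 * (10 * N)) + K * (10 * N)) * ‖f k‖)
      (a := a) (b := l ^ 2 * ((1 - l') * (1 - a))) (c := l * (1 - l')) (K := K)
      (M := 2 * (1 + m)) (fun k => ?_) (fun k => by positivity) (fun k => by positivity)
      (fun k => by positivity) (fun k => mul_nonneg (hα k).1 (by positivity)) ha1 (by positivity)
      (by positivity) hK0 (by positivity) (hfs.mul_left _) (fun k => ?_) (fun k => ?_)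
      (fun η hη => ?_)
    · exact add_nonneg (sq_nonneg _) (mul_nonneg hm0 (hh0 k))
    · have h1 := henergy k
      have h2 := mul_le_mul_of_nonneg_left (hpos k) hm0
      have h3 : 0 ≤ K * (10 * N) * ‖f k‖ := by positivity
      have h4 : a * h k + m * a * h k = m * h k := by rw [← add_mul, hma]
      linarith
    · have h1 := displacement_sq_le ha0 ha1 (hα k).1 (hα k).2 (hlam0 k).le (hlam1 k).le (hdisp k)
        (hfN k)
      have h2 : 0 ≤ (1 + m) * (3 * (10 * N)) * ‖f k‖ := by positivity
      linarith
    · obtain ⟨C, hC⟩ := residual_descent_eps (H := H) (B := 10 * N) ha1 hl hl' hη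
      have hts : Summable fun k => α k * ‖d (k + 1)‖ ^ 2 := hsumα
      refine ⟨fun k => C * (α k * ‖d (k + 1)‖ ^ 2 + α (k + 1) * ‖d (k + 2)‖ ^ 2
        + ‖f k‖ + ‖f (k + 1)‖), ?_, fun k => ?_⟩
      · exact (((hts.add ((summable_nat_add_iff 1).2 hts)).add hfs).add
          ((summable_nat_add_iff 1).2 hfs)).mul_left C
      · exact hC (hα (k + 1)).1 (hα (k + 1)).2 (hα k).1 (hα k).2 (hlam k).1 (hlam k).2
          (hlam (k + 1)).1 (hlam (k + 1)).2 (hdisp k) (hdisp (k + 1)) (hrv k) (hrv (k + 1))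
          (hvv k) (hvr k) (by linarith [hdN (k + 1)]) (by linarith [hrN k])
          (by linarith [hvN (k + 1)]) (hfN k)
  have hlim := hmain.tendsto_atTop_zero.sqrt
  simpa [Real.sqrt_sq (norm_nonneg _)] using hlim
end

section
/- Let H be a real Hilbert space and T : H → H nonexpansive with Fix(T) ≠ ∅. Let (z^k), (μ^k) be generated by the inexact inertial Krasnoselskii–Mann iteration and assume conditions (I) hold. Then lim_{k→∞} ‖z^{k+1} − μ^k‖ = 0, lim_{k→∞} ‖z^{k+1} − z^k‖ = 0, and lim_{k→∞} ‖μ^k − z^k‖ = 0. -/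
open Filter Topology

/-- A nonnegative sequence with asymptotically vanishing increments from above tends to zero if
whenever it is not small, a bounded potential decreases by a fixed amount over two steps. -/
theorem tendsto_zero_of_two_step_decrease {r φ : ℕ → ℝ} {B : ℝ} (hr : ∀ k, 0 ≤ r k)
    (hφ0 : ∀ k, 0 ≤ φ k) (hφB : ∀ k, φ k ≤ B)
    (hinc : ∀ η > 0, ∀ᶠ k in atTop, r (k + 1) ≤ r k + η)
    (hdec : ∀ ε > 0, ∃ c > 0, ∀ᶠ k in atTop, ε ≤ r k → φ (k + 2) ≤ φ k - c) :
    Tendsto r atTop (𝓝 0) := by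
  rw [Metric.tendsto_atTop]
  intro ε hε
  obtain ⟨c, hc, hdec⟩ := hdec (ε / 2) (by positivity)
  obtain ⟨N, hN⟩ := exists_nat_gt (B / c)
  rw [div_lt_iff₀ hc] at hN
  set η := ε / (4 * (N + 1)) with hη
  have hηpos : 0 < η := by positivity
  have hηN : 2 * N * η ≤ ε / 2 := by
    rw [hη, mul_div_assoc', div_le_div_iff₀ (by positivity) (by positivity)]
    nlinarith
  obtain ⟨K, hK⟩ := eventually_atTop.1 ((hinc η hηpos).and hdec)
  refine ⟨K + 2 * N, fun n hn => ?_⟩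
  rw [Real.dist_eq, sub_zero, abs_of_nonneg (hr n)]
  by_contra! hlarge
  obtain ⟨m, rfl⟩ : ∃ m, n = m + 2 * N := ⟨n - 2 * N, by omega⟩
  have hgrow : ∀ j i, K ≤ i → r (i + j) ≤ r i + j * η := by
    intro j i hi
    induction j with
    | zero => simp
    | succ j ih =>
      have := (hK (i + j) (by omega)).1
      rw [← add_assoc]
      push_cast
      linarith
  have hdrop : ∀ i, i ≤ N → φ (m + 2 * i) ≤ φ m - i * c := by
    intro i hi
    induction i with
    | zero => simp
    | succ i ih =>
      have h1 := hgrow (2 * (N - i)) (m + 2 * i) (by omega)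
      rw [show m + 2 * i + 2 * (N - i) = m + 2 * N by omega] at h1
      have h2 : ((2 * (N - i) : ℕ) : ℝ) * η ≤ 2 * N * η := by
        gcongr
        exact_mod_cast (by omega : 2 * (N - i) ≤ 2 * N)
      have h3 := (hK (m + 2 * i) (by omega)).2 (by linarith)
      have h4 := ih (by omega)
      rw [show m + 2 * (i + 1) = m + 2 * i + 2 by ring]
      push_cast
      linarith
  have := hdrop N le_rfl
  linarith [hφ0 (m + 2 * N), hφB m]

theorem residual_le_add {H : Type*} [NormedAddCommGroup H] {T : H → H}
    (hT : ∀ x y : H, ‖T x - T y‖ ≤ ‖x - y‖) (x y : H) :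
    ‖T y - y‖ ≤ ‖T x - x‖ + 2 * ‖y - x‖ := by
  have h : T y - y = (T y - T x) + (T x - x) - (y - x) := by abel
  rw [h]
  linarith [norm_sub_le ((T y - T x) + (T x - x)) (y - x), norm_add_le (T y - T x) (T x - x),
    hT y x]

section KrasnoselskiiMann

variable {H : Type*} [NormedAddCommGroup H] [InnerProductSpace ℝ H] {T : H → H}

theorem norm_sub_sq_relaxed_le (hT : ∀ x y : H, ‖T x - T y‖ ≤ ‖x - y‖) {p : H} (hp : T p = p)
    (x : H) {t : ℝ} (ht : 0 ≤ t) :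
    ‖x + t • (T x - x) - p‖ ^ 2 ≤ ‖x - p‖ ^ 2 - t * (1 - t) * ‖T x - x‖ ^ 2 := by
  have h1 : ‖T x - p‖ ^ 2 ≤ ‖x - p‖ ^ 2 := by
    have := hT x p
    rw [hp] at this
    gcongr
  have h2 : T x - p = (x - p) + (T x - x) := by abel
  have h3 : x + t • (T x - x) - p = (x - p) + t • (T x - x) := by abel
  rw [h2, norm_add_sq_real] at h1
  rw [h3, norm_add_sq_real, inner_smul_right, norm_smul, mul_pow, Real.norm_eq_abs, sq_abs]
  nlinarith

theorem residual_relaxed_le (hT : ∀ x y : H, ‖T x - T y‖ ≤ ‖x - y‖) (x : H) {t : ℝ}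
    (ht0 : 0 ≤ t) (ht1 : t ≤ 1) :
    ‖T (x + t • (T x - x)) - (x + t • (T x - x))‖ ≤ ‖T x - x‖ := by
  have h1 := hT (x + t • (T x - x)) x
  rw [add_sub_cancel_left, norm_smul, Real.norm_of_nonneg ht0] at h1
  have h2 : T (x + t • (T x - x)) - (x + t • (T x - x)) =
      (T (x + t • (T x - x)) - T x) + (1 - t) • (T x - x) := by module
  have h3 : ‖(1 - t) • (T x - x)‖ = (1 - t) * ‖T x - x‖ := by
    rw [norm_smul, Real.norm_of_nonneg (by linarith)]
  rw [h2]
  linarith [norm_add_le (T (x + t • (T x - x)) - T x) ((1 - t) • (T x - x))]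

theorem norm_inexact_step_sub_relaxed_le (hT : ∀ x y : H, ‖T x - T y‖ ≤ ‖x - y‖) (x m w : H)
    {t : ℝ} (ht0 : 0 ≤ t) (ht1 : t ≤ 1) :
    ‖m + t • (T m + w - m) - (x + t • (T x - x))‖ ≤ ‖m - x‖ + t * ‖w‖ := by
  have h : m + t • (T m + w - m) - (x + t • (T x - x)) =
      (1 - t) • (m - x) + t • (T m - T x) + t • w := by module
  have h1 : ‖(1 - t) • (m - x)‖ = (1 - t) * ‖m - x‖ := by
    rw [norm_smul, Real.norm_of_nonneg (by linarith)]
  have h2 : ‖t • (T m - T x)‖ ≤ t * ‖m - x‖ := by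
    rw [norm_smul, Real.norm_of_nonneg ht0]
    exact mul_le_mul_of_nonneg_left (hT m x) ht0
  have h3 : ‖t • w‖ = t * ‖w‖ := by rw [norm_smul, Real.norm_of_nonneg ht0]
  rw [h]
  linarith [norm_add₃_le (a := (1 - t) • (m - x)) (b := t • (T m - T x)) (c := t • w)]

end KrasnoselskiiMann

/-- Under conditions (I): ‖z^{k+1} − μ^k‖ → 0, ‖z^{k+1} − z^k‖ → 0 and ‖μ^k − z^k‖ → 0. -/
theorem inexact_inertial_KM_condI_successive_differences
    {H : Type*} [NormedAddCommGroup H] [InnerProductSpace ℝ H] [CompleteSpace H]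
    (T : H → H) (hT : ∀ x y : H, ‖T x - T y‖ ≤ ‖x - y‖)
    (hfix : ∃ p : H, T p = p)
    (z μ e : ℕ → H) (α lam : ℕ → ℝ) (a l l' : ℝ)
    -- the iteration: `z (k+1)` stands for `z^k` (so `z 0` is `z^{-1}`), `μ k` for `μ^k`
    (hμ : ∀ k, μ k = z (k + 1) + α k • (z (k + 1) - z k))
    (hz : ∀ k, z (k + 2) = μ k + lam k • (T (μ k) + e k - μ k))
    -- conditions (I)
    (ha0 : 0 ≤ a) (ha1 : a < 1)
    (hα : ∀ k, 0 ≤ α k ∧ α k ≤ a)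
    (hl : 0 < l) (hl' : l' < 1)
    (hlam : ∀ k, l ≤ lam k ∧ lam k ≤ l')
    (hsumα : Summable fun k => α k * ‖z (k + 2) - z (k + 1)‖ ^ 2)
    (hsume : Summable fun k => lam k * ‖e k‖)
    (hbdd : ∃ M : ℝ, ∀ k, ‖z k‖ ≤ M) :
    Tendsto (fun k => ‖z (k + 2) - μ k‖) atTop (nhds 0) ∧
      Tendsto (fun k => ‖z (k + 2) - z (k + 1)‖) atTop (nhds 0) ∧
      Tendsto (fun k => ‖μ k - z (k + 1)‖) atTop (nhds 0) := by
  obtain ⟨p, hp⟩ := hfix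
  obtain ⟨M, hM⟩ := hbdd
  set s : ℕ → ℝ := fun k => ‖μ k - z (k + 1)‖ with hs
  set d : ℕ → ℝ := fun k => ‖z (k + 2) - z (k + 1)‖ with hd
  set r : ℕ → ℝ := fun k => ‖T (z (k + 1)) - z (k + 1)‖ with hr
  set φ : ℕ → ℝ := fun k => ‖z (k + 1) - p‖ ^ 2 with hφ
  set E : ℕ → ℝ := fun k => lam k * ‖e k‖ with hE
  set δ : ℕ → ℝ := fun k => min (s k) (d k) + E k with hδ
  set R := M + ‖p‖ with hR
  have hlam0 : ∀ k, 0 ≤ lam k := fun k => hl.le.trans (hlam k).1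
  have hlam1 : ∀ k, lam k ≤ 1 := fun k => (hlam k).2.trans hl'.le
  have hs0 : ∀ k, 0 ≤ s k := fun k => norm_nonneg _
  have hd0 : ∀ k, 0 ≤ d k := fun k => norm_nonneg _
  have hr0 : ∀ k, 0 ≤ r k := fun k => norm_nonneg _
  have hE0 : ∀ k, 0 ≤ E k := fun k => mul_nonneg (hlam0 k) (norm_nonneg _)
  have hδ0 : ∀ k, 0 ≤ δ k := fun k => add_nonneg (le_min (hs0 k) (hd0 k)) (hE0 k)
  have hEδ : ∀ k, E k ≤ δ k := fun k => le_add_of_nonneg_left (le_min (hs0 k) (hd0 k))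
  have hs_eq : ∀ k, s k = α k * ‖z (k + 1) - z k‖ := by
    intro k
    simp only [hs]
    rw [hμ k, add_sub_cancel_left, norm_smul, Real.norm_of_nonneg (hα k).1]
  have hdist : ∀ k, ‖z (k + 1) - p‖ ≤ R := fun k => by
    linarith [norm_sub_le (z (k + 1)) p, hM (k + 1)]
  have hR0 : 0 ≤ R := (norm_nonneg _).trans (hdist 0)
  have hE_lim : Tendsto E atTop (𝓝 0) := hsume.tendsto_atTop_zero
  have hδ_lim : Tendsto δ atTop (𝓝 0) := by
    have hmin : Tendsto (fun k => min (s k) (d k)) atTop (𝓝 0) := by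
      have h4 : Tendsto (fun k => (min (s k) (d k)) ^ 4) atTop (𝓝 0) := by
        have hmaj := hsumα.tendsto_atTop_zero.const_mul ((2 * M) ^ 2)
        rw [mul_zero] at hmaj
        refine squeeze_zero (fun k => by positivity) (fun k => ?_) hmaj
        have hm0 : 0 ≤ min (s k) (d k) := le_min (hs0 k) (hd0 k)
        have hsk : s k ≤ α k * (2 * M) := by
          rw [hs_eq]
          refine mul_le_mul_of_nonneg_left ?_ (hα k).1
          linarith [norm_sub_le (z (k + 1)) (z k), hM k, hM (k + 1)]
        have hα1 : α k ^ 2 ≤ α k := by nlinarith [(hα k).1, (hα k).2]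
        calc (min (s k) (d k)) ^ 4 = (min (s k) (d k)) ^ 2 * (min (s k) (d k)) ^ 2 := by ring
          _ ≤ (α k * (2 * M)) ^ 2 * d k ^ 2 := by
            gcongr
            · exact (min_le_left _ _).trans hsk
            · exact min_le_right _ _
          _ = (α k ^ 2) * ((2 * M) ^ 2 * d k ^ 2) := by ring
          _ ≤ α k * ((2 * M) ^ 2 * d k ^ 2) := by gcongr
          _ = (2 * M) ^ 2 * (α k * d k ^ 2) := by ring
      rw [Metric.tendsto_atTop] at h4 ⊢
      intro ε hε
      obtain ⟨N, hN⟩ := h4 (ε ^ 4) (by positivity)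
      refine ⟨N, fun n hn => ?_⟩
      have := hN n hn
      rw [Real.dist_eq, sub_zero] at this ⊢
      rw [abs_pow] at this
      exact lt_of_pow_lt_pow_left₀ 4 hε.le this
    simpa using hmin.add hE_lim
  have hcases : ∀ k, s k ≤ δ k ∨ d k ≤ δ k := by
    intro k
    rcases min_choice (s k) (d k) with h | h
    · left
      simp only [hδ, h]
      linarith [hE0 k]
    · right
      simp only [hδ, h]
      linarith [hE0 k]
  have hstep : ∀ k, s k ≤ δ k →
      ‖z (k + 2) - (z (k + 1) + lam k • (T (z (k + 1)) - z (k + 1)))‖ ≤ 2 * δ k := by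
    intro k hk
    have := norm_inexact_step_sub_relaxed_le hT (z (k + 1)) (μ k) (e k) (hlam0 k) (hlam1 k)
    rw [← hz k] at this
    linarith [hEδ k, show ‖μ k - z (k + 1)‖ = s k from rfl, show lam k * ‖e k‖ = E k from rfl]
  have hr_inc : ∀ k, r (k + 1) ≤ r k + 4 * δ k := by
    intro k
    rcases hcases k with h | h
    · linarith [hstep k h, residual_relaxed_le hT (z (k + 1)) (hlam0 k) (hlam1 k),
        residual_le_add hT (z (k + 1) + lam k • (T (z (k + 1)) - z (k + 1))) (z (k + 2)),
        show ‖T (z (k + 1)) - z (k + 1)‖ = r k from rfl,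
        show ‖T (z (k + 2)) - z (k + 2)‖ = r (k + 1) from rfl]
    · linarith [residual_le_add hT (z (k + 1)) (z (k + 2)), hδ0 k,
        show ‖z (k + 2) - z (k + 1)‖ = d k from rfl,
        show ‖T (z (k + 1)) - z (k + 1)‖ = r k from rfl,
        show ‖T (z (k + 2)) - z (k + 2)‖ = r (k + 1) from rfl]
  have hr_back : ∀ k, r k ≤ r (k + 1) + 2 * d k := by
    intro k
    have := residual_le_add hT (z (k + 2)) (z (k + 1))
    rwa [norm_sub_rev (z (k + 1)) (z (k + 2))] at this
  have hsq : ∀ k (y : H) (b : ℝ), ‖z (k + 2) - y‖ ≤ b → ‖y - p‖ ≤ R →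
      ‖z (k + 2) - p‖ ^ 2 ≤ ‖y - p‖ ^ 2 + 2 * R * b := by
    intro k y b hb hy
    have h1 := norm_sub_le_norm_sub_add_norm_sub (z (k + 2)) y p
    have h2 : ‖z (k + 2) - p‖ ≤ R := hdist (k + 1)
    have hb0 := (norm_nonneg _).trans hb
    have h3 : (‖z (k + 2) - p‖ - ‖y - p‖) * (‖z (k + 2) - p‖ + ‖y - p‖) ≤ b * (2 * R) := by
      refine mul_le_mul (by linarith) (by linarith) (by positivity) hb0
    nlinarith
  have hcpos : 0 < l * (1 - l') := mul_pos hl (by linarith)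
  have hφ_dec : ∀ k, s k ≤ δ k → φ (k + 1) ≤ φ k - l * (1 - l') * r k ^ 2 + 4 * R * δ k := by
    intro k hk
    have h1 := norm_sub_sq_relaxed_le hT hp (z (k + 1)) (hlam0 k)
    have h2 : l * (1 - l') ≤ lam k * (1 - lam k) :=
      mul_le_mul (hlam k).1 (by linarith [(hlam k).2]) (by linarith) (hlam0 k)
    have h3 : l * (1 - l') * r k ^ 2 ≤ lam k * (1 - lam k) * r k ^ 2 := by gcongr
    have h4 : 0 ≤ l * (1 - l') * r k ^ 2 := by positivity
    have h5 : ‖z (k + 1) + lam k • (T (z (k + 1)) - z (k + 1)) - p‖ ≤ R := by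
      refine le_trans ?_ (hdist k)
      refine (sq_le_sq₀ (norm_nonneg _) (norm_nonneg _)).1 ?_
      linarith [show ‖T (z (k + 1)) - z (k + 1)‖ = r k from rfl]
    have h6 := hsq k _ _ (hstep k hk) h5
    linarith [show φ k = ‖z (k + 1) - p‖ ^ 2 from rfl,
      show φ (k + 1) = ‖z (k + 2) - p‖ ^ 2 from rfl]
  have hφ_inc : ∀ k, φ (k + 1) ≤ φ k + 4 * R * δ k := by
    intro k
    rcases hcases k with h | h
    · have : 0 ≤ l * (1 - l') * r k ^ 2 := by positivity
      linarith [hφ_dec k h]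
    · have h1 := hsq k _ _ h (hdist k)
      have h2 := mul_nonneg hR0 (hδ0 k)
      linarith [show φ k = ‖z (k + 1) - p‖ ^ 2 from rfl,
        show φ (k + 1) = ‖z (k + 2) - p‖ ^ 2 from rfl]
  have hdiff : ∀ k, z (k + 2) - z (k + 1) - lam k • (T (z (k + 1)) - z (k + 1)) =
      z (k + 2) - (z (k + 1) + lam k • (T (z (k + 1)) - z (k + 1))) := fun k => by abel
  have hr_stall : ∀ k, d k ≤ δ k → d (k + 1) ≤ δ (k + 1) →
      l * r (k + 1) ≤ δ k + 2 * δ (k + 1) := by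
    intro k h1 h2
    have h3 := norm_inexact_step_sub_relaxed_le hT (z (k + 2)) (μ (k + 1)) (e (k + 1))
      (hlam0 (k + 1)) (hlam1 (k + 1))
    have hz' : z (k + 3) = _ := hz (k + 1)
    rw [← hz'] at h3
    have h4 : s (k + 1) ≤ d k := by
      rw [hs_eq]
      exact mul_le_of_le_one_left (norm_nonneg _) ((hα (k + 1)).2.trans ha1.le)
    have h5 : lam (k + 1) • (T (z (k + 2)) - z (k + 2)) = (z (k + 3) - z (k + 2)) -
        (z (k + 3) - (z (k + 2) + lam (k + 1) • (T (z (k + 2)) - z (k + 2)))) := by abel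
    have h6 : lam (k + 1) * r (k + 1) = ‖lam (k + 1) • (T (z (k + 2)) - z (k + 2))‖ := by
      rw [norm_smul, Real.norm_of_nonneg (hlam0 (k + 1))]
    have h7 : l * r (k + 1) ≤ lam (k + 1) * r (k + 1) :=
      mul_le_mul_of_nonneg_right (hlam (k + 1)).1 (hr0 _)
    rw [h5] at h6
    linarith [norm_sub_le (z (k + 3) - z (k + 2))
        (z (k + 3) - (z (k + 2) + lam (k + 1) • (T (z (k + 2)) - z (k + 2)))),
      hEδ (k + 1), show ‖μ (k + 1) - z (k + 2)‖ = s (k + 1) from rfl,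
      show ‖z (k + 3) - z (k + 2)‖ = d (k + 1) from rfl,
      show lam (k + 1) * ‖e (k + 1)‖ = E (k + 1) from rfl]
  have hr_lim : Tendsto r atTop (𝓝 0) := by
    refine tendsto_zero_of_two_step_decrease (φ := φ) (B := R ^ 2) hr0 (fun k => sq_nonneg _)
      (fun k => pow_le_pow_left₀ (norm_nonneg _) (hdist k) 2) ?_ ?_
    · intro η hη
      filter_upwards [hδ_lim.eventually (gt_mem_nhds (show 0 < η / 4 by positivity))] with k hk
      linarith [hr_inc k]
    · intro ε hε
      set c := l * (1 - l') * (ε / 2) ^ 2 with hc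
      have hc0 : 0 < c := by positivity
      refine ⟨c / 2, by positivity, ?_⟩
      have hsmall : ∀ᶠ k in atTop, δ k < ε / 4 ∧ δ k < l * ε / 8 ∧ 8 * R * δ k < c / 2 := by
        have h3 : Tendsto (fun k => 8 * R * δ k) atTop (𝓝 0) := by
          simpa using hδ_lim.const_mul (8 * R)
        exact (hδ_lim.eventually (gt_mem_nhds (by positivity))).and
          ((hδ_lim.eventually (gt_mem_nhds (by positivity))).and
            (h3.eventually (gt_mem_nhds (by positivity))))
      filter_upwards [hsmall, (tendsto_add_atTop_nat 1).eventually hsmall] with k h0 h1 hk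
      obtain ⟨ha, hb, hc1⟩ := h0
      obtain ⟨ha', hb', hc1'⟩ := h1
      have hφ2 := hφ_inc (k + 1)
      have hdrop : ∀ i, ε / 2 ≤ r i → c ≤ l * (1 - l') * r i ^ 2 := fun i hi => by
        rw [hc]
        gcongr
      rcases hcases k with h | h
      · linarith [hφ_dec k h, hdrop k (by linarith)]
      · have hrk : ε / 2 ≤ r (k + 1) := by linarith [hr_back k]
        rcases hcases (k + 1) with h' | h'
        · linarith [hφ_dec (k + 1) h', hφ_inc k, hdrop (k + 1) hrk]
        · have := hr_stall k h h'
          have := mul_le_mul_of_nonneg_left hrk hl.le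
          linarith [mul_pos hl hε]
  have hd_lim : Tendsto d atTop (𝓝 0) := by
    have hmaj : Tendsto (fun k => r k + 2 * δ k) atTop (𝓝 0) := by
      simpa using hr_lim.add (hδ_lim.const_mul 2)
    refine squeeze_zero hd0 (fun k => ?_) hmaj
    rcases hcases k with h | h
    · have h1 := hstep k h
      rw [← hdiff k] at h1
      have h2 : ‖lam k • (T (z (k + 1)) - z (k + 1))‖ ≤ r k := by
        rw [norm_smul, Real.norm_of_nonneg (hlam0 k)]
        exact mul_le_of_le_one_left (norm_nonneg _) (hlam1 k)
      linarith [norm_le_norm_sub_add (z (k + 2) - z (k + 1))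
          (lam k • (T (z (k + 1)) - z (k + 1))),
        show ‖z (k + 2) - z (k + 1)‖ = d k from rfl]
    · linarith [hr0 k, hδ0 k]
  have hs_lim : Tendsto s atTop (𝓝 0) := by
    rw [← tendsto_add_atTop_iff_nat 1]
    refine squeeze_zero (fun k => hs0 _) (fun k => ?_) hd_lim
    rw [hs_eq]
    exact mul_le_of_le_one_left (norm_nonneg _) ((hα (k + 1)).2.trans ha1.le)
  refine ⟨?_, hd_lim, hs_lim⟩
  refine squeeze_zero (fun k => norm_nonneg _) (fun k => ?_) (by simpa using hd_lim.add hs_lim)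
  have := norm_sub_le_norm_sub_add_norm_sub (z (k + 2)) (z (k + 1)) (μ k)
  rwa [norm_sub_rev (z (k + 1)) (μ k)] at this
end

section
/- Let H be a real Hilbert space and T : H → H nonexpansive with Fix(T) ≠ ∅. Let (z^k), (μ^k) be generated by the inexact inertial Krasnoselskii–Mann iteration and assume conditions (II) hold. Then Σ_{k=0}^∞ ‖z^{k+1} − z^k‖² < +∞; in particular lim_{k→∞} ‖z^{k+1} − z^k‖ = 0. -/
open Filter Topology

/-- The inertial extrapolation identity for the squared distance to `p`. -/
theorem norm_inertial_sub_sq {H : Type*} [NormedAddCommGroup H] [InnerProductSpace ℝ H]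
    (x y p : H) (t : ℝ) :
    ‖y + t • (y - x) - p‖ ^ 2 =
      (1 + t) * ‖y - p‖ ^ 2 - t * ‖x - p‖ ^ 2 + t * (1 + t) * ‖y - x‖ ^ 2 := by
  have h1 : y + t • (y - x) - p = (y - p) + t • (y - x) := by abel
  have h2 : x - p = (y - p) - (y - x) := by abel
  rw [h1, h2, norm_add_sq_real, norm_sub_sq_real (y - p), inner_smul_right, norm_smul, mul_pow,
    Real.norm_eq_abs, sq_abs]
  ring

/-- The squared norm of a relaxed step towards `v`. -/
theorem norm_relaxation_sub_sq {H : Type*} [NormedAddCommGroup H] [InnerProductSpace ℝ H]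
    (m v p : H) (t : ℝ) :
    ‖m + t • (v - m) - p‖ ^ 2 =
      (1 - t) * ‖m - p‖ ^ 2 + t * ‖v - p‖ ^ 2 - t * (1 - t) * ‖v - m‖ ^ 2 := by
  have h1 : m + t • (v - m) - p = (m - p) + t • (v - m) := by abel
  have h2 : v - p = (m - p) + (v - m) := by abel
  rw [h1, h2, norm_add_sq_real, norm_add_sq_real, inner_smul_right, norm_smul, mul_pow,
    Real.norm_eq_abs, sq_abs]
  ring

/-- A weighted Young inequality bounding `‖u - t • d‖ ^ 2` from below. -/
theorem le_mul_norm_sub_smul_sq {H : Type*} [NormedAddCommGroup H] [InnerProductSpace ℝ H]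
    (u d : H) {t : ℝ} (ht : 0 ≤ t) (s : ℝ) :
    s * ‖u‖ ^ 2 - (t + s) * t * s * ‖d‖ ^ 2 ≤ (t + s) * ‖u - t • d‖ ^ 2 := by
  have h : 0 ≤ t * ‖u - (t + s) • d‖ ^ 2 := by positivity
  rw [norm_sub_sq_real, inner_smul_right, norm_smul, mul_pow, Real.norm_eq_abs, sq_abs] at h ⊢
  linarith

/-- A quasi-Fejér type criterion for summability. -/
theorem summable_of_forall_succ_add_le {Θ f b : ℕ → ℝ} {c B : ℝ} (hc : 0 < c)
    (hf : ∀ k, 0 ≤ f k) (hb : ∀ k, 0 ≤ b k) (hbs : Summable b) (hB : ∀ k, B ≤ Θ k)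
    (h : ∀ k, Θ (k + 1) + c * f k ≤ Θ k + b k) : Summable f := by
  refine summable_of_sum_range_le (c := (Θ 0 - B + ∑' k, b k) / c) hf fun n => ?_
  have key : Θ n + c * ∑ k ∈ Finset.range n, f k ≤ Θ 0 + ∑ k ∈ Finset.range n, b k := by
    induction n with
    | zero => simp
    | succ n ih =>
      rw [Finset.sum_range_succ, Finset.sum_range_succ]
      linarith [h n]
  have hsum := hbs.sum_le_tsum (Finset.range n) fun k _ => hb k
  rw [le_div_iff₀ hc]
  linarith [hB n]

/-- One step of the inexact inertial Krasnoselskii–Mann iteration. -/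
theorem inexact_inertial_KM_step {H : Type*} [NormedAddCommGroup H] [InnerProductSpace ℝ H]
    {T : H → H} (hT : ∀ x y : H, ‖T x - T y‖ ≤ ‖x - y‖) {p : H} (hp : T p = p)
    {x y w m e : H} {t s a δ X : ℝ} (hm : m = y + t • (y - x))
    (hw : w = m + s • (T m + e - m)) (ht : 0 ≤ t) (hta : t ≤ a) (hs : 0 < s) (hs1 : s ≤ 1)
    (hδ : 0 < δ) (hX : X * (t + δ * s) ≤ δ * (1 - s)) :
    ‖w - p‖ ^ 2 + X * ‖w - y‖ ^ 2 ≤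
      (1 + t) * ‖y - p‖ ^ 2 - t * ‖x - p‖ ^ 2 + (a * (1 + a) + a * δ) * ‖y - x‖ ^ 2 +
        (2 * ‖m - p‖ + ‖e‖) * ‖e‖ := by
  have hwm : w - m = (w - y) - t • (y - x) := by rw [hm]; abel
  have hq : ‖w - m‖ ^ 2 = s ^ 2 * ‖T m + e - m‖ ^ 2 := by
    rw [hw, add_sub_cancel_left, norm_smul, mul_pow, Real.norm_eq_abs, sq_abs]
  have hwp := norm_relaxation_sub_sq m (T m + e) p s
  have hmp := norm_inertial_sub_sq x y p t
  have hyoung := le_mul_norm_sub_smul_sq (w - y) (y - x) ht (δ * s)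
  rw [← hw] at hwp
  rw [← hm] at hmp
  rw [← hwm, hq] at hyoung
  have hTe : ‖T m + e - p‖ ^ 2 ≤ (‖m - p‖ + ‖e‖) ^ 2 := by
    gcongr
    calc ‖T m + e - p‖ = ‖(T m - T p) + e‖ := by rw [hp]; congr 1; abel
      _ ≤ ‖T m - T p‖ + ‖e‖ := norm_add_le _ _
      _ ≤ ‖m - p‖ + ‖e‖ := by gcongr; exact hT m p
  have hr : 0 < t + δ * s := by positivity
  have hs1' : 0 ≤ 1 - s := sub_nonneg.2 hs1
  have hres : X * ‖w - y‖ ^ 2 - (1 - s) * t * δ * ‖y - x‖ ^ 2 ≤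
      s * (1 - s) * ‖T m + e - m‖ ^ 2 := by
    refine le_of_mul_le_mul_left ?_ (mul_pos hr hs)
    have h1 := mul_le_mul_of_nonneg_left hyoung hs1'
    have h2 := mul_le_mul_of_nonneg_left hX (mul_nonneg hs.le (sq_nonneg ‖w - y‖))
    linarith
  have hcoef : t * (1 + t) + (1 - s) * t * δ ≤ a * (1 + a) + a * δ := by
    have h1 : (1 - s) * t ≤ a := (mul_le_of_le_one_left ht (by linarith)).trans hta
    have h2 : t * (1 + t) ≤ a * (1 + a) := by gcongr; exact ht.trans hta
    linarith [mul_le_mul_of_nonneg_right h1 hδ.le]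
  have hcoef' := mul_le_mul_of_nonneg_right hcoef (sq_nonneg ‖y - x‖)
  have herr : s * ((2 * ‖m - p‖ + ‖e‖) * ‖e‖) ≤ (2 * ‖m - p‖ + ‖e‖) * ‖e‖ :=
    mul_le_of_le_one_left (by positivity) hs1
  have hTe' := mul_le_mul_of_nonneg_left hTe hs.le
  linarith

/-- Theorem 3.2 (i): under conditions (II), ∑ ‖z^{k+1} − z^k‖² < ∞ and ‖z^{k+1} − z^k‖ → 0. -/
theorem inexact_inertial_KM_condII_square_summable
    {H : Type*} [NormedAddCommGroup H] [InnerProductSpace ℝ H] [CompleteSpace H]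
    (T : H → H) (hT : ∀ x y : H, ‖T x - T y‖ ≤ ‖x - y‖)
    (hfix : ∃ p : H, T p = p)
    (z μ e : ℕ → H) (α lam : ℕ → ℝ) (a l σ δ : ℝ)
    -- the iteration: `z (k+1)` stands for `z^k` (so `z 0` is `z^{-1}`), `μ k` for `μ^k`
    (hμ : ∀ k, μ k = z (k + 1) + α k • (z (k + 1) - z k))
    (hz : ∀ k, z (k + 2) = μ k + lam k • (T (μ k) + e k - μ k))
    -- conditions (II)
    (hαmono : Monotone α) (hα0 : α 0 = 0)
    (hα : ∀ k, 0 ≤ α k ∧ α k ≤ a) (ha1 : a < 1)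
    (hl : 0 < l) (hσ : 0 < σ) (hδ : 0 < δ)
    (hδbig : δ > a * (a * (1 + a) + σ) / (1 - a ^ 2))
    (hlam : ∀ k, l ≤ lam k ∧
      lam k ≤ (δ - a * (a * (1 + a) + a * δ + σ)) / (δ * (1 + a * (1 + a) + a * δ + σ)))
    (hbdd : ∃ M : ℝ, ∀ k, ‖z k‖ ≤ M)
    (hsume : Summable fun k => ‖e k‖) :
    (Summable fun k => ‖z (k + 2) - z (k + 1)‖ ^ 2) ∧
      Tendsto (fun k => ‖z (k + 2) - z (k + 1)‖) atTop (nhds 0) := by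
  obtain ⟨p, hp⟩ := hfix
  obtain ⟨M, hM⟩ := hbdd
  have ha : 0 ≤ a := (hα 0).1.trans (hα 0).2
  have hM0 : 0 ≤ M := (norm_nonneg _).trans (hM 0)
  set X := a * (1 + a) + a * δ + σ with hXdef
  have hX : 0 < X := by positivity
  have hzp : ∀ k, ‖z k - p‖ ≤ M + ‖p‖ := fun k =>
    (norm_sub_le _ _).trans (by gcongr; exact hM k)
  have hμp : ∀ k, ‖μ k - p‖ ≤ (M + ‖p‖) + 2 * M := fun k => by
    have hd : ‖z (k + 1) - z k‖ ≤ 2 * M :=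
      (norm_sub_le _ _).trans (by linarith [hM (k + 1), hM k])
    calc ‖μ k - p‖ = ‖(z (k + 1) - p) + α k • (z (k + 1) - z k)‖ := by
          rw [hμ]; congr 1; abel
      _ ≤ ‖z (k + 1) - p‖ + α k * ‖z (k + 1) - z k‖ := by
          refine (norm_add_le _ _).trans_eq ?_
          rw [norm_smul, Real.norm_of_nonneg (hα k).1]
      _ ≤ (M + ‖p‖) + 2 * M := by
          refine add_le_add (hzp _) ((mul_le_of_le_one_left (norm_nonneg _) ?_).trans hd)
          exact (hα k).2.trans ha1.le
  have hstep : ∀ k, X * (α k + δ * lam k) ≤ δ * (1 - lam k) := fun k => by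
    have h1 := (hlam k).2
    rw [show 1 + a * (1 + a) + a * δ + σ = 1 + X by rw [hXdef]; ring,
      le_div_iff₀ (by positivity)] at h1
    have h2 := mul_le_mul_of_nonneg_right (hα k).2 hX.le
    linarith
  have hlpos : ∀ k, 0 < lam k := fun k => hl.trans_le (hlam k).1
  have hl1 : ∀ k, lam k ≤ 1 := fun k => by
    have h0 : 0 ≤ X * (α k + δ * lam k) :=
      mul_nonneg hX.le (add_nonneg (hα k).1 (mul_pos hδ (hlpos k)).le)
    exact sub_nonneg.1 (nonneg_of_mul_nonneg_right (h0.trans (hstep k)) hδ)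
  have hsq : Summable fun k => ‖z (k + 2) - z (k + 1)‖ ^ 2 := by
    refine summable_of_forall_succ_add_le
      (Θ := fun k => ‖z (k + 1) - p‖ ^ 2 - α k * ‖z k - p‖ ^ 2 +
        (a * (1 + a) + a * δ) * ‖z (k + 1) - z k‖ ^ 2)
      (b := fun k => (2 * ((M + ‖p‖) + 2 * M) + ∑' j, ‖e j‖) * ‖e k‖)
      (B := -(M + ‖p‖) ^ 2) hσ (fun k => by positivity)
      (fun k => mul_nonneg (add_nonneg (by positivity) (tsum_nonneg fun _ => norm_nonneg _))
        (norm_nonneg _)) (hsume.mul_left _) (fun k => ?_) fun k => ?_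
    · have h1 : α k * ‖z k - p‖ ^ 2 ≤ (M + ‖p‖) ^ 2 :=
        (mul_le_of_le_one_left (by positivity) ((hα k).2.trans ha1.le)).trans
          (pow_le_pow_left₀ (norm_nonneg _) (hzp k) 2)
      have h2 : 0 ≤ (a * (1 + a) + a * δ) * ‖z (k + 1) - z k‖ ^ 2 := by positivity
      linarith [sq_nonneg ‖z (k + 1) - p‖]
    · have h1 := inexact_inertial_KM_step hT hp (hμ k) (hz k) (hα k).1 (hα k).2 (hlpos k)
        (hl1 k) hδ (hstep k)
      have h2 : (2 * ‖μ k - p‖ + ‖e k‖) * ‖e k‖ ≤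
          (2 * ((M + ‖p‖) + 2 * M) + ∑' j, ‖e j‖) * ‖e k‖ := by
        gcongr
        · exact hμp k
        · exact hsume.le_tsum k fun _ _ => norm_nonneg _
      have h3 := mul_le_mul_of_nonneg_right (hαmono k.le_succ) (sq_nonneg ‖z (k + 1) - p‖)
      rw [hXdef] at h1
      simp only [Nat.succ_eq_add_one] at h3
      linarith
  refine ⟨hsq, ?_⟩
  simpa using hsq.tendsto_atTop_zero.sqrt
end

section
/- Let H be a real Hilbert space and T : H → H nonexpansive with z* ∈ Fix(T). Let (z^k), (μ^k) be generated by the inexact inertial Krasnoselskii–Mann iteration and assume conditions (I) hold. Set Δ := α Σ_{k=1}^∞ max(‖z^k − z*‖² − ‖z^{k−1} − z*‖², 0) + Σ_{k=1}^∞ 2‖z^{k+1} − z*‖ λ_k ‖e^k‖ + Σ_{k=1}^∞ α_k(1 + α_k)‖z^k − z^{k−1}‖². Then Δ < +∞ and for every k ≥ 1: min_{1 ≤ i ≤ k} ‖Tμ^i − μ^i‖² ≤ (‖z^1 − z*‖² + Δ) / (k λ (1 − λ')). -/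
open Filter Topology

/-- A nonnegative sequence that decreases up to a summable error makes its decrements summable. -/
theorem summable_of_add_le_add {W x r : ℕ → ℝ} (hW : ∀ k, 0 ≤ W k) (hx : ∀ k, 0 ≤ x k)
    (hr0 : ∀ k, 0 ≤ r k) (hr : Summable r) (h : ∀ k, W (k + 1) + x k ≤ W k + r k) :
    Summable x := by
  have key : ∀ n, W n + ∑ i ∈ Finset.range n, x i ≤ W 0 + ∑ i ∈ Finset.range n, r i := by
    intro n
    induction n with
    | zero => simp
    | succ n ih =>
      rw [Finset.sum_range_succ, Finset.sum_range_succ]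
      linarith [h n]
  refine summable_of_sum_range_le (c := W 0 + ∑' i, r i) hx fun n => ?_
  linarith [key n, hW n, hr.sum_le_tsum (Finset.range n) fun i _ => hr0 i]

/-- The scalar estimate behind the recursion for the weighted squared increments. -/
theorem mul_sq_le_of_increment_bound {a l α β D D' D'' m Y E E' : ℝ} (ha1 : a < 1) (hl : 0 < l)
    (hα : 0 ≤ α) (hα1 : α ≤ 1) (hβ : 0 ≤ β) (hD' : 0 ≤ D') (hm0 : 0 ≤ m)
    (hm : m ≤ β * D + E) (h : (1 - a) * D' ≤ m + Y + D'' / l + E' / l) :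
    α * D' ^ 2 ≤ 1 / 2 * (β * D ^ 2) + 4 / (1 - a) ^ 2 * Y ^ 2 +
      (4 / (1 - a) ^ 2 * (2 * E ^ 2 + E' ^ 2 / l ^ 2) +
        4 / (1 - a) ^ 2 / l ^ 2 * (α * D'' ^ 2) + 4 * (4 / (1 - a) ^ 2) * (β * D' ^ 2)) := by
  have ha : 0 < 1 - a := by linarith
  obtain ⟨K, hK⟩ : ∃ K : ℝ, K = 4 / (1 - a) ^ 2 := ⟨_, rfl⟩
  have hK0 : 0 < K := by rw [hK]; positivity
  rw [← hK]
  have hr1 : 0 ≤ K * Y ^ 2 := by positivity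
  have hr2 : 0 ≤ K * (2 * E ^ 2 + E' ^ 2 / l ^ 2) := by positivity
  have hr3 : 0 ≤ K / l ^ 2 * (α * D'' ^ 2) := by positivity
  have hr4 : 0 ≤ 4 * K * (β * D' ^ 2) := by positivity
  have hr5 : 0 ≤ β * D ^ 2 := by positivity
  rcases le_or_gt (4 * K * β) 1 with hβ1 | hβ1
  · have hsq : D' ^ 2 ≤ K * (m ^ 2 + Y ^ 2 + (D'' / l) ^ 2 + (E' / l) ^ 2) := by
      have h1 := pow_le_pow_left₀ (mul_nonneg ha.le hD') h 2
      have h2 : ((1 - a) * D') ^ 2 ≤ 4 * (m ^ 2 + Y ^ 2 + (D'' / l) ^ 2 + (E' / l) ^ 2) := by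
        refine h1.trans ?_
        linarith [sq_nonneg (m - Y), sq_nonneg (m - D'' / l), sq_nonneg (m - E' / l),
          sq_nonneg (Y - D'' / l), sq_nonneg (Y - E' / l), sq_nonneg (D'' / l - E' / l)]
      rw [hK, div_mul_eq_mul_div, le_div_iff₀ (by positivity)]
      linarith [mul_pow (1 - a) D' 2]
    have hmsq : m ^ 2 ≤ 2 * (β * D) ^ 2 + 2 * E ^ 2 := by
      have := pow_le_pow_left₀ hm0 hm 2
      linarith [sq_nonneg (β * D - E)]
    have h3 : K * (2 * (β * D) ^ 2) ≤ 1 / 2 * (β * D ^ 2) := by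
      linarith [mul_le_mul_of_nonneg_right hβ1 hr5]
    have h4 := mul_le_mul_of_nonneg_left hmsq hK0.le
    have hP : 0 ≤ K * (m ^ 2 + Y ^ 2 + (E' / l) ^ 2) := by positivity
    have h6 := mul_le_mul_of_nonneg_left hsq hα
    have h7 := mul_le_mul_of_nonneg_right hα1 hP
    have h8 : α * (K * (m ^ 2 + Y ^ 2 + (D'' / l) ^ 2 + (E' / l) ^ 2)) =
        α * (K * (m ^ 2 + Y ^ 2 + (E' / l) ^ 2)) + K / l ^ 2 * (α * D'' ^ 2) := by ring
    have h9 : (E' / l) ^ 2 = E' ^ 2 / l ^ 2 := div_pow _ _ _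
    rw [h9] at h6 h7 h8
    linarith
  · have h1 := mul_le_mul_of_nonneg_right (hα1.trans hβ1.le) (sq_nonneg D')
    linarith

section Step

variable {H : Type*} [NormedAddCommGroup H] [InnerProductSpace ℝ H] {T : H → H}

/-- The step of the inertial iteration differs from the plain relaxed step by at most the
extrapolation and the error. -/
theorem norm_inertial_step_sub_le (hT : ∀ x y : H, ‖T x - T y‖ ≤ ‖x - y‖) {x d e y : H} {α l : ℝ}
    (hα : 0 ≤ α) (hl : 0 ≤ l) (hl1 : l ≤ 1)
    (hy : y = x + α • d + l • (T (x + α • d) + e - (x + α • d))) :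
    ‖y - x - l • (T x - x)‖ ≤ α * ‖d‖ + l * ‖e‖ := by
  have e1 : y - x - l • (T x - x) =
      (1 - l) • (α • d) + l • (T (x + α • d) - T x) + l • e := by
    rw [hy]; module
  have h1 : ‖T (x + α • d) - T x‖ ≤ α * ‖d‖ := by
    have := hT (x + α • d) x
    rwa [add_sub_cancel_left, norm_smul, Real.norm_of_nonneg hα] at this
  calc ‖y - x - l • (T x - x)‖
      ≤ ‖(1 - l) • (α • d)‖ + ‖l • (T (x + α • d) - T x)‖ + ‖l • e‖ := by
        rw [e1]; exact norm_add₃_le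
    _ = (1 - l) * (α * ‖d‖) + l * ‖T (x + α • d) - T x‖ + l * ‖e‖ := by
        rw [norm_smul, norm_smul, norm_smul, norm_smul, Real.norm_of_nonneg hα,
          Real.norm_of_nonneg hl, Real.norm_of_nonneg (by linarith : 0 ≤ 1 - l)]
    _ ≤ α * ‖d‖ + l * ‖e‖ := by nlinarith

/-- Near-monotonicity of the residual `T x - x` along one step close to a relaxed step. -/
theorem residual_sq_step_le (hT : ∀ x y : H, ‖T x - T y‖ ≤ ‖x - y‖) {x y : H} {l M : ℝ}
    (hM : ‖y - x - l • (T x - x)‖ ≤ M) :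
    l * (‖T y - y‖ ^ 2 - ‖T x - x‖ ^ 2) + (1 - l) * ‖(T y - y) - (T x - x)‖ ^ 2
      ≤ 4 * (‖y - x‖ * M) := by
  obtain ⟨m, hm⟩ : ∃ m, m = y - x - l • (T x - x) := ⟨_, rfl⟩
  obtain ⟨u, hu⟩ : ∃ u, u = T x - x := ⟨_, rfl⟩
  obtain ⟨w, hw⟩ : ∃ w, w = (T y - y) - (T x - x) := ⟨_, rfl⟩
  have hyx : y - x = l • u + m := by rw [hm, hu]; module
  have hv : T y - y = u + w := by rw [hu, hw]; abel
  have hTyx : T y - T x = w + (y - x) := by rw [hw]; abel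
  have h1 : ‖w + (y - x)‖ ^ 2 ≤ ‖y - x‖ ^ 2 := by
    rw [← hTyx]; exact pow_le_pow_left₀ (norm_nonneg _) (hT y x) 2
  have h2 : ‖w‖ ≤ 2 * ‖y - x‖ := by
    have : w = (T y - T x) - (y - x) := by rw [hTyx]; abel
    rw [this]
    linarith [norm_sub_le (T y - T x) (y - x), hT y x]
  rw [norm_add_sq_real, hyx, inner_add_right, inner_smul_right, ← hyx] at h1
  have h3 : -inner ℝ w m ≤ ‖w‖ * ‖m‖ := by
    linarith [neg_abs_le (inner ℝ w m), abs_real_inner_le_norm w m]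
  have h4 : ‖w‖ * ‖m‖ ≤ 2 * ‖y - x‖ * M :=
    mul_le_mul h2 (hm ▸ hM) (norm_nonneg _) (by positivity)
  rw [← hw, ← hu, hv, norm_add_sq_real, real_inner_comm w u]
  nlinarith

/-- A large increment `d` followed by a small one forces a change of the residual. -/
theorem mul_norm_increment_le (hT : ∀ x y : H, ‖T x - T y‖ ≤ ‖x - y‖) {x d e y u₀ : H}
    {α a l l₀ b : ℝ} (hα : 0 ≤ α) (hαa : α ≤ a) (hb : 0 < b) (hbl : b ≤ l) (hl1 : l ≤ 1)
    (hl₀ : 0 ≤ l₀) (hl₀1 : l₀ ≤ 1)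
    (hy : y = x + α • d + l • (T (x + α • d) + e - (x + α • d))) :
    (1 - a) * ‖d‖ ≤ ‖d - l₀ • u₀‖ + ‖(T x - x) - u₀‖ + ‖y - x‖ / b + l * ‖e‖ / b := by
  have hl : 0 < l := hb.trans_le hbl
  obtain ⟨u, hu⟩ : ∃ u, u = T x - x := ⟨_, rfl⟩
  obtain ⟨q, hq⟩ : ∃ q, q = T (x + α • d) - T x := ⟨_, rfl⟩
  have hqn : ‖q‖ ≤ α * ‖d‖ := by
    have := hT (x + α • d) x
    rwa [← hq, add_sub_cancel_left, norm_smul, Real.norm_of_nonneg hα] at this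
  have e1 : l • u = (y - x) - (α * (1 - l)) • d - l • q - l • e := by
    rw [hy, hu, hq]; module
  have c1 := real_inner_le_norm (y - x) d
  have c2 : -inner ℝ q d ≤ α * ‖d‖ * ‖d‖ := by
    have := mul_le_mul_of_nonneg_right hqn (norm_nonneg d)
    linarith [neg_abs_le (inner ℝ q d), abs_real_inner_le_norm q d]
  have c3 : -inner ℝ e d ≤ ‖e‖ * ‖d‖ := by
    linarith [neg_abs_le (inner ℝ e d), abs_real_inner_le_norm e d]
  have hin : l * inner ℝ u d ≤ l * (α * ‖d‖ ^ 2) + (‖y - x‖ + l * ‖e‖) * ‖d‖ := by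
    have : l * inner ℝ u d = inner ℝ (y - x) d - α * (1 - l) * ‖d‖ ^ 2
        - l * inner ℝ q d - l * inner ℝ e d := by
      rw [← real_inner_smul_left, e1, inner_sub_left, inner_sub_left, inner_sub_left,
        real_inner_smul_left, real_inner_smul_left, real_inner_smul_left,
        real_inner_self_eq_norm_sq]
    have h0 : 0 ≤ α * (1 - l) * ‖d‖ ^ 2 :=
      mul_nonneg (mul_nonneg hα (by linarith)) (sq_nonneg _)
    nlinarith [mul_le_mul_of_nonneg_left c2 hl.le, mul_le_mul_of_nonneg_left c3 hl.le]
  have hin2 : inner ℝ u d ≤ α * ‖d‖ ^ 2 + (‖y - x‖ / b + l * ‖e‖ / b) * ‖d‖ := by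
    have hN : 0 ≤ (‖y - x‖ + l * ‖e‖) * ‖d‖ := by positivity
    have h5 : inner ℝ u d ≤ α * ‖d‖ ^ 2 + (‖y - x‖ + l * ‖e‖) * ‖d‖ / l := by
      rw [← sub_le_iff_le_add', le_div_iff₀ hl]
      linarith
    have h6 := div_le_div_of_nonneg_left hN hb hbl
    have h7 : (‖y - x‖ / b + l * ‖e‖ / b) * ‖d‖ = (‖y - x‖ + l * ‖e‖) * ‖d‖ / b := by ring
    linarith
  have hR : 0 ≤ α * ‖d‖ ^ 2 + (‖y - x‖ / b + l * ‖e‖ / b) * ‖d‖ := by positivity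
  have hin3 : l₀ * inner ℝ u d ≤ α * ‖d‖ ^ 2 + (‖y - x‖ / b + l * ‖e‖ / b) * ‖d‖ := by
    nlinarith [mul_le_mul_of_nonneg_left hin2 hl₀, mul_le_mul_of_nonneg_right hl₀1 hR]
  have hsplit : ‖d‖ ^ 2 = inner ℝ (d - l₀ • u₀) d - l₀ * inner ℝ (u - u₀) d
      + l₀ * inner ℝ u d := by
    rw [inner_sub_left, inner_sub_left, real_inner_smul_left, real_inner_self_eq_norm_sq]; ring
  have c4 := real_inner_le_norm (d - l₀ • u₀) d
  have c5 : -(l₀ * inner ℝ (u - u₀) d) ≤ ‖u - u₀‖ * ‖d‖ := by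
    have h8 : -inner ℝ (u - u₀) d ≤ ‖u - u₀‖ * ‖d‖ := by
      linarith [neg_abs_le (inner ℝ (u - u₀) d), abs_real_inner_le_norm (u - u₀) d]
    have h9 : 0 ≤ ‖u - u₀‖ * ‖d‖ := by positivity
    nlinarith [mul_le_mul_of_nonneg_left h8 hl₀, mul_le_mul_of_nonneg_right hl₀1 h9]
  rw [← hu]
  rcases (norm_nonneg d).eq_or_lt with hd | hd
  · rw [← hd, mul_zero]; positivity
  · refine le_of_mul_le_mul_right ?_ hd
    nlinarith [mul_le_mul_of_nonneg_right hαa (sq_nonneg ‖d‖)]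

/-- The Fejér-type estimate for one step of the inexact inertial iteration. -/
theorem sq_dist_fixed_point_step_le (hT : ∀ x y : H, ‖T x - T y‖ ≤ ‖x - y‖) {p x w e m y : H}
    {α l : ℝ} (hp : T p = p) (hl : 0 ≤ l) (hm : m = x + α • (x - w))
    (hy : y = m + l • (T m + e - m)) :
    ‖y - p‖ ^ 2 + l * (1 - l) * ‖T m - m‖ ^ 2 ≤
      ‖x - p‖ ^ 2 + α * (‖x - p‖ ^ 2 - ‖w - p‖ ^ 2) + α * (1 + α) * ‖x - w‖ ^ 2
        + 2 * ‖y - p‖ * (l * ‖e‖) := by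
  have hmp : ‖m - p‖ ^ 2 = ‖x - p‖ ^ 2 + α * (‖x - p‖ ^ 2 - ‖w - p‖ ^ 2)
      + α * (1 + α) * ‖x - w‖ ^ 2 := by
    have e1 : m - p = (x - p) + α • (x - w) := by rw [hm]; abel
    have e2 : w - p = (x - p) - (x - w) := by abel
    rw [e1, e2, norm_add_sq_real, norm_sub_sq_real (x - p), inner_smul_right, norm_smul, mul_pow,
      Real.norm_eq_abs, sq_abs]
    ring
  have hV : ‖T m - m‖ ^ 2 + 2 * inner ℝ (m - p) (T m - m) ≤ 0 := by
    have h := pow_le_pow_left₀ (norm_nonneg _) (hT m p) 2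
    have e1 : T m - T p = (m - p) + (T m - m) := by rw [hp]; abel
    rw [e1, norm_add_sq_real] at h
    linarith
  have e1 : (m - p) + l • (T m - m) = (y - p) - l • e := by rw [hy]; module
  have h1 : ‖(m - p) + l • (T m - m)‖ ^ 2
      = ‖m - p‖ ^ 2 + 2 * (l * inner ℝ (m - p) (T m - m)) + l ^ 2 * ‖T m - m‖ ^ 2 := by
    rw [norm_add_sq_real, inner_smul_right, norm_smul, mul_pow, Real.norm_eq_abs, sq_abs]
  have h2 : ‖(y - p) - l • e‖ ^ 2
      = ‖y - p‖ ^ 2 - 2 * (l * inner ℝ (y - p) e) + ‖l • e‖ ^ 2 := by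
    rw [norm_sub_sq_real, inner_smul_right]
  have h3 := mul_le_mul_of_nonneg_left (real_inner_le_norm (y - p) e) hl
  rw [e1, h2] at h1
  nlinarith [mul_le_mul_of_nonneg_left hV hl, sq_nonneg ‖l • e‖]

end Step

/-- Along a bounded inexact inertial iteration, summability of `α k * ‖z (k + 2) - z (k + 1)‖ ^ 2`
transfers to the preceding increments. -/
theorem summable_inertia_mul_sq_increment {H : Type*} [NormedAddCommGroup H]
    [InnerProductSpace ℝ H] {T : H → H} (hT : ∀ x y : H, ‖T x - T y‖ ≤ ‖x - y‖)
    {z e : ℕ → H} {α lam : ℕ → ℝ} {a l l' : ℝ}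
    (hz : ∀ k, z (k + 2) = z (k + 1) + α k • (z (k + 1) - z k) +
      lam k • (T (z (k + 1) + α k • (z (k + 1) - z k)) + e k
        - (z (k + 1) + α k • (z (k + 1) - z k))))
    (ha1 : a < 1) (hα : ∀ k, 0 ≤ α k ∧ α k ≤ a) (hl : 0 < l) (hl' : l' < 1)
    (hlam : ∀ k, l ≤ lam k ∧ lam k ≤ l')
    (hsumα : Summable fun k => α k * ‖z (k + 2) - z (k + 1)‖ ^ 2)
    (hsume : Summable fun k => lam k * ‖e k‖) (hbdd : ∃ M : ℝ, ∀ k, ‖z k‖ ≤ M) :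
    Summable fun k => α k * ‖z (k + 1) - z k‖ ^ 2 := by
  obtain ⟨B, hB⟩ := hbdd
  have hB0 : 0 ≤ B := (norm_nonneg _).trans (hB 0)
  have hD : ∀ k, ‖z (k + 1) - z k‖ ≤ 2 * B := fun k => by
    linarith [norm_sub_le (z (k + 1)) (z k), hB k, hB (k + 1)]
  have hlam0 : ∀ k, 0 < lam k := fun k => hl.trans_le (hlam k).1
  have hlam1 : ∀ k, lam k ≤ 1 := fun k => (hlam k).2.trans hl'.le
  have hα0 : ∀ k, 0 ≤ α k := fun k => (hα k).1
  set E : ℕ → ℝ := fun k => lam k * ‖e k‖ with hE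
  have hE0 : ∀ k, 0 ≤ E k := fun k => mul_nonneg (hlam0 k).le (norm_nonneg _)
  have hEsq : Summable fun k => E k ^ 2 := by
    refine Summable.of_nonneg_of_le (fun k => sq_nonneg _) (fun k => ?_)
      (hsume.mul_left (∑' i, E i))
    rw [sq]
    exact mul_le_mul_of_nonneg_right (hsume.le_tsum k fun i _ => hE0 i) (hE0 k)
  set u : ℕ → H := fun k => T (z (k + 1)) - z (k + 1) with hu
  set c : ℕ → ℝ := fun k => α k * ‖z (k + 2) - z (k + 1)‖ ^ 2 with hc
  set x : ℕ → ℝ := fun k => α k * ‖z (k + 1) - z k‖ ^ 2 with hx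
  have hx0 : ∀ k, 0 ≤ x k := fun k => mul_nonneg (hα0 k) (sq_nonneg _)
  have hc0 : ∀ k, 0 ≤ c k := fun k => mul_nonneg (hα0 k) (sq_nonneg _)
  have hmom : ∀ k, ‖z (k + 2) - z (k + 1) - lam k • u k‖ ≤
      α k * ‖z (k + 1) - z k‖ + E k := fun k =>
    norm_inertial_step_sub_le hT (hα0 k) (hlam0 k).le (hlam1 k) (hz k)
  have ht : 0 < 1 - l' := by linarith
  have ha : 0 < 1 - a := by linarith
  obtain ⟨K, hK⟩ : ∃ K : ℝ, K = 4 / (1 - a) ^ 2 := ⟨_, rfl⟩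
  have hK0 : 0 < K := by rw [hK]; positivity
  have hres : ∀ (s : ℝ), 0 < s → ∀ k, ‖u (k + 1)‖ ^ 2 + (1 - l') * ‖u (k + 1) - u k‖ ^ 2 ≤
      ‖u k‖ ^ 2 + s * x k + (4 / (s * l ^ 2) * c k + 8 * B / l * E k) := by
    intro s hs k
    have h := residual_sq_step_le hT (hmom k)
    set D := ‖z (k + 1) - z k‖ with hDk
    set D' := ‖z (k + 2) - z (k + 1)‖ with hDk'
    have hD0 : 0 ≤ D := norm_nonneg _
    have hD'0 : 0 ≤ D' := norm_nonneg _
    change lam k * (‖u (k + 1)‖ ^ 2 - ‖u k‖ ^ 2) + (1 - lam k) * ‖u (k + 1) - u k‖ ^ 2 ≤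
      4 * (D' * (α k * D + E k)) at h
    have hrhs : 0 ≤ 4 * (D' * (α k * D + E k)) :=
      mul_nonneg (by norm_num) (mul_nonneg hD'0 (add_nonneg (mul_nonneg (hα0 k) hD0) (hE0 k)))
    have h1 : ‖u (k + 1)‖ ^ 2 - ‖u k‖ ^ 2 + (1 - l') * ‖u (k + 1) - u k‖ ^ 2 ≤
        4 * (D' * (α k * D + E k)) / l := by
      refine le_trans ?_ (div_le_div_of_nonneg_left hrhs hl (hlam k).1)
      rw [le_div_iff₀ (hlam0 k)]
      have h2 : lam k * (1 - l') ≤ 1 - lam k := by nlinarith [hlam1 k, (hlam k).2, hlam0 k]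
      nlinarith [mul_le_mul_of_nonneg_right h2 (sq_nonneg ‖u (k + 1) - u k‖)]
    have h3 : 4 * (D' * D) / l ≤ s * D ^ 2 + 4 / (s * l ^ 2) * D' ^ 2 := by
      have : s * D ^ 2 + 4 / (s * l ^ 2) * D' ^ 2 - 4 * (D' * D) / l =
          s * (D - 2 / (s * l) * D') ^ 2 := by field_simp; ring
      have := mul_nonneg hs.le (sq_nonneg (D - 2 / (s * l) * D'))
      linarith
    have h4 : 4 * (D' * E k) / l ≤ 8 * B / l * E k := by
      have := hD (k + 1)
      have := hE0 k
      calc 4 * (D' * E k) / l ≤ 4 * (2 * B * E k) / l := by gcongr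
        _ = 8 * B / l * E k := by ring
    have h5 : 4 * (D' * (α k * D + E k)) / l =
        α k * (4 * (D' * D) / l) + 4 * (D' * E k) / l := by ring
    have h6 := mul_le_mul_of_nonneg_left h3 (hα0 k)
    have h7 : α k * (s * D ^ 2 + 4 / (s * l ^ 2) * D' ^ 2) =
        s * x k + 4 / (s * l ^ 2) * c k := by simp only [hx, hc, ← hDk, ← hDk']; ring
    linarith
  have hinc : ∀ k, x (k + 1) ≤ 1 / 2 * x k + K * ‖u (k + 1) - u k‖ ^ 2 +
      (K * (2 * E k ^ 2 + E (k + 1) ^ 2 / l ^ 2) + K / l ^ 2 * c (k + 1) + 4 * K * c k) := by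
    intro k
    have h := mul_norm_increment_le hT (u₀ := u k) (hα0 (k + 1)) (hα (k + 1)).2 hl
      (hlam (k + 1)).1 (hlam1 (k + 1)) (hlam0 k).le (hlam1 k) (hz (k + 1))
    rw [hK]
    exact mul_sq_le_of_increment_bound ha1 hl (hα0 (k + 1)) ((hα (k + 1)).2.trans ha1.le) (hα0 k)
      (norm_nonneg _) (norm_nonneg _) (hmom k) h
  obtain ⟨L, hL⟩ : ∃ L : ℝ, L = K / (1 - l') := ⟨_, rfl⟩
  have hL0 : 0 < L := by rw [hL]; positivity
  have hLt : L * (1 - l') = K := by rw [hL]; field_simp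
  obtain ⟨s, hs⟩ : ∃ s : ℝ, s = 1 / (4 * L) := ⟨_, rfl⟩
  have hs0 : 0 < s := by rw [hs]; positivity
  have hLs : L * s = 1 / 4 := by rw [hs]; field_simp
  have hsum : Summable fun k => 1 / 4 * x k := by
    refine summable_of_add_le_add (W := fun k => x k + L * ‖u k‖ ^ 2)
      (r := fun k => (K * (2 * E k ^ 2 + E (k + 1) ^ 2 / l ^ 2) + K / l ^ 2 * c (k + 1)
        + 4 * K * c k) + L * (4 / (s * l ^ 2) * c k + 8 * B / l * E k))
      (fun k => add_nonneg (hx0 k) (by positivity)) (fun k => by linarith [hx0 k])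
      (fun k => ?_) ?_ (fun k => ?_)
    · have := hc0 k
      have := hc0 (k + 1)
      have := hE0 k
      positivity
    · have hE1 := (summable_nat_add_iff 1).2 hEsq
      have hc1 := (summable_nat_add_iff 1).2 hsumα
      exact ((((hEsq.mul_left 2).add (hE1.div_const _)).mul_left K).add (hc1.mul_left _)
        |>.add (hsumα.mul_left _)).add
          (((hsumα.mul_left _).add (hsume.mul_left _)).mul_left L)
    · have h1 := mul_le_mul_of_nonneg_left (hres s hs0 k) hL0.le
      have h2 := hinc k
      have h3 : L * (‖u (k + 1)‖ ^ 2 + (1 - l') * ‖u (k + 1) - u k‖ ^ 2) =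
          L * ‖u (k + 1)‖ ^ 2 + K * ‖u (k + 1) - u k‖ ^ 2 := by rw [← hLt]; ring
      have h4 : L * (‖u k‖ ^ 2 + s * x k + (4 / (s * l ^ 2) * c k + 8 * B / l * E k)) =
          L * ‖u k‖ ^ 2 + 1 / 4 * x k + L * (4 / (s * l ^ 2) * c k + 8 * B / l * E k) := by
        rw [← hLs]; ring
      rw [h3, h4] at h1
      linarith
  simpa using hsum.mul_left 4

/-- Convergence-rate theorem under conditions (I): with
Δ = α ∑_{k≥1} [‖z^k−z*‖²−‖z^{k−1}−z*‖²]_+ + ∑_{k≥1} 2‖z^{k+1}−z*‖ λ_k ‖e^k‖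
    + ∑_{k≥1} α_k(1+α_k)‖z^k−z^{k−1}‖²,
one has Δ < ∞ and min_{1≤i≤k} ‖Tμ^i − μ^i‖² ≤ (‖z^1 − z*‖² + Δ)/(k λ (1−λ')).
Here `z (k+1)` stands for `z^k` (so `z 0` is `z^{-1}`). -/
theorem inexact_inertial_KM_condI_rate
    {H : Type*} [NormedAddCommGroup H] [InnerProductSpace ℝ H] [CompleteSpace H]
    (T : H → H) (hT : ∀ x y : H, ‖T x - T y‖ ≤ ‖x - y‖)
    (hfix : ∃ p : H, T p = p)
    (z μ e : ℕ → H) (α lam : ℕ → ℝ) (a l l' : ℝ)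
    -- the iteration: `z (k+1)` stands for `z^k` (so `z 0` is `z^{-1}`), `μ k` for `μ^k`
    (hμ : ∀ k, μ k = z (k + 1) + α k • (z (k + 1) - z k))
    (hz : ∀ k, z (k + 2) = μ k + lam k • (T (μ k) + e k - μ k))
    -- conditions (I)
    (ha0 : 0 ≤ a) (ha1 : a < 1)
    (hα : ∀ k, 0 ≤ α k ∧ α k ≤ a)
    (hl : 0 < l) (hl' : l' < 1)
    (hlam : ∀ k, l ≤ lam k ∧ lam k ≤ l')
    (hsumα : Summable fun k => α k * ‖z (k + 2) - z (k + 1)‖ ^ 2)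
    (hsume : Summable fun k => lam k * ‖e k‖)
    (hbdd : ∃ M : ℝ, ∀ k, ‖z k‖ ≤ M)
    (zs : H) (hzs : T zs = zs) :
    (Summable fun k => max (‖z (k + 2) - zs‖ ^ 2 - ‖z (k + 1) - zs‖ ^ 2) 0) ∧
    (Summable fun k => 2 * ‖z (k + 3) - zs‖ * (lam (k + 1) * ‖e (k + 1)‖)) ∧
    (Summable fun k => α (k + 1) * (1 + α (k + 1)) * ‖z (k + 2) - z (k + 1)‖ ^ 2) ∧
    ∀ k : ℕ, 1 ≤ k → ∃ i : ℕ, 1 ≤ i ∧ i ≤ k ∧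
      ‖T (μ i) - μ i‖ ^ 2 ≤
        (‖z 2 - zs‖ ^ 2 +
            (a * (∑' j : ℕ, max (‖z (j + 2) - zs‖ ^ 2 - ‖z (j + 1) - zs‖ ^ 2) 0)
              + (∑' j : ℕ, 2 * ‖z (j + 3) - zs‖ * (lam (j + 1) * ‖e (j + 1)‖))
              + (∑' j : ℕ, α (j + 1) * (1 + α (j + 1)) * ‖z (j + 2) - z (j + 1)‖ ^ 2)))
          / (k * l * (1 - l')) := by
  obtain ⟨M, hM⟩ := hbdd
  have hlam0 : ∀ k, 0 ≤ lam k := fun k => hl.le.trans (hlam k).1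
  have hα0 : ∀ k, 0 ≤ α k := fun k => (hα k).1
  have hinertia : Summable fun k => α k * ‖z (k + 1) - z k‖ ^ 2 :=
    summable_inertia_mul_sq_increment hT (fun k => by rw [hz k, hμ k]) ha1 hα hl hl' hlam
      hsumα hsume ⟨M, hM⟩
  have h3 : Summable fun k => α k * (1 + α k) * ‖z (k + 1) - z k‖ ^ 2 := by
    refine Summable.of_nonneg_of_le (fun k => ?_) (fun k => ?_) (hinertia.mul_left 2)
    · have := hα0 k
      positivity
    · have := hα k
      nlinarith [mul_nonneg (hα0 k) (sq_nonneg ‖z (k + 1) - z k‖)]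
  have h2 : Summable fun k => 2 * ‖z (k + 2) - zs‖ * (lam k * ‖e k‖) := by
    refine Summable.of_nonneg_of_le (fun k => ?_) (fun k => ?_)
      (hsume.mul_left (2 * (M + ‖zs‖)))
    · have := hlam0 k
      positivity
    · have := hlam0 k
      gcongr
      linarith [norm_sub_le (z (k + 2)) zs, hM (k + 2)]
  have hstep : ∀ k, ‖z (k + 2) - zs‖ ^ 2 + lam k * (1 - lam k) * ‖T (μ k) - μ k‖ ^ 2 ≤
      ‖z (k + 1) - zs‖ ^ 2 + α k * (‖z (k + 1) - zs‖ ^ 2 - ‖z k - zs‖ ^ 2)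
        + α k * (1 + α k) * ‖z (k + 1) - z k‖ ^ 2
        + 2 * ‖z (k + 2) - zs‖ * (lam k * ‖e k‖) := fun k =>
    sq_dist_fixed_point_step_le hT hzs (hlam0 k) (hμ k) (hz k)
  have hplus : ∀ k, α k * (‖z (k + 1) - zs‖ ^ 2 - ‖z k - zs‖ ^ 2) ≤
      a * max (‖z (k + 1) - zs‖ ^ 2 - ‖z k - zs‖ ^ 2) 0 := fun k =>
    (mul_le_mul_of_nonneg_left (le_max_left _ 0) (hα0 k)).trans
      (mul_le_mul_of_nonneg_right (hα k).2 (le_max_right _ _))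
  have hgap : ∀ k, l * (1 - l') ≤ lam k * (1 - lam k) := fun k => by
    have := hlam k
    exact mul_le_mul this.1 (by linarith) (by linarith) (hlam0 k)
  have hc : 0 < l * (1 - l') := mul_pos hl (by linarith)
  have hstep' : ∀ k, ‖z (k + 2) - zs‖ ^ 2 + l * (1 - l') * ‖T (μ k) - μ k‖ ^ 2 ≤
      ‖z (k + 1) - zs‖ ^ 2 + (a * max (‖z (k + 1) - zs‖ ^ 2 - ‖z k - zs‖ ^ 2) 0
        + 2 * ‖z (k + 2) - zs‖ * (lam k * ‖e k‖)
        + α k * (1 + α k) * ‖z (k + 1) - z k‖ ^ 2) := fun k => by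
    linarith [hstep k, hplus k,
      mul_le_mul_of_nonneg_right (hgap k) (sq_nonneg ‖T (μ k) - μ k‖)]
  have h2nn : ∀ k, 0 ≤ 2 * ‖z (k + 2) - zs‖ * (lam k * ‖e k‖) := fun k => by
    have := hlam0 k
    positivity
  have h3nn : ∀ k, 0 ≤ α k * (1 + α k) * ‖z (k + 1) - z k‖ ^ 2 := fun k => by
    have := hα0 k
    positivity
  have h1 : Summable fun k => max (‖z (k + 1) - zs‖ ^ 2 - ‖z k - zs‖ ^ 2) 0 := by
    have ha : 0 < 1 - a := by linarith
    have hs := summable_of_add_le_add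
      (W := fun k => max (‖z (k + 1) - zs‖ ^ 2 - ‖z k - zs‖ ^ 2) 0)
      (x := fun k => (1 - a) * max (‖z (k + 1) - zs‖ ^ 2 - ‖z k - zs‖ ^ 2) 0)
      (fun k => le_max_right _ _) (fun k => mul_nonneg ha.le (le_max_right _ _))
      (fun k => add_nonneg (h2nn k) (h3nn k)) (h2.add h3) (fun k => ?_)
    · exact (summable_mul_left_iff ha.ne').1 hs
    · have hm : 0 ≤ a * max (‖z (k + 1) - zs‖ ^ 2 - ‖z k - zs‖ ^ 2) 0 :=
        mul_nonneg ha0 (le_max_right _ _)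
      have : max (‖z (k + 2) - zs‖ ^ 2 - ‖z (k + 1) - zs‖ ^ 2) 0 ≤
          a * max (‖z (k + 1) - zs‖ ^ 2 - ‖z k - zs‖ ^ 2) 0
          + (2 * ‖z (k + 2) - zs‖ * (lam k * ‖e k‖)
            + α k * (1 + α k) * ‖z (k + 1) - z k‖ ^ 2) :=
        max_le (by linarith [hstep' k, mul_nonneg hc.le (sq_nonneg ‖T (μ k) - μ k‖)])
          (by linarith [h2nn k, h3nn k])
      linarith
  have s1 : Summable fun k => max (‖z (k + 2) - zs‖ ^ 2 - ‖z (k + 1) - zs‖ ^ 2) 0 :=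
    (summable_nat_add_iff 1).2 h1
  have s2 : Summable fun k => 2 * ‖z (k + 3) - zs‖ * (lam (k + 1) * ‖e (k + 1)‖) :=
    (summable_nat_add_iff 1).2 h2
  have s3 : Summable fun k => α (k + 1) * (1 + α (k + 1)) * ‖z (k + 2) - z (k + 1)‖ ^ 2 :=
    (summable_nat_add_iff 1).2 h3
  refine ⟨s1, s2, s3, fun k hk => ?_⟩
  have hsum : ∀ n, ‖z (n + 2) - zs‖ ^ 2
      + ∑ i ∈ Finset.range n, l * (1 - l') * ‖T (μ (i + 1)) - μ (i + 1)‖ ^ 2 ≤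
      ‖z 2 - zs‖ ^ 2
      + (a * ∑ j ∈ Finset.range n, max (‖z (j + 2) - zs‖ ^ 2 - ‖z (j + 1) - zs‖ ^ 2) 0
      + ∑ j ∈ Finset.range n, 2 * ‖z (j + 3) - zs‖ * (lam (j + 1) * ‖e (j + 1)‖)
      + ∑ j ∈ Finset.range n,
          α (j + 1) * (1 + α (j + 1)) * ‖z (j + 2) - z (j + 1)‖ ^ 2) := by
    intro n
    induction n with
    | zero => simp
    | succ n ih =>
      simp only [Finset.sum_range_succ]
      linarith [hstep' (n + 1)]
  have b1 := mul_le_mul_of_nonneg_left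
    (s1.sum_le_tsum (Finset.range k) fun i _ => le_max_right _ _) ha0
  have b2 := s2.sum_le_tsum (Finset.range k) fun i _ => h2nn (i + 1)
  have b3 := s3.sum_le_tsum (Finset.range k) fun i _ => h3nn (i + 1)
  by_contra! hcon
  have hk0 : (0 : ℝ) < k := by exact_mod_cast hk
  have hpos : 0 < (k : ℝ) * l * (1 - l') := by
    rw [mul_assoc]; exact mul_pos hk0 hc
  have hlt := Finset.sum_lt_sum_of_nonempty (s := Finset.range k) ⟨0, Finset.mem_range.2 hk⟩
    fun i hi => mul_lt_mul_of_pos_left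
      (hcon (i + 1) (by omega) (by have := Finset.mem_range.1 hi; omega)) hc
  rw [Finset.sum_const, Finset.card_range, nsmul_eq_mul, ← mul_assoc, ← mul_assoc,
    mul_div_cancel₀ _ hpos.ne'] at hlt
  linarith [hsum k, sq_nonneg ‖z (k + 2) - zs‖]
end

section
/- Let H be a real Hilbert space and T : H → H nonexpansive with z* ∈ Fix(T). Let (z^k), (μ^k) be generated by the inexact inertial Krasnoselskii–Mann iteration and assume conditions (II) hold, and set θ := (δ − α[α(1+α) + αδ + σ])/(δ[1 + α(1+α) + αδ + σ]). Set Δ := α Σ_{k=1}^∞ max(‖z^k − z*‖² − ‖z^{k−1} − z*‖², 0) + Σ_{k=1}^∞ 2‖z^{k+1} − z*‖ λ_k ‖e^k‖ + Σ_{k=1}^∞ α_k(1 + α_k)‖z^k − z^{k−1}‖². Then Δ < +∞ and for every k ≥ 1: min_{1 ≤ i ≤ k} ‖Tμ^i − μ^i‖² ≤ (‖z^1 − z*‖² + Δ) / (k λ (1 − θ)). -/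
open Filter Topology

theorem summable_of_add_mul_le_add {V d ε : ℕ → ℝ} {c m : ℝ} (hc : 0 < c)
    (hV : ∀ k, m ≤ V k) (hd : ∀ k, 0 ≤ d k) (hε0 : ∀ k, 0 ≤ ε k) (hε : Summable ε)
    (h : ∀ k, V (k + 1) + c * d k ≤ V k + ε k) : Summable d := by
  have key : ∀ n, V n + c * ∑ i ∈ Finset.range n, d i ≤ V 0 + ∑ i ∈ Finset.range n, ε i := by
    intro n
    induction n with
    | zero => simp
    | succ n ih =>
      rw [Finset.sum_range_succ, Finset.sum_range_succ]
      linarith [h n]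
  refine summable_of_sum_range_le (c := (V 0 - m + ∑' i, ε i) / c) hd fun n => ?_
  rw [le_div_iff₀ hc]
  linarith [key n, hV n, hε.sum_le_tsum (Finset.range n) fun i _ => hε0 i]

/-- One relaxed inertial step from `x, y` with inexact evaluation of `T`. -/
theorem sq_norm_inexact_inertial_step_le {H : Type*} [NormedAddCommGroup H]
    [InnerProductSpace ℝ H] {T : H → H} (hT : ∀ x y : H, ‖T x - T y‖ ≤ ‖x - y‖)
    {p : H} (hp : T p = p) {x y w u e : H} {t r : ℝ} (hw : w = y + t • (y - x))
    (hu : u = w + r • (T w + e - w)) (hr0 : 0 ≤ r) :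
    ‖u - p‖ ^ 2 + r * (1 - r) * ‖T w - w‖ ^ 2 ≤
      ‖y - p‖ ^ 2 + t * (‖y - p‖ ^ 2 - ‖x - p‖ ^ 2) + t * (1 + t) * ‖y - x‖ ^ 2
        + 2 * ‖u - p‖ * (r * ‖e‖) := by
  have h1 : ‖w - p‖ ^ 2 = ‖y - p‖ ^ 2 + t * (‖y - p‖ ^ 2 - ‖x - p‖ ^ 2)
      + t * (1 + t) * ‖y - x‖ ^ 2 := by
    have e1 : w - p = (1 + t) • (y - p) - t • (x - p) := by rw [hw]; module
    have e2 : y - x = (y - p) - (x - p) := by abel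
    rw [e1, e2, norm_sub_sq_real, norm_sub_sq_real (y - p), norm_smul, norm_smul, mul_pow,
      mul_pow, inner_smul_left, inner_smul_right, Real.norm_eq_abs, Real.norm_eq_abs, sq_abs, sq_abs]
    simp only [conj_trivial]
    ring
  have h2 : ‖T w - p‖ ^ 2 ≤ ‖w - p‖ ^ 2 := by
    have := hT w p
    rw [hp] at this
    gcongr
  have h3 : ‖u - p - r • e‖ ^ 2 + r * (1 - r) * ‖T w - w‖ ^ 2
      = (1 - r) * ‖w - p‖ ^ 2 + r * ‖T w - p‖ ^ 2 := by
    have e1 : u - p - r • e = (1 - r) • (w - p) + r • (T w - p) := by rw [hu]; module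
    have e2 : T w - w = (T w - p) - (w - p) := by abel
    rw [e1, e2, norm_add_sq_real, norm_sub_sq_real (T w - p), norm_smul, norm_smul, mul_pow, mul_pow,
      inner_smul_left, inner_smul_right, Real.norm_eq_abs, Real.norm_eq_abs, sq_abs, sq_abs,
      real_inner_comm (w - p) (T w - p)]
    simp only [conj_trivial]
    ring
  have h4 : ‖u - p‖ ^ 2 ≤ ‖u - p - r • e‖ ^ 2 + 2 * ‖u - p‖ * (r * ‖e‖) := by
    have := real_inner_le_norm (u - p) e
    rw [norm_sub_sq_real (u - p), inner_smul_right]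
    nlinarith [sq_nonneg ‖r • e‖, mul_le_mul_of_nonneg_left this hr0]
  nlinarith [mul_le_mul_of_nonneg_left h2 hr0]

/-- Lower bound of the residual by consecutive increments, from Young's inequality with
parameter `t + δ * r`. -/
theorem inexact_inertial_residual_lower_bound {H : Type*} [NormedAddCommGroup H]
    [InnerProductSpace ℝ H] {s s' v e : H} {t r δ N : ℝ} (ht0 : 0 ≤ t) (ht1 : t ≤ 1)
    (hr0 : 0 < r) (hr1 : r ≤ 1) (hδ : 0 < δ) (hs : ‖s‖ ≤ N) (hs' : ‖s'‖ ≤ N)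
    (h : s' - t • s = r • (v + e)) :
    (1 - r) * δ / (t + δ * r) * ‖s'‖ ^ 2 ≤
      r * (1 - r) * ‖v‖ ^ 2 + t * (1 - r) * δ * ‖s‖ ^ 2 + 4 * N * ‖e‖ := by
  have hD : 0 < t + δ * r := by positivity
  have hw : ‖s' - t • s‖ ≤ 2 * N := by
    have := norm_sub_le s' (t • s)
    rw [norm_smul, Real.norm_of_nonneg ht0] at this
    nlinarith [norm_nonneg s]
  have h1 : ‖s' - t • s‖ ^ 2 ≤ r ^ 2 * ‖v‖ ^ 2 + 4 * N * r * ‖e‖ := by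
    have e1 : r • v = (s' - t • s) - r • e := by rw [h]; module
    have e2 : r ^ 2 * ‖v‖ ^ 2 = ‖(s' - t • s) - r • e‖ ^ 2 := by
      rw [← e1, norm_smul, mul_pow, Real.norm_eq_abs, sq_abs]
    have h3 := real_inner_le_norm (s' - t • s) e
    have h4 := mul_le_mul_of_nonneg_right hw (norm_nonneg e)
    rw [e2, norm_sub_sq_real (s' - t • s), inner_smul_right]
    nlinarith [sq_nonneg ‖r • e‖, mul_le_mul_of_nonneg_left (h3.trans h4) hr0.le]
  have h2 : δ * r / (t + δ * r) * ‖s'‖ ^ 2 ≤ ‖s' - t • s‖ ^ 2 + t * δ * r * ‖s‖ ^ 2 := by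
    have e1 : ‖s' - t • s‖ ^ 2 = ‖s'‖ ^ 2 - 2 * t * inner ℝ s' s + t ^ 2 * ‖s‖ ^ 2 := by
      rw [norm_sub_sq_real, inner_smul_right, norm_smul, mul_pow, Real.norm_eq_abs, sq_abs]
      ring
    have h3 := mul_le_mul_of_nonneg_left (real_inner_le_norm s' s) ht0
    have h4 : δ * r / (t + δ * r) * ‖s'‖ ^ 2 ≤
        ‖s'‖ ^ 2 - 2 * t * (‖s'‖ * ‖s‖) + t ^ 2 * ‖s‖ ^ 2 + t * δ * r * ‖s‖ ^ 2 := by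
      rw [div_mul_eq_mul_div, div_le_iff₀ hD]
      nlinarith [mul_nonneg ht0 (sq_nonneg (‖s'‖ - (t + δ * r) * ‖s‖))]
    linarith
  have h5 : δ / (t + δ * r) * ‖s'‖ ^ 2 ≤ r * ‖v‖ ^ 2 + t * δ * ‖s‖ ^ 2 + 4 * N * ‖e‖ := by
    refine le_of_mul_le_mul_left ?_ hr0
    calc r * (δ / (t + δ * r) * ‖s'‖ ^ 2) = δ * r / (t + δ * r) * ‖s'‖ ^ 2 := by ring
      _ ≤ _ := by linarith
  have hNe : 0 ≤ 4 * N * ‖e‖ := by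
    have := (norm_nonneg s).trans hs
    positivity
  calc (1 - r) * δ / (t + δ * r) * ‖s'‖ ^ 2 = (1 - r) * (δ / (t + δ * r) * ‖s'‖ ^ 2) := by ring
    _ ≤ (1 - r) * (r * ‖v‖ ^ 2 + t * δ * ‖s‖ ^ 2 + 4 * N * ‖e‖) :=
      mul_le_mul_of_nonneg_left h5 (by linarith)
    _ ≤ _ := by nlinarith

/-- Convergence-rate theorem under conditions (II), with
θ = (δ − α[α(1+α) + αδ + σ])/(δ[1 + α(1+α) + αδ + σ]) and
Δ = α ∑_{k≥1} [‖z^k−z*‖²−‖z^{k−1}−z*‖²]_+ + ∑_{k≥1} 2‖z^{k+1}−z*‖ λ_k ‖e^k‖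
    + ∑_{k≥1} α_k(1+α_k)‖z^k−z^{k−1}‖²:
Δ < ∞ and min_{1≤i≤k} ‖Tμ^i − μ^i‖² ≤ (‖z^1 − z*‖² + Δ)/(k λ (1−θ)).
Here `z (k+1)` stands for `z^k` (so `z 0` is `z^{-1}`). -/
theorem inexact_inertial_KM_condII_rate
    {H : Type*} [NormedAddCommGroup H] [InnerProductSpace ℝ H] [CompleteSpace H]
    (T : H → H) (hT : ∀ x y : H, ‖T x - T y‖ ≤ ‖x - y‖)
    (hfix : ∃ p : H, T p = p)
    (z μ e : ℕ → H) (α lam : ℕ → ℝ) (a l σ δ : ℝ)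
    -- the iteration: `z (k+1)` stands for `z^k` (so `z 0` is `z^{-1}`), `μ k` for `μ^k`
    (hμ : ∀ k, μ k = z (k + 1) + α k • (z (k + 1) - z k))
    (hz : ∀ k, z (k + 2) = μ k + lam k • (T (μ k) + e k - μ k))
    -- conditions (II)
    (hαmono : Monotone α) (hα0 : α 0 = 0)
    (hα : ∀ k, 0 ≤ α k ∧ α k ≤ a) (ha1 : a < 1)
    (hl : 0 < l) (hσ : 0 < σ) (hδ : 0 < δ)
    (hδbig : δ > a * (a * (1 + a) + σ) / (1 - a ^ 2))
    (hlam : ∀ k, l ≤ lam k ∧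
      lam k ≤ (δ - a * (a * (1 + a) + a * δ + σ)) / (δ * (1 + a * (1 + a) + a * δ + σ)))
    (hbdd : ∃ M : ℝ, ∀ k, ‖z k‖ ≤ M)
    (hsume : Summable fun k => ‖e k‖)
    (zs : H) (hzs : T zs = zs) :
    (Summable fun k => max (‖z (k + 2) - zs‖ ^ 2 - ‖z (k + 1) - zs‖ ^ 2) 0) ∧
    (Summable fun k => 2 * ‖z (k + 3) - zs‖ * (lam (k + 1) * ‖e (k + 1)‖)) ∧
    (Summable fun k => α (k + 1) * (1 + α (k + 1)) * ‖z (k + 2) - z (k + 1)‖ ^ 2) ∧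
    ∀ k : ℕ, 1 ≤ k → ∃ i : ℕ, 1 ≤ i ∧ i ≤ k ∧
      ‖T (μ i) - μ i‖ ^ 2 ≤
        (‖z 2 - zs‖ ^ 2 +
            (a * (∑' j : ℕ, max (‖z (j + 2) - zs‖ ^ 2 - ‖z (j + 1) - zs‖ ^ 2) 0)
              + (∑' j : ℕ, 2 * ‖z (j + 3) - zs‖ * (lam (j + 1) * ‖e (j + 1)‖))
              + (∑' j : ℕ, α (j + 1) * (1 + α (j + 1)) * ‖z (j + 2) - z (j + 1)‖ ^ 2)))
          / (k * l *
              (1 - (δ - a * (a * (1 + a) + a * δ + σ))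
                    / (δ * (1 + a * (1 + a) + a * δ + σ)))) := by
  have ha0 : 0 ≤ a := (hα 0).1.trans (hα 0).2
  set C := a * (1 + a) + a * δ + σ with hC
  have hC0 : 0 < C := by positivity
  have hden : δ * (1 + a * (1 + a) + a * δ + σ) = δ * (1 + C) := by rw [hC]; ring
  rw [hden] at hlam ⊢
  set θ := (δ - a * C) / (δ * (1 + C)) with hθ
  have hθ1 : θ < 1 := by
    rw [hθ, div_lt_one (by positivity)]
    nlinarith [mul_pos hδ hC0, mul_nonneg ha0 hC0.le]
  have hl0 : ∀ k, 0 < lam k := fun k => hl.trans_le (hlam k).1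
  have hl1 : ∀ k, lam k < 1 := fun k => (hlam k).2.trans_lt hθ1
  obtain ⟨M, hM⟩ := hbdd
  have hN : ∀ k, ‖z k - zs‖ ≤ M + ‖zs‖ := fun k => (norm_sub_le _ _).trans (by linarith [hM k])
  set N := M + ‖zs‖
  have hN0 : 0 ≤ N := (norm_nonneg _).trans (hN 0)
  have hdN : ∀ k, ‖z (k + 1) - z k‖ ≤ 2 * N := fun k => by
    have := norm_sub_le (z (k + 1) - zs) (z k - zs)
    rw [sub_sub_sub_cancel_right] at this
    linarith [hN k, hN (k + 1)]
  have hstep := fun k => sq_norm_inexact_inertial_step_le hT hzs (hμ k) (hz k) (hl0 k).le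
  have hres := fun k => inexact_inertial_residual_lower_bound (e := e k) (v := T (μ k) - μ k)
    (s := z (k + 1) - z k) (s' := z (k + 2) - z (k + 1)) (hα k).1 ((hα k).2.trans ha1.le)
    (hl0 k) (hl1 k).le hδ (hdN k) (hdN (k + 1)) (by
      have h1 := hz k
      have h2 := hμ k
      calc z (k + 2) - z (k + 1) - α k • (z (k + 1) - z k)
          = z (k + 2) - (z (k + 1) + α k • (z (k + 1) - z k)) := by abel
        _ = z (k + 2) - μ k := by rw [← h2]
        _ = lam k • (T (μ k) - μ k + e k) := by rw [h1]; module)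
  have herr : ∀ k, 2 * ‖z (k + 2) - zs‖ * (lam k * ‖e k‖) ≤ 2 * N * ‖e k‖ := fun k => by
    have h1 : lam k * ‖e k‖ ≤ ‖e k‖ := mul_le_of_le_one_left (norm_nonneg _) (hl1 k).le
    have := hN (k + 2)
    have := (hl0 k).le
    gcongr
  have herr0 : ∀ k, 0 ≤ 2 * ‖z (k + 2) - zs‖ * (lam k * ‖e k‖) := fun k => by
    have := (hl0 k).le
    positivity
  have hsumErr : Summable fun k => 2 * ‖z (k + 2) - zs‖ * (lam k * ‖e k‖) :=
    Summable.of_nonneg_of_le herr0 herr (hsume.mul_left _)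
  have hsumInc : Summable fun k => ‖z (k + 2) - z (k + 1)‖ ^ 2 := by
    refine summable_of_add_mul_le_add (c := σ) (m := -N ^ 2) (ε := fun k => 10 * N * ‖e k‖)
      (V := fun k => ‖z (k + 1) - zs‖ ^ 2 - α k * ‖z k - zs‖ ^ 2
        + (a * (1 + a) + a * δ) * ‖z (k + 1) - z k‖ ^ 2) hσ (fun k => ?_) (fun k => sq_nonneg _)
      (fun k => by positivity) (hsume.mul_left _) (fun k => ?_)
    · have h1 : α k * ‖z k - zs‖ ^ 2 ≤ 1 * N ^ 2 := by
        have := (hα k).2.trans ha1.le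
        have := hN k
        gcongr
      have h2 : 0 ≤ (a * (1 + a) + a * δ) * ‖z (k + 1) - z k‖ ^ 2 := by positivity
      linarith [sq_nonneg ‖z (k + 1) - zs‖]
    · have hκ : C ≤ (1 - lam k) * δ / (α k + δ * lam k) := by
        rw [le_div_iff₀ (add_pos_of_nonneg_of_pos (hα k).1 (mul_pos hδ (hl0 k)))]
        have h1 := (hlam k).2
        rw [hθ, le_div_iff₀ (by positivity)] at h1
        nlinarith [mul_le_mul_of_nonneg_left (hα k).2 hC0.le]
      have h1 := mul_le_mul_of_nonneg_right hκ (sq_nonneg ‖z (k + 2) - z (k + 1)‖)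
      have h2 := mul_le_mul_of_nonneg_right (hαmono k.le_succ) (sq_nonneg ‖z (k + 1) - zs‖)
      have hγ : α k * (1 + α k) + α k * (1 - lam k) * δ ≤ a * (1 + a) + a * δ := by
        have h3 := hα k
        have h4 : α k * (1 - lam k) ≤ a := by nlinarith [hl0 k]
        have h5 : α k * (1 + α k) ≤ a * (1 + a) := by nlinarith
        nlinarith
      have h3 := mul_le_mul_of_nonneg_right hγ (sq_nonneg ‖z (k + 1) - z k‖)
      have h4 : C * ‖z (k + 2) - z (k + 1)‖ ^ 2 = (a * (1 + a) + a * δ) *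
        ‖z (k + 2) - z (k + 1)‖ ^ 2 + σ * ‖z (k + 2) - z (k + 1)‖ ^ 2 := by rw [hC]; ring
      dsimp only [Nat.succ_eq_add_one] at h2 ⊢
      linarith [hstep k, hres k, herr k]
  have hβ0 : ∀ k, 0 ≤ α k * (1 + α k) := fun k => mul_nonneg (hα k).1 (by linarith [(hα k).1])
  have hsumInertia : Summable fun k =>
      α (k + 1) * (1 + α (k + 1)) * ‖z (k + 2) - z (k + 1)‖ ^ 2 := by
    refine Summable.of_nonneg_of_le (fun k => mul_nonneg (hβ0 _) (sq_nonneg _)) (fun k => ?_)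
      (hsumInc.mul_left 2)
    have h3 := hα (k + 1)
    refine mul_le_mul_of_nonneg_right ?_ (sq_nonneg _)
    nlinarith
  have hstep' : ∀ k, ‖z (k + 3) - zs‖ ^ 2
      + lam (k + 1) * (1 - lam (k + 1)) * ‖T (μ (k + 1)) - μ (k + 1)‖ ^ 2 ≤
      ‖z (k + 2) - zs‖ ^ 2 + α (k + 1) * (‖z (k + 2) - zs‖ ^ 2 - ‖z (k + 1) - zs‖ ^ 2)
      + α (k + 1) * (1 + α (k + 1)) * ‖z (k + 2) - z (k + 1)‖ ^ 2
      + 2 * ‖z (k + 3) - zs‖ * (lam (k + 1) * ‖e (k + 1)‖) := fun k => hstep (k + 1)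
  have hsumErr' : Summable fun k => 2 * ‖z (k + 3) - zs‖ * (lam (k + 1) * ‖e (k + 1)‖) :=
    (summable_nat_add_iff 1).2 hsumErr
  have hmax : ∀ k x, α k * x ≤ a * max x 0 := fun k x =>
    (mul_le_mul_of_nonneg_left (le_max_left x 0) (hα k).1).trans
      (mul_le_mul_of_nonneg_right (hα k).2 (le_max_right x 0))
  have hsumMax : Summable fun k => max (‖z (k + 2) - zs‖ ^ 2 - ‖z (k + 1) - zs‖ ^ 2) 0 := by
    refine summable_of_add_mul_le_add (sub_pos.2 ha1)
      (V := fun k => max (‖z (k + 2) - zs‖ ^ 2 - ‖z (k + 1) - zs‖ ^ 2) 0) (fun k => le_max_right _ _)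
      (fun k => le_max_right _ _) (fun k => add_nonneg (herr0 (k + 1))
        (mul_nonneg (hβ0 (k + 1)) (sq_nonneg ‖z (k + 2) - z (k + 1)‖)))
      (hsumErr'.add hsumInertia) (fun k => ?_)
    have h1 : 0 ≤ lam (k + 1) * (1 - lam (k + 1)) * ‖T (μ (k + 1)) - μ (k + 1)‖ ^ 2 :=
      mul_nonneg (mul_nonneg (hl0 _).le (sub_nonneg.2 (hl1 _).le)) (sq_nonneg _)
    have h2 : max (‖z (k + 3) - zs‖ ^ 2 - ‖z (k + 2) - zs‖ ^ 2) 0 ≤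
        a * max (‖z (k + 2) - zs‖ ^ 2 - ‖z (k + 1) - zs‖ ^ 2) 0
        + (2 * ‖z (k + 3) - zs‖ * (lam (k + 1) * ‖e (k + 1)‖)
          + α (k + 1) * (1 + α (k + 1)) * ‖z (k + 2) - z (k + 1)‖ ^ 2) := by
      refine max_le ?_ (add_nonneg (mul_nonneg ha0 (le_max_right _ _))
        (add_nonneg (herr0 (k + 1)) (mul_nonneg (hβ0 _) (sq_nonneg _))))
      linarith [hstep' k, hmax (k + 1) (‖z (k + 2) - zs‖ ^ 2 - ‖z (k + 1) - zs‖ ^ 2)]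
    linarith
  refine ⟨hsumMax, hsumErr', hsumInertia, fun k hk => ?_⟩
  have htel : ∀ n, ‖z (n + 2) - zs‖ ^ 2
      + l * (1 - θ) * ∑ j ∈ Finset.range n, ‖T (μ (j + 1)) - μ (j + 1)‖ ^ 2 ≤
      ‖z 2 - zs‖ ^ 2
      + (a * (∑ j ∈ Finset.range n, max (‖z (j + 2) - zs‖ ^ 2 - ‖z (j + 1) - zs‖ ^ 2) 0)
        + (∑ j ∈ Finset.range n, 2 * ‖z (j + 3) - zs‖ * (lam (j + 1) * ‖e (j + 1)‖))
        + (∑ j ∈ Finset.range n,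
            α (j + 1) * (1 + α (j + 1)) * ‖z (j + 2) - z (j + 1)‖ ^ 2)) := by
    intro n
    induction n with
    | zero => simp
    | succ n ih =>
      simp only [Finset.sum_range_succ]
      rw [show n + 1 + 2 = n + 3 from rfl]
      have h1 : l * (1 - θ) ≤ lam (n + 1) * (1 - lam (n + 1)) :=
        mul_le_mul (hlam _).1 (by linarith [(hlam (n + 1)).2]) (by linarith) (hl0 _).le
      have h2 := mul_le_mul_of_nonneg_right h1 (sq_nonneg ‖T (μ (n + 1)) - μ (n + 1)‖)
      linarith [hstep' n, hmax (n + 1) (‖z (n + 2) - zs‖ ^ 2 - ‖z (n + 1) - zs‖ ^ 2)]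
  set A := ∑' j : ℕ, max (‖z (j + 2) - zs‖ ^ 2 - ‖z (j + 1) - zs‖ ^ 2) 0
  have hk0 : (0 : ℝ) < k := by exact_mod_cast hk
  have hkl : 0 < k * l * (1 - θ) := mul_pos (mul_pos hk0 hl) (sub_pos.2 hθ1)
  have hbound : l * (1 - θ) * ∑ j ∈ Finset.range k, ‖T (μ (j + 1)) - μ (j + 1)‖ ^ 2 ≤
      ‖z 2 - zs‖ ^ 2 + (a * A
        + (∑' j : ℕ, 2 * ‖z (j + 3) - zs‖ * (lam (j + 1) * ‖e (j + 1)‖))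
        + (∑' j : ℕ, α (j + 1) * (1 + α (j + 1)) * ‖z (j + 2) - z (j + 1)‖ ^ 2)) := by
    linarith [htel k, sq_nonneg ‖z (k + 2) - zs‖,
      mul_le_mul_of_nonneg_left
        (hsumMax.sum_le_tsum (Finset.range k) fun j _ => le_max_right _ _) ha0,
      hsumErr'.sum_le_tsum (Finset.range k) fun j _ => herr0 (j + 1),
      hsumInertia.sum_le_tsum (Finset.range k) fun j _ => mul_nonneg (hβ0 (j + 1)) (sq_nonneg _)]
  obtain ⟨j, hj, hle⟩ := Finset.exists_le_of_sum_le (s := Finset.range k)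
    (f := fun j => ‖T (μ (j + 1)) - μ (j + 1)‖ ^ 2)
    (g := fun _ => (∑ j ∈ Finset.range k, ‖T (μ (j + 1)) - μ (j + 1)‖ ^ 2) / k)
    (Finset.nonempty_range_iff.2 (by omega)) (by
      rw [Finset.sum_const, Finset.card_range, nsmul_eq_mul, mul_div_cancel₀ _ hk0.ne'])
  refine ⟨j + 1, by omega, Finset.mem_range.1 hj, hle.trans ?_⟩
  rw [div_le_div_iff₀ hk0 hkl]
  linarith [mul_le_mul_of_nonneg_left hbound hk0.le]
end

section
/- Let H be a real Hilbert space, T : H → H nonexpansive, and let z^{−1}, z^0 ∈ H, α_k ≥ 0, λ_k > 0 with λ_k ≤ 1, e^k ∈ H, μ^k = z^k + α_k (z^k − z^{k−1}), z^{k+1} = μ^k + λ_k (Tμ^k + e^k − μ^k). Define ē^k := (α_k/λ_k)(z^k − z^{k−1}) + Tμ^k − Tz^k − α_k (z^k − z^{k−1}) + e^k. Then for every k ≥ 0: z^{k+1} = z^k + λ_k (Tz^k − z^k + ē^k) and λ_k ‖ē^k‖ ≤ α_k ‖z^k − z^{k−1}‖ + 2 λ_k α_k ‖z^k − z^{k−1}‖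 + λ_k ‖e^k‖. -/
open Filter Topology

/-- The inexact inertial KM iteration rewritten as an inexact KM iteration: with
ē^k = (α_k/λ_k)(z^k − z^{k−1}) + Tμ^k − Tz^k − α_k(z^k − z^{k−1}) + e^k one has
z^{k+1} = z^k + λ_k (Tz^k − z^k + ē^k) and
λ_k ‖ē^k‖ ≤ α_k ‖z^k − z^{k−1}‖ + 2 λ_k α_k ‖z^k − z^{k−1}‖ + λ_k ‖e^k‖.
Here `z (k+1)` stands for `z^k` (so `z 0` is `z^{-1}`). -/
theorem inexact_inertial_KM_as_inexact_KM
    {H : Type*} [NormedAddCommGroup H] [InnerProductSpace ℝ H] [CompleteSpace H]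
    (T : H → H) (hT : ∀ x y : H, ‖T x - T y‖ ≤ ‖x - y‖)
    (z μ e eb : ℕ → H) (α lam : ℕ → ℝ)
    (hα : ∀ k, 0 ≤ α k)
    (hlam : ∀ k, 0 < lam k ∧ lam k ≤ 1)
    (hμ : ∀ k, μ k = z (k + 1) + α k • (z (k + 1) - z k))
    (hz : ∀ k, z (k + 2) = μ k + lam k • (T (μ k) + e k - μ k))
    (heb : ∀ k, eb k = (α k / lam k) • (z (k + 1) - z k) + T (μ k) - T (z (k + 1))
      - α k • (z (k + 1) - z k) + e k) :
    ∀ k : ℕ,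
      z (k + 2) = z (k + 1) + lam k • (T (z (k + 1)) - z (k + 1) + eb k) ∧
      lam k * ‖eb k‖ ≤ α k * ‖z (k + 1) - z k‖
        + 2 * lam k * α k * ‖z (k + 1) - z k‖ + lam k * ‖e k‖ := by
  intro k
  have hpos := (hlam k).1
  set d := z (k + 1) - z k
  have hμd : μ k - z (k + 1) = α k • d := by rw [hμ k]; abel
  have hscaled : lam k • eb k
      = α k • d + lam k • (T (μ k) - T (z (k + 1)) - α k • d + e k) := by
    have hdiv : α k • d = lam k • ((α k / lam k) • d) := by
      rw [smul_smul, mul_div_cancel₀ _ hpos.ne']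
    rw [heb k]
    nth_rewrite 2 [hdiv]
    rw [← smul_add]
    congr 1
    abel
  refine ⟨?_, ?_⟩
  · rw [smul_add, hscaled, hz k, ← hμd]
    module
  · have hnorm : ‖α k • d‖ = α k * ‖d‖ := by
      rw [norm_smul, Real.norm_of_nonneg (hα k)]
    have hTd : ‖T (μ k) - T (z (k + 1))‖ ≤ α k * ‖d‖ := by
      rw [← hnorm, ← hμd]
      exact hT _ _
    have hinner : ‖T (μ k) - T (z (k + 1)) - α k • d + e k‖
        ≤ α k * ‖d‖ + α k * ‖d‖ + ‖e k‖ := by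
      refine (norm_add_le _ _).trans ?_
      gcongr
      exact (norm_sub_le _ _).trans (add_le_add hTd hnorm.le)
    calc lam k * ‖eb k‖ = ‖lam k • eb k‖ := by
          rw [norm_smul, Real.norm_of_nonneg hpos.le]
      _ ≤ α k * ‖d‖ + lam k * ‖T (μ k) - T (z (k + 1)) - α k • d + e k‖ := by
          rw [hscaled]
          refine (norm_add_le _ _).trans_eq ?_
          rw [hnorm, norm_smul, Real.norm_of_nonneg hpos.le]
      _ ≤ α k * ‖d‖ + lam k * (α k * ‖d‖ + α k * ‖d‖ + ‖e k‖) := by gcongr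
      _ = α k * ‖d‖ + 2 * lam k * α k * ‖d‖ + lam k * ‖e k‖ := by ring
end
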